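/- For every Δ ∈ ℕ and every α > 0 there exist C_* ∈ ℕ and n₀ ∈ ℕ such that the following holds for all n ≥ n₀: let G be an n-vertex graph with minimum degree δ(G) ≥ (1/2+α)n, let T be an n-vertex tree with maximum degree Δ(T) ≤ Δ, let t ∈ V(T) and v ∈ V(G). Then there exists a random embedding φ of T into G such that φ(t) = v with probability 1, and the restriction of φ to V(T) \ {t} is (C_*/n)-spread. -/

import Mathlib

open Finset

/-- `A` is the vertex set of a tree with root `r`, in which `par x` is the parent of a vertex
`x ≠ r`, `dep` increases by one from parent to child, and every vertex has at most `Δ` children. -/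
structure IsRootedTree {ι : Type*} [DecidableEq ι] (par : ι → ι) (dep : ι → ℕ) (Δ : ℕ)
    (A : Finset ι) (r : ι) : Prop where
  root_mem : r ∈ A
  par_mem : ∀ x ∈ A, x ≠ r → par x ∈ A
  dep_eq : ∀ x ∈ A, x ≠ r → dep x = dep (par x) + 1
  card_children : ∀ y, #{x ∈ A | par x = y ∧ dep x = dep y + 1} ≤ Δ

namespace IsRootedTree

variable {ι : Type*} [DecidableEq ι] {par : ι → ι} {dep : ι → ℕ} {Δ : ℕ} {A : Finset ι} {r : ι}

lemma dep_root_le (h : IsRootedTree par dep Δ A r) : ∀ x ∈ A, dep r ≤ dep x := by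
  have key : ∀ k, ∀ x ∈ A, dep x = k → dep r ≤ dep x := by
    intro k
    induction k using Nat.strong_induction_on with
    | _ k ih =>
      intro x hx hk
      by_cases hxr : x = r
      · rw [hxr]
      · have h1 := h.dep_eq x hx hxr
        have h2 := ih (dep (par x)) (by omega) (par x) (h.par_mem x hx hxr) rfl
        omega
  exact fun x hx => key _ x hx rfl

lemma dep_root_lt (h : IsRootedTree par dep Δ A r) {x : ι} (hx : x ∈ A) (hxr : x ≠ r) :
    dep r < dep x := by
  have h1 := h.dep_eq x hx hxr
  have h2 := h.dep_root_le (par x) (h.par_mem x hx hxr)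
  omega

lemma iterate_par (h : IsRootedTree par dep Δ A r) {y : ι} (hy : y ∈ A) (j : ℕ)
    (hj : dep r + j ≤ dep y) : par^[j] y ∈ A ∧ dep (par^[j] y) + j = dep y := by
  induction j with
  | zero => simpa using hy
  | succ j ih =>
    obtain ⟨h1, h2⟩ := ih (by omega)
    have hne : par^[j] y ≠ r := by
      intro h0
      rw [h0] at h2
      omega
    rw [Function.iterate_succ_apply']
    refine ⟨h.par_mem _ h1 hne, ?_⟩
    have := h.dep_eq _ h1 hne
    omega

/-- A parent-closed subset containing the root is again a rooted tree. -/
lemma subset (h : IsRootedTree par dep Δ A r) {D : Finset ι} (hD : D ⊆ A) (hr : r ∈ D)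
    (hpar : ∀ x ∈ D, x ≠ r → par x ∈ D) : IsRootedTree par dep Δ D r where
  root_mem := hr
  par_mem := hpar
  dep_eq x hx := h.dep_eq x (hD hx)
  card_children y := (card_le_card (filter_subset_filter _ hD)).trans (h.card_children y)

/-- A proper parent-closed subset can be extended by one vertex. -/
lemma exists_next (h : IsRootedTree par dep Δ A r) {D : Finset ι} (hD : D ⊆ A) (hr : r ∈ D)
    (hne : D ≠ A) : ∃ y ∈ A, y ∉ D ∧ y ≠ r ∧ par y ∈ D := by
  have hn : (A \ D).Nonempty := by
    rw [sdiff_nonempty]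
    exact fun hs => hne (hD.antisymm hs)
  obtain ⟨y, hy, hmin⟩ := exists_min_image (A \ D) dep hn
  rw [mem_sdiff] at hy
  have hyr : y ≠ r := fun h0 => hy.2 (h0 ▸ hr)
  refine ⟨y, hy.1, hy.2, hyr, ?_⟩
  by_contra hp
  have h1 := hmin (par y) (mem_sdiff.2 ⟨h.par_mem y hy.1 hyr, hp⟩)
  have h2 := h.dep_eq y hy.1 hyr
  omega

end IsRootedTree

/-- The set of descendants of `x` in `A`. -/
def branch {ι : Type*} [DecidableEq ι] (par : ι → ι) (dep : ι → ℕ) (A : Finset ι) (x : ι) :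
    Finset ι :=
  {y ∈ A | dep x ≤ dep y ∧ par^[dep y - dep x] y = x}

namespace IsRootedTree

variable {ι : Type*} [DecidableEq ι] {par : ι → ι} {dep : ι → ℕ} {Δ : ℕ} {A : Finset ι} {r : ι}

lemma branch_root (h : IsRootedTree par dep Δ A r) : branch par dep A r = A := by
  refine filter_true_of_mem fun y hy => ⟨h.dep_root_le y hy, ?_⟩
  have h0 := h.dep_root_le y hy
  obtain ⟨h1, h2⟩ := h.iterate_par hy (dep y - dep r) (by omega)
  by_contra hne
  have := h.dep_root_lt h1 hne
  omega

lemma self_mem_branch {x : ι} (hx : x ∈ A) : x ∈ branch par dep A x := by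
  simp [branch, hx]

lemma par_mem_branch (h : IsRootedTree par dep Δ A r) {x y : ι} (hx : x ∈ A)
    (hy : y ∈ branch par dep A x) (hyx : y ≠ x) : y ≠ r ∧ par y ∈ branch par dep A x := by
  simp only [branch, mem_filter] at hy ⊢
  obtain ⟨hyA, hd, hp⟩ := hy
  have hlt : dep x < dep y := by
    rcases hd.lt_or_eq with h1 | h1
    · exact h1
    · rw [h1] at hp
      simp at hp
      exact absurd hp hyx
  have hyr : y ≠ r := by
    rintro rfl
    have := h.dep_root_le x hx
    omega
  have h2 := h.dep_eq y hyA hyr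
  refine ⟨hyr, h.par_mem y hyA hyr, by omega, ?_⟩
  rw [← Function.iterate_succ_apply]
  convert hp using 2
  omega

lemma mem_branch_of_par (h : IsRootedTree par dep Δ A r) {x y : ι} (hy : y ∈ A) (hyr : y ≠ r)
    (hp : par y ∈ branch par dep A x) : y ∈ branch par dep A x := by
  simp only [branch, mem_filter] at hp ⊢
  have h2 := h.dep_eq y hy hyr
  refine ⟨hy, by omega, ?_⟩
  rw [show dep y - dep x = (dep (par y) - dep x) + 1 by omega, Function.iterate_succ_apply]
  exact hp.2.2

lemma branch_isRootedTree (h : IsRootedTree par dep Δ A r) {x : ι} (hx : x ∈ A) :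
    IsRootedTree par dep Δ (branch par dep A x) x where
  root_mem := self_mem_branch hx
  par_mem _ hy hyx := (h.par_mem_branch hx hy hyx).2
  dep_eq y hy hyx := h.dep_eq y (filter_subset _ _ hy) (h.par_mem_branch hx hy hyx).1
  card_children y :=
    (card_le_card (filter_subset_filter _ (filter_subset _ _))).trans (h.card_children y)

lemma sdiff_branch_isRootedTree (h : IsRootedTree par dep Δ A r) {x : ι} (hx : x ∈ A)
    (hxr : x ≠ r) : IsRootedTree par dep Δ (A \ branch par dep A x) r := by
  refine h.subset sdiff_subset (mem_sdiff.2 ⟨h.root_mem, fun hr => ?_⟩) fun y hy hyr => ?_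
  · exact (h.par_mem_branch hx hr hxr.symm).1 rfl
  · rw [mem_sdiff] at hy ⊢
    exact ⟨h.par_mem y hy.1 hyr, fun hp => hy.2 (h.mem_branch_of_par hy.1 hyr hp)⟩

lemma branch_subset_biUnion (h : IsRootedTree par dep Δ A r) {x : ι} (hx : x ∈ A) :
    branch par dep A x ⊆ insert x
      ({w ∈ A | par w = x ∧ dep w = dep x + 1}.biUnion (branch par dep A)) := by
  intro y hy
  by_cases hyx : y = x
  · simp [hyx]
  refine mem_insert_of_mem (mem_biUnion.2 ?_)
  have hyA : y ∈ A := filter_subset _ _ hy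
  have h1 := hy
  simp only [branch, mem_filter] at h1
  obtain ⟨-, hd, hp⟩ := h1
  have hlt : dep x < dep y := by
    rcases hd.lt_or_eq with h1 | h1
    · exact h1
    · rw [h1] at hp
      simp at hp
      exact absurd hp hyx
  have hr := h.dep_root_le x hx
  obtain ⟨hw, hwd⟩ := h.iterate_par hyA (dep y - dep x - 1) (by omega)
  refine ⟨par^[dep y - dep x - 1] y, mem_filter.2 ⟨hw, ?_, by omega⟩, ?_⟩
  · rw [← Function.iterate_succ_apply' par]
    convert hp using 2
    omega
  · refine mem_filter.2 ⟨hyA, by omega, ?_⟩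
    have he : dep y - dep (par^[dep y - dep x - 1] y) = dep y - dep x - 1 := by omega
    rw [he]

/-- A rooted tree with more than `Δ * M` vertices has a branch with between `M` and `Δ * M`
vertices. -/
lemma exists_branch (h : IsRootedTree par dep Δ A r) (hΔ : 1 ≤ Δ) {M : ℕ} (hM : 1 ≤ M)
    (hA : Δ * M < #A) :
    ∃ q, ∃ Q ⊆ A, q ≠ r ∧ M ≤ #Q ∧ #Q ≤ Δ * M ∧ IsRootedTree par dep Δ Q q ∧
      IsRootedTree par dep Δ (A \ Q) r ∧ par q ∈ A \ Q := by
  have hMA : M ≤ #A := (Nat.le_mul_of_pos_left M hΔ).trans hA.le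
  have hne : {x ∈ A | M ≤ #(branch par dep A x)}.Nonempty :=
    ⟨r, mem_filter.2 ⟨h.root_mem, by rwa [h.branch_root]⟩⟩
  obtain ⟨q, hq, hmax⟩ := exists_max_image _ dep hne
  rw [mem_filter] at hq
  have hcard : #(branch par dep A q) ≤ Δ * M := by
    have h1 : #({w ∈ A | par w = q ∧ dep w = dep q + 1}.biUnion (branch par dep A)) ≤
        Δ * (M - 1) := by
      refine (card_biUnion_le_card_mul _ _ (M - 1) fun w hw => ?_).trans
        (Nat.mul_le_mul_right _ (h.card_children q))
      rw [mem_filter] at hw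
      by_contra hc
      have := hmax w (mem_filter.2 ⟨hw.1, by omega⟩)
      omega
    have h2 := (card_le_card (h.branch_subset_biUnion hq.1)).trans (card_insert_le _ _)
    obtain ⟨m, rfl⟩ : ∃ m, M = m + 1 := ⟨M - 1, by omega⟩
    simp only [Nat.add_sub_cancel] at h1
    rw [mul_add]
    omega
  have hqr : q ≠ r := by
    rintro rfl
    rw [h.branch_root] at hcard
    omega
  refine ⟨q, branch par dep A q, filter_subset _ _, hqr, hq.2, hcard,
    h.branch_isRootedTree hq.1, h.sdiff_branch_isRootedTree hq.1 hqr,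
    mem_sdiff.2 ⟨h.par_mem q hq.1 hqr, fun hp => ?_⟩⟩
  have h1 := h.dep_eq q hq.1 hqr
  simp only [branch, mem_filter] at hp
  omega

end IsRootedTree

/-- `PieceChain S A`: the tree `A` arises from `S` by successively attaching pieces, which are
rooted trees with between `M` and `Δ * M` vertices. -/
inductive PieceChain {ι : Type*} [DecidableEq ι] (par : ι → ι) (dep : ι → ℕ) (Δ M : ℕ) (r : ι)
    (S : Finset ι) : Finset ι → Prop
  | refl : PieceChain par dep Δ M r S S
  | step (A Q : Finset ι) (q : ι) : PieceChain par dep Δ M r S A →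
      IsRootedTree par dep Δ A r → IsRootedTree par dep Δ Q q → Disjoint A Q → par q ∈ A →
      dep q = dep (par q) + 1 → M ≤ #Q → #Q ≤ Δ * M → PieceChain par dep Δ M r S (A ∪ Q)

lemma IsRootedTree.exists_pieceChain {ι : Type*} [DecidableEq ι] {par : ι → ι} {dep : ι → ℕ}
    {Δ : ℕ} {r : ι} (hΔ : 1 ≤ Δ) {M : ℕ} (hM : 1 ≤ M) {k : ℕ} (hk : Δ * M ≤ k)
    (A : Finset ι) (h : IsRootedTree par dep Δ A r) (hkA : k ≤ #A) :
    ∃ S ⊆ A, IsRootedTree par dep Δ S r ∧ PieceChain par dep Δ M r S A ∧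
      #S ≤ k ∧ k ≤ #S + Δ * M := by
  induction hn : #A using Nat.strong_induction_on generalizing A with
  | _ n ih =>
    by_cases hle : #A ≤ k
    · exact ⟨A, subset_rfl, h, .refl, hle, by omega⟩
    obtain ⟨q, Q, hQA, hqr, hMQ, hQM, hQ, hAQ, hpar⟩ := h.exists_branch hΔ hM (by omega)
    have hc := card_sdiff_of_subset hQA
    have hcQ := card_le_card hQA
    by_cases hk2 : k ≤ #(A \ Q)
    · obtain ⟨S, hS, hS1, hS2, hS3⟩ := ih _ (by omega) (A \ Q) hAQ hk2 rfl
      refine ⟨S, hS.trans sdiff_subset, hS1, ?_, hS3⟩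
      have := PieceChain.step (A \ Q) Q q hS2 hAQ hQ disjoint_sdiff_self_left hpar
        (h.dep_eq q (hQA hQ.root_mem) hqr) hMQ hQM
      rwa [sdiff_union_of_subset hQA] at this
    · refine ⟨A \ Q, sdiff_subset, hAQ, ?_, by omega, by omega⟩
      have := PieceChain.step (A \ Q) Q q .refl hAQ hQ disjoint_sdiff_self_left hpar
        (h.dep_eq q (hQA hQ.root_mem) hqr) hMQ hQM
      rwa [sdiff_union_of_subset hQA] at this

open Classical in
/-- The neighbours of `v` inside the finite set `U`. -/
noncomputable def nbrs {V : Type*} (G : SimpleGraph V) (U : Finset V) (v : V) : Finset V :=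
  {u ∈ U | G.Adj v u}

@[simp]
lemma mem_nbrs {V : Type*} {G : SimpleGraph V} {U : Finset V} {v u : V} :
    u ∈ nbrs G U v ↔ u ∈ U ∧ G.Adj v u := by
  simp [nbrs]

lemma nbrs_subset {V : Type*} (G : SimpleGraph V) (U : Finset V) (v : V) : nbrs G U v ⊆ U :=
  fun _ hu => (mem_nbrs.1 hu).1

lemma sum_card_nbrs_comm {V : Type*} (G : SimpleGraph V) (A Z : Finset V) :
    ∑ a ∈ A, #(nbrs G Z a) = ∑ z ∈ Z, #(nbrs G A z) := by
  classical
  have := sum_card_bipartiteAbove_eq_sum_card_bipartiteBelow (s := A) (t := Z) G.Adj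
  simp only [bipartiteAbove, bipartiteBelow] at this
  convert this using 3 with z hz z hz
  · unfold nbrs
    congr
  · ext a
    simp [G.adj_comm]

/-- If every vertex of `A` sees a positive fraction of `Z`, then there is a complete bipartite
graph between a positive fraction of `A` and a positive fraction of `Z`. -/
lemma exists_complete_pair {V : Type*} (G : SimpleGraph V) (A Z : Finset V) {γ : ℝ} (hγ : 0 < γ)
    (hγ1 : γ ≤ 1) (hA : A.Nonempty) (h : ∀ a ∈ A, 2 * γ * #Z ≤ #(nbrs G Z a)) :
    ∃ A' ⊆ A, ∃ Z' ⊆ Z, γ * #A ≤ #A' ∧ γ * #Z / 2 ^ #A ≤ #Z' ∧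
      ∀ a ∈ A', ∀ z ∈ Z', G.Adj a z := by
  classical
  have hApos : (0 : ℝ) < #A := by exact_mod_cast hA.card_pos
  set Zg : Finset V := {z ∈ Z | γ * #A ≤ #(nbrs G A z)} with hZg
  have hsum : 2 * γ * #Z * #A ≤ ∑ z ∈ Z, (#(nbrs G A z) : ℝ) := by
    have h1 : ∑ a ∈ A, (2 * γ * #Z : ℝ) ≤ ∑ a ∈ A, (#(nbrs G Z a) : ℝ) := sum_le_sum h
    have h2 : ∑ a ∈ A, (#(nbrs G Z a) : ℝ) = ∑ z ∈ Z, (#(nbrs G A z) : ℝ) := by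
      exact_mod_cast sum_card_nbrs_comm G A Z
    rw [sum_const, nsmul_eq_mul] at h1
    linarith
  have hup : ∑ z ∈ Z, (#(nbrs G A z) : ℝ) ≤ #Zg * #A + #Z * (γ * #A) := by
    have h1 : ∀ z ∈ Z, (#(nbrs G A z) : ℝ) ≤
        (if γ * #A ≤ #(nbrs G A z) then (#A : ℝ) else 0) + γ * #A := by
      intro z _
      split_ifs with hz
      · have : (#(nbrs G A z) : ℝ) ≤ #A := by exact_mod_cast card_le_card (nbrs_subset G A z)
        have : 0 ≤ γ * #A := by positivity
        linarith
      · linarith [not_le.1 hz]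
    refine (sum_le_sum h1).trans (le_of_eq ?_)
    rw [sum_add_distrib, sum_const, nsmul_eq_mul, ← sum_filter, sum_const, nsmul_eq_mul]
  have hcard : γ * #Z ≤ #Zg := by
    have : γ * #Z * #A ≤ #Zg * #A := by nlinarith
    exact le_of_mul_le_mul_right this hApos
  set t : Finset (Finset V) := {P ∈ A.powerset | γ * #A ≤ #P} with ht
  have htn : t.Nonempty := ⟨A, by simp [ht]; nlinarith⟩
  have htc : (#t : ℝ) ≤ 2 ^ #A := by
    have := card_filter_le A.powerset (fun P => γ * #A ≤ (#P : ℝ))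
    rw [card_powerset] at this
    exact_mod_cast this
  obtain ⟨P, hP, hfib⟩ := exists_le_card_fiber_of_nsmul_le_card_of_maps_to
    (s := Zg) (t := t) (f := fun z => nbrs G A z) (b := γ * #Z / 2 ^ #A)
    (fun z hz => by
      simp only [ht, mem_filter, mem_powerset]
      exact ⟨nbrs_subset G A z, (mem_filter.1 hz).2⟩) htn (by
      rw [nsmul_eq_mul]
      refine le_trans ?_ hcard
      rw [mul_div_assoc', div_le_iff₀ (by positivity), mul_comm]
      gcongr)
  rw [ht, mem_filter, mem_powerset] at hP
  refine ⟨P, hP.1, {z ∈ Zg | nbrs G A z = P}, (filter_subset _ _).trans (filter_subset _ _),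
    hP.2, hfib, fun a ha z hz => ?_⟩
  rw [mem_filter] at hz
  rw [← hz.2, mem_nbrs] at ha
  exact ha.2.symm

/-- A function with values in `[0, 1]` on `U` has two sublevel sets, of total size at least `#U`,
whose levels average to about the mean of the function. -/
lemma exists_levels {V : Type*} (U : Finset V) (hU : U.Nonempty) (g : V → ℝ)
    (h0 : ∀ u ∈ U, 0 ≤ g u) (h1 : ∀ u ∈ U, g u ≤ 1) {η : ℝ} (hη : 0 < η) (hη1 : η ≤ 1 / 4) :
    ∃ a b : ℝ, a ≤ b ∧ a + b ≤ 2 * ((∑ u ∈ U, g u) / #U) + 8 * η ∧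
      η * #U ≤ #{u ∈ U | g u ≤ a} ∧ #U ≤ #{u ∈ U | g u ≤ a} + #{u ∈ U | g u ≤ b} := by
  classical
  set n := #U with hn
  have hnpos : 0 < n := hU.card_pos
  have hnR : (0 : ℝ) < n := by exact_mod_cast hnpos
  let e : Fin n ≃ U := (U.equivFinOfCardEq rfl).symm
  let f : Fin n → ℝ := fun i => g (e i)
  let σ := Tuple.sort f
  let p : Fin n → ℝ := f ∘ σ
  have hp : Monotone p := Tuple.monotone_sort f
  have hp0 : ∀ i, 0 ≤ p i := fun i => h0 _ (e (σ i)).2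
  have hp1 : ∀ i, p i ≤ 1 := fun i => h1 _ (e (σ i)).2
  have hsum : ∑ i, p i = ∑ u ∈ U, g u := by
    rw [← sum_coe_sort U g, ← (σ.trans e).sum_comp (fun u : U => g u)]
    rfl
  have hcount : ∀ i : Fin n, (i : ℕ) + 1 ≤ #{u ∈ U | g u ≤ p i} := by
    intro i
    have hinj : Function.Injective (fun j => (e (σ j) : V)) :=
      Subtype.val_injective.comp (e.injective.comp σ.injective)
    have : #((Iic i).image fun j => (e (σ j) : V)) = i + 1 := by
      rw [card_image_of_injective _ hinj]
      simp
    rw [← this]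
    refine card_le_card fun u hu => ?_
    obtain ⟨j, hj, rfl⟩ := mem_image.1 hu
    exact mem_filter.2 ⟨(e (σ j)).2, hp (mem_Iic.1 hj)⟩
  set c := (∑ u ∈ U, g u) / n with hc
  have hc0 : 0 ≤ c := div_nonneg (sum_nonneg h0) hnR.le
  have hc1 : c ≤ 1 := by
    rw [hc, div_le_one hnR]
    calc ∑ u ∈ U, g u ≤ ∑ u ∈ U, (1 : ℝ) := sum_le_sum h1
      _ = n := by simp [hn]
  obtain ⟨i, hi1, hi2, hi3⟩ : ∃ i : Fin n, η * n ≤ (i : ℕ) + 1 ∧ η * n ≤ (i.rev : ℕ) + 1 ∧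
      p i + p i.rev ≤ 2 * c + 8 * η := by
    by_contra hcon
    push Not at hcon
    have hterm : ∀ i : Fin n, (2 * c + 8 * η) -
        ((if (i : ℕ) + 1 < η * n then 2 * c + 8 * η else 0) +
          (if (i.rev : ℕ) + 1 < η * n then 2 * c + 8 * η else 0)) ≤ p i + p i.rev := by
      intro i
      have := hp0 i
      have := hp0 i.rev
      split_ifs with h2 h3 h3
      · linarith
      · linarith
      · linarith
      · linarith [hcon i (not_lt.1 h2) (not_lt.1 h3)]
    have hfew : (#{i : Fin n | ((i : ℕ) : ℝ) + 1 < η * n} : ℝ) < η * n := by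
      by_cases hne : {i : Fin n | ((i : ℕ) : ℝ) + 1 < η * n} = (∅ : Set (Fin n))
      · have : ({i : Fin n | ((i : ℕ) : ℝ) + 1 < η * n} : Finset (Fin n)) = ∅ := by
          ext i
          have := Set.ext_iff.1 hne i
          simpa using this
        rw [this]
        simp
        positivity
      · have hne' : ({i : Fin n | ((i : ℕ) : ℝ) + 1 < η * n} : Finset (Fin n)).Nonempty := by
          obtain ⟨i, hi⟩ := Set.nonempty_iff_ne_empty.2 hne
          exact ⟨i, by simpa using hi⟩
        obtain ⟨i, hi, hmax⟩ := exists_max_image _ id hne'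
        have hsub : ({i : Fin n | ((i : ℕ) : ℝ) + 1 < η * n} : Finset (Fin n)) ⊆ Iic i :=
          fun j hj => mem_Iic.2 (hmax j hj)
        have h3 := card_le_card hsub
        rw [Fin.card_Iic] at h3
        have h4 : (#{i : Fin n | ((i : ℕ) : ℝ) + 1 < η * n} : ℝ) ≤ (i : ℕ) + 1 := by
          exact_mod_cast h3
        exact h4.trans_lt (mem_filter.1 hi).2
    have hS1 : ∑ i : Fin n, (if ((i : ℕ) : ℝ) + 1 < η * n then 2 * c + 8 * η else 0) =
        #{i : Fin n | ((i : ℕ) : ℝ) + 1 < η * n} * (2 * c + 8 * η) := by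
      rw [← sum_filter, sum_const, nsmul_eq_mul]
    have hS2 : ∑ i : Fin n, (if ((i.rev : ℕ) : ℝ) + 1 < η * n then 2 * c + 8 * η else 0) =
        #{i : Fin n | ((i : ℕ) : ℝ) + 1 < η * n} * (2 * c + 8 * η) := by
      rw [← hS1]
      exact Equiv.sum_comp Fin.revPerm
        (fun i : Fin n => if ((i : ℕ) : ℝ) + 1 < η * n then 2 * c + 8 * η else 0)
    have hrev : ∑ i : Fin n, p i.rev = ∑ i, p i := Equiv.sum_comp Fin.revPerm p
    have htot := sum_le_sum fun i (_ : i ∈ (univ : Finset (Fin n))) => hterm i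
    have hcst : ∑ _i : Fin n, (2 * c + 8 * η) = n * (2 * c + 8 * η) := by
      rw [sum_const, nsmul_eq_mul, card_univ, Fintype.card_fin]
    rw [sum_sub_distrib, hcst, sum_add_distrib, sum_add_distrib, hS1, hS2, hrev, hsum] at htot
    have hcn : ∑ u ∈ U, g u = c * n := by rw [hc]; field_simp
    rw [hcn] at htot
    have hpos : 0 < 2 * c + 8 * η := by linarith
    have h5 := mul_lt_mul_of_pos_right hfew hpos
    have h6 : (n : ℝ) * (8 * η) < 2 * (η * n * (2 * c + 8 * η)) := by nlinarith
    have h7 : 2 * (η * n * (2 * c + 8 * η)) ≤ n * (8 * η) := by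
      have : (0 : ℝ) ≤ n * η := mul_nonneg hnR.le hη.le
      nlinarith
    linarith
  have hrevval : (i.rev : ℕ) + 1 + i = n := by
    rw [Fin.val_rev]
    omega
  rcases le_total i i.rev with hle | hle
  · refine ⟨p i, p i.rev, hp hle, hi3, hi1.trans ?_, ?_⟩
    · exact_mod_cast hcount i
    · have := hcount i
      have := hcount i.rev
      omega
  · refine ⟨p i.rev, p i, hp hle, by linarith, hi2.trans ?_, ?_⟩
    · exact_mod_cast hcount i.rev
    · have := hcount i
      have := hcount i.rev
      omega

/-- Sets with at least as many elements as there are indices have distinct representatives. -/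
lemma exists_injOn_mem {ι V : Type*} [DecidableEq ι] [Nonempty V] (Q : Finset ι)
    (C : ι → Finset V) (hC : ∀ x ∈ Q, #Q ≤ #(C x)) :
    ∃ ψ : ι → V, Set.InjOn ψ Q ∧ ∀ x ∈ Q, ψ x ∈ C x := by
  classical
  induction Q using Finset.induction_on with
  | empty => exact ⟨fun _ => Classical.arbitrary V, by simp, by simp⟩
  | insert q Q hq ih =>
    rw [card_insert_of_notMem hq] at hC
    obtain ⟨ψ, hψ, hmem⟩ := ih fun x hx =>
      (Nat.le_succ _).trans (hC x (mem_insert_of_mem hx))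
    obtain ⟨v, hv, hv'⟩ : ∃ v ∈ C q, v ∉ Q.image ψ := by
      by_contra hcon
      push Not at hcon
      have h1 := card_le_card (fun v hv => hcon v hv : C q ⊆ Q.image ψ)
      have h2 := hC q (mem_insert_self _ _)
      have h3 := card_image_le (s := Q) (f := ψ)
      omega
    have hup : ∀ x ∈ Q, Function.update ψ q v x = ψ x := fun x hx =>
      Function.update_of_ne (ne_of_mem_of_not_mem hx hq) _ _
    refine ⟨Function.update ψ q v, ?_, ?_⟩
    · rw [coe_insert, Set.injOn_insert (by simpa using hq)]
      refine ⟨fun x hx y hy hxy => ?_, ?_⟩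
      · rw [hup x hx, hup y hy] at hxy
        exact hψ hx hy hxy
      · rintro ⟨x, hx, hxv⟩
        rw [hup x hx, Function.update_self] at hxv
        exact hv' (mem_image.2 ⟨x, hx, hxv⟩)
    · intro x hx
      rcases mem_insert.1 hx with rfl | hx
      · rwa [Function.update_self]
      · rw [hup x hx]
        exact hmem x hx

/-- A tree can be embedded level by level: the root is mapped to `ρ`, its children to `Z`, and the
remaining vertices alternately to `P` and `P'`. -/
lemma IsRootedTree.exists_layered_embedding {ι V : Type*} [DecidableEq ι] {par : ι → ι}
    {dep : ι → ℕ} {Δ : ℕ} {Q : Finset ι} {q : ι} (hQ : IsRootedTree par dep Δ Q q)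
    {G : SimpleGraph V} {ρ : V} {Z P P' : Finset V} (hZ : #Q < #Z) (hP : #Q < #P)
    (hP' : #Q < #P') (hρZ : ∀ z ∈ Z, G.Adj ρ z) (hPZ : ∀ p ∈ P, ∀ z ∈ Z, G.Adj p z)
    (hPP' : ∀ p ∈ P, ∀ p' ∈ P', G.Adj p p') :
    ∃ ψ : ι → V, ψ q = ρ ∧ Set.InjOn ψ Q ∧ (∀ x ∈ Q, x ≠ q → G.Adj (ψ (par x)) (ψ x)) ∧
      ∀ x ∈ Q, x ≠ q → (dep x = dep q + 1 ∧ ψ x ∈ Z) ∨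
        (dep x ≠ dep q + 1 ∧ (dep x + dep q) % 2 = 0 ∧ ψ x ∈ P) ∨
        (dep x ≠ dep q + 1 ∧ (dep x + dep q) % 2 = 1 ∧ ψ x ∈ P') := by
  classical
  let C : ι → Finset V := fun x =>
    (if dep x = dep q + 1 then Z else if (dep x + dep q) % 2 = 0 then P else P').erase ρ
  have : Nonempty V := ⟨ρ⟩
  obtain ⟨ψ, hinj, hmem⟩ := exists_injOn_mem (Q.erase q) C (fun x hx => by
    have h1 := card_erase_lt_of_mem hQ.root_mem
    have h2 : ∀ W : Finset V, #W - 1 ≤ #(W.erase ρ) := fun W => pred_card_le_card_erase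
    simp only [C]
    split_ifs <;> [have := h2 Z; have := h2 P; have := h2 P'] <;> omega)
  have hq : ∀ x ∈ Q, x ≠ q → Function.update ψ q ρ x = ψ x := fun x _ hxq =>
    Function.update_of_ne hxq _ _
  have hcl : ∀ x ∈ Q, x ≠ q → (dep x = dep q + 1 ∧ ψ x ∈ Z) ∨
        (dep x ≠ dep q + 1 ∧ (dep x + dep q) % 2 = 0 ∧ ψ x ∈ P) ∨
        (dep x ≠ dep q + 1 ∧ (dep x + dep q) % 2 = 1 ∧ ψ x ∈ P') := by
    intro x hx hxq
    have := mem_of_mem_erase (hmem x (mem_erase.2 ⟨hxq, hx⟩))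
    split_ifs at this with h1 h2
    · exact .inl ⟨h1, this⟩
    · exact .inr (.inl ⟨h1, h2, this⟩)
    · exact .inr (.inr ⟨h1, by omega, this⟩)
  refine ⟨Function.update ψ q ρ, by simp, ?_, ?_, ?_⟩
  · rw [← insert_erase hQ.root_mem, coe_insert, Set.injOn_insert (by simp)]
    constructor
    · refine hinj.congr fun x hx => ?_
      rw [mem_coe, mem_erase] at hx
      exact (hq x hx.2 hx.1).symm
    · rintro ⟨x, hx, hx'⟩
      rw [mem_coe] at hx
      rw [hq x (mem_of_mem_erase hx) (ne_of_mem_erase hx), Function.update_self] at hx'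
      exact ne_of_mem_erase (hmem x hx) hx'
  · intro x hx hxq
    have hd := hQ.dep_eq x hx hxq
    have hp := hQ.par_mem x hx hxq
    rw [hq x hx hxq]
    by_cases hpq : par x = q
    · rw [hpq, Function.update_self]
      rcases hcl x hx hxq with h | h | h
      · exact hρZ _ h.2
      · rw [hpq] at hd; exact absurd hd h.1
      · rw [hpq] at hd; exact absurd hd h.1
    · rw [hq _ hp hpq]
      have hlt := hQ.dep_root_lt hp hpq
      rcases hcl x hx hxq with h | h | h
      · omega
      · rcases hcl _ hp hpq with h' | h' | h'
        · exact (hPZ _ h.2.2 _ h'.2).symm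
        · omega
        · exact (hPP' _ h.2.2 _ h'.2.2).symm
      · rcases hcl _ hp hpq with h' | h' | h'
        · omega
        · exact hPP' _ h'.2.2 _ h.2.2
        · omega
  · intro x hx hxq
    rw [hq x hx hxq]
    exact hcl x hx hxq

set_option maxHeartbeats 1000000 in
/-- A tree of bounded size can be embedded into a graph of large minimum degree with its root at a
prescribed vertex, in such a way that the remaining vertices have average weight barely above the
mean. -/
lemma IsRootedTree.exists_balanced_embedding {ι V : Type*} [DecidableEq ι] [DecidableEq V]
    {par : ι → ι} {dep : ι → ℕ} {Δ : ℕ} {Q : Finset ι} {q : ι} (hQ : IsRootedTree par dep Δ Q q)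
    {G : SimpleGraph V} {U : Finset V} {ρ : V} {β η : ℝ} (hβ : 0 < β) (hβ1 : β ≤ 1 / 2)
    (hη : 0 < η) (hη1 : η ≤ 1 / 4) {k : ℕ} (hkQ : 2 * (#Q + 1) ≤ β ^ 2 * k) (hkη : k ≤ η * #U)
    (hkU : 4 * k * 2 ^ k ≤ β * #U) (hU : ∀ u ∈ U, (1 / 2 + β) * #U ≤ #(nbrs G U u))
    (hρ : (1 / 2 + β) * #U ≤ #(nbrs G U ρ)) (g : V → ℝ) (hg0 : ∀ u ∈ U, 0 ≤ g u)
    (hg1 : ∀ u ∈ U, g u ≤ 1) :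
    ∃ ψ : ι → V, ψ q = ρ ∧ Set.InjOn ψ Q ∧ (∀ x ∈ Q, x ≠ q → G.Adj (ψ (par x)) (ψ x)) ∧
      (∀ x ∈ Q, x ≠ q → ψ x ∈ U) ∧
      ∑ x ∈ Q.erase q, g (ψ x) ≤ Δ + #Q * ((∑ u ∈ U, g u) / #U + 4 * η) := by
  have hQpos : (0 : ℝ) < #Q := by exact_mod_cast card_pos.2 ⟨q, hQ.root_mem⟩
  have hβsq : β ^ 2 ≤ 1 := by nlinarith
  have hkpos : (0 : ℝ) < k := by
    by_contra hc
    have : (k : ℝ) = 0 := le_antisymm (not_lt.1 hc) k.cast_nonneg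
    rw [this] at hkQ
    linarith
  have hkQ' : (2 * (#Q + 1) : ℝ) ≤ k := hkQ.trans (by nlinarith)
  have hUpos : (0 : ℝ) < #U := by
    by_contra hc
    nlinarith
  have hUne : U.Nonempty := card_pos.1 (by exact_mod_cast hUpos)
  obtain ⟨a, b, hab, habs, hLa, hLb⟩ := exists_levels U hUne g hg0 hg1 hη hη1
  set La : Finset V := {u ∈ U | g u ≤ a} with hLadef
  set Lb : Finset V := {u ∈ U | g u ≤ b} with hLbdef
  have hLab : #La ≤ #Lb := card_le_card fun u hu => by
    rw [hLadef, mem_filter] at hu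
    exact mem_filter.2 ⟨hu.1, hu.2.trans hab⟩
  have hLbU : (1 / 2 : ℝ) * #U ≤ #Lb := by
    have : (#U : ℝ) ≤ #La + #Lb := by exact_mod_cast hLb
    have : (#La : ℝ) ≤ #Lb := by exact_mod_cast hLab
    linarith
  have hLbU' : (#Lb : ℝ) ≤ #U := by exact_mod_cast card_le_card (filter_subset _ U)
  -- two vertex sets in `U` have a large intersection
  have hinter : ∀ S T : Finset V, S ⊆ U → T ⊆ U → (#S + #T - #U : ℝ) ≤ #(S ∩ T) := by
    intro S T hS hT
    have h1 := card_union_add_card_inter S T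
    have h2 := card_le_card (union_subset hS hT)
    have h3 : (#S + #T : ℝ) ≤ #U + #(S ∩ T) := by
      have : #S + #T ≤ #U + #(S ∩ T) := by omega
      exact_mod_cast this
    linarith
  obtain ⟨A₀, hA₀, hA₀k⟩ := exists_subset_card_eq (s := La) (n := k)
    (by exact_mod_cast hkη.trans hLa)
  obtain ⟨A₁, hA₁, B₁, hB₁, hA₁c, hB₁c, hAB⟩ := exists_complete_pair G A₀ Lb (γ := β / 2)
    (by linarith) (by linarith) (card_pos.1 (by rw [hA₀k]; exact_mod_cast hkpos)) (by
      intro x hx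
      have hxU : x ∈ U := filter_subset _ _ (hA₀ hx)
      have h1 := hinter (nbrs G U x) Lb (nbrs_subset _ _ _) (filter_subset _ _)
      have h2 : nbrs G U x ∩ Lb ⊆ nbrs G Lb x := by
        intro z hz
        rw [mem_inter, mem_nbrs] at hz
        exact mem_nbrs.2 ⟨hz.2, hz.1.2⟩
      have h3 : (#(nbrs G U x ∩ Lb) : ℝ) ≤ #(nbrs G Lb x) := by exact_mod_cast card_le_card h2
      have h4 := hU x hxU
      nlinarith)
  rw [hA₀k] at hA₁c hB₁c
  have h2k : (0 : ℝ) < 2 ^ k := by positivity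
  have hkB : (k : ℝ) ≤ #B₁ := by
    refine le_trans ?_ hB₁c
    rw [le_div_iff₀ h2k]
    nlinarith
  obtain ⟨B₂, hB₂, hB₂k⟩ := exists_subset_card_eq (s := B₁) (n := k) (by exact_mod_cast hkB)
  have hβk : β * k ≤ k := by nlinarith
  have main : ∀ P P' : Finset V, P ⊆ U → P' ⊆ U → #P ≤ k → β / 2 * k ≤ #P → β / 2 * k ≤ #P' →
      (∀ p ∈ P, ∀ p' ∈ P', G.Adj p p') →
      ∃ ψ : ι → V, ψ q = ρ ∧ Set.InjOn ψ Q ∧ (∀ x ∈ Q, x ≠ q → G.Adj (ψ (par x)) (ψ x)) ∧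
        (∀ x ∈ Q, x ≠ q → ψ x ∈ U) ∧ ∀ x ∈ Q, x ≠ q → dep x ≠ dep q + 1 →
          ((dep x + dep q) % 2 = 0 → ψ x ∈ P) ∧ ((dep x + dep q) % 2 = 1 → ψ x ∈ P') := by
    intro P P' hP hP' hPk hPc hPc' hadj
    have hPpos : (0 : ℝ) < #P := lt_of_lt_of_le (by positivity) hPc
    obtain ⟨P₀, hP₀, Z, hZ, hP₀c, hZc, hPZ⟩ := exists_complete_pair G P (nbrs G U ρ) (γ := β)
      hβ (by linarith) (card_pos.1 (by exact_mod_cast hPpos)) (by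
        intro x hx
        have h1 := hinter (nbrs G U x) (nbrs G U ρ) (nbrs_subset _ _ _) (nbrs_subset _ _ _)
        have h2 : nbrs G U x ∩ nbrs G U ρ ⊆ nbrs G (nbrs G U ρ) x := by
          intro z hz
          rw [mem_inter, mem_nbrs] at hz
          exact mem_nbrs.2 ⟨hz.2, hz.1.2⟩
        have h3 : (#(nbrs G U x ∩ nbrs G U ρ) : ℝ) ≤ #(nbrs G (nbrs G U ρ) x) := by
          exact_mod_cast card_le_card h2
        have h4 := hU x (hP hx)
        have h5 : (#(nbrs G U ρ) : ℝ) ≤ #U := by exact_mod_cast card_le_card (nbrs_subset G U ρ)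
        nlinarith)
    have hcP₀ : #Q < #P₀ := by
      have h1 : β * (β / 2 * k) ≤ β * #P := by gcongr
      have h2 : β * (β / 2 * k) = β ^ 2 * k / 2 := by ring
      have : (#Q : ℝ) < #P₀ := by linarith
      exact_mod_cast this
    have hcP' : #Q < #P' := by
      have h1 : β ^ 2 * k ≤ β * k := by
        have : β ^ 2 ≤ β := by nlinarith
        gcongr
      have : (#Q : ℝ) < #P' := by linarith
      exact_mod_cast this
    have hcZ : #Q < #Z := by
      have h1 : (k : ℝ) ≤ #Z := by
        refine le_trans ?_ hZc
        have h2 : (2 : ℝ) ^ #P ≤ 2 ^ k := pow_le_pow_right₀ (by norm_num) hPk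
        rw [le_div_iff₀ (by positivity)]
        calc (k : ℝ) * 2 ^ #P ≤ k * 2 ^ k := by gcongr
          _ ≤ β * ((1 / 2 + β) * #U) := by nlinarith [mul_pos hkpos h2k, mul_pos hβ hUpos]
          _ ≤ _ := by gcongr
      have : (#Q : ℝ) < #Z := by linarith
      exact_mod_cast this
    obtain ⟨ψ, h1, h2, h3, h4⟩ := hQ.exists_layered_embedding (G := G) (ρ := ρ) hcZ hcP₀ hcP'
      (fun z hz => (mem_nbrs.1 (hZ hz)).2) hPZ (fun p hp => hadj p (hP₀ hp))
    refine ⟨ψ, h1, h2, h3, fun x hx hxq => ?_, fun x hx hxq hd => ⟨fun hm => ?_, fun hm => ?_⟩⟩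
    · rcases h4 x hx hxq with h | h | h
      · exact nbrs_subset _ _ _ (hZ h.2)
      · exact hP (hP₀ h.2.2)
      · exact hP' h.2.2
    · rcases h4 x hx hxq with h | h | h
      · omega
      · exact hP₀ h.2.2
      · omega
    · rcases h4 x hx hxq with h | h | h
      · omega
      · omega
      · exact h.2.2
  have hA₁U : A₁ ⊆ U := (hA₁.trans hA₀).trans (filter_subset _ _)
  have hB₂U : B₂ ⊆ U := (hB₂.trans hB₁).trans (filter_subset _ _)
  have hA₁g : ∀ u ∈ A₁, g u ≤ a := fun u hu => (mem_filter.1 (hA₀ (hA₁ hu))).2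
  have hB₂g : ∀ u ∈ B₂, g u ≤ b := fun u hu => (mem_filter.1 (hB₁ (hB₂ hu))).2
  have hB₂c : β / 2 * k ≤ #B₂ := by rw [hB₂k]; linarith
  have hA₁k : #A₁ ≤ k := hA₀k ▸ card_le_card hA₁
  set L : Finset ι := {x ∈ Q.erase q | dep x = dep q + 1} with hL
  set E : Finset ι := {x ∈ Q.erase q | dep x ≠ dep q + 1 ∧ (dep x + dep q) % 2 = 0} with hE
  set O : Finset ι := {x ∈ Q.erase q | dep x ≠ dep q + 1 ∧ (dep x + dep q) % 2 = 1} with hO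
  have hLΔ : #L ≤ Δ := by
    refine le_trans (card_le_card fun x hx => ?_) (hQ.card_children q)
    rw [hL, mem_filter, mem_erase] at hx
    refine mem_filter.2 ⟨hx.1.2, ?_, hx.2⟩
    by_contra hp
    have h1 := hQ.dep_root_lt (hQ.par_mem x hx.1.2 hx.1.1) hp
    have h2 := hQ.dep_eq x hx.1.2 hx.1.1
    omega
  have hsplit : ∀ f : ι → ℝ, ∑ x ∈ Q.erase q, f x =
      ∑ x ∈ L, f x + (∑ x ∈ E, f x + ∑ x ∈ O, f x) := by
    intro f
    rw [← sum_filter_add_sum_filter_not (Q.erase q) (fun x => dep x = dep q + 1),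
      ← sum_filter_add_sum_filter_not ({x ∈ Q.erase q | ¬ dep x = dep q + 1})
      (fun x => (dep x + dep q) % 2 = 0), filter_filter, filter_filter]
    simp only [hL, hE, hO, Nat.mod_two_not_eq_zero, ne_eq]
  have hEO : (#E + #O : ℝ) ≤ #Q := by
    have h1 := hsplit fun _ => 1
    simp only [sum_const, nsmul_eq_mul, mul_one] at h1
    have h2 : (#(Q.erase q) : ℝ) ≤ #Q := by exact_mod_cast card_le_card (erase_subset _ _)
    have h3 : (0 : ℝ) ≤ #L := Nat.cast_nonneg _
    linarith
  have havg : 0 ≤ (∑ u ∈ U, g u) / #U := div_nonneg (sum_nonneg hg0) hUpos.le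
  have hLsum : ∀ ψ : ι → V, (∀ x ∈ Q, x ≠ q → ψ x ∈ U) → ∑ x ∈ L, g (ψ x) ≤ Δ := by
    intro ψ hψ
    have h1 : ∑ x ∈ L, g (ψ x) ≤ ∑ x ∈ L, (1 : ℝ) := sum_le_sum fun x hx => by
      have := mem_erase.1 (mem_filter.1 hx).1
      exact hg1 _ (hψ x this.2 this.1)
    refine h1.trans ?_
    rw [sum_const, nsmul_eq_mul, mul_one]
    exact_mod_cast hLΔ
  have hset : ∀ (ψ : ι → V) (W : Finset ι) (c : ℝ), (∀ x ∈ W, g (ψ x) ≤ c) →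
      ∑ x ∈ W, g (ψ x) ≤ #W * c := by
    intro ψ W c hW
    refine (sum_le_sum hW).trans ?_
    rw [sum_const, nsmul_eq_mul]
  have hfin : (#E + #O) * ((a + b) / 2) ≤ #Q * ((∑ u ∈ U, g u) / #U + 4 * η) := by
    calc (#E + #O : ℝ) * ((a + b) / 2) ≤ (#E + #O) * ((∑ u ∈ U, g u) / #U + 4 * η) := by
          gcongr; linarith
      _ ≤ _ := by gcongr
  rcases le_total (#O : ℝ) #E with hle | hle
  · obtain ⟨ψ, h1, h2, h3, h4, h5⟩ := main A₁ B₂ hA₁U hB₂U hA₁k hA₁c hB₂c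
      (fun p hp p' hp' => hAB p hp p' (hB₂ hp'))
    refine ⟨ψ, h1, h2, h3, h4, ?_⟩
    rw [hsplit fun x => g (ψ x)]
    have h6 := hLsum ψ h4
    have h7 := hset ψ E a fun x hx => by
      simp only [hE, mem_filter, mem_erase] at hx
      exact hA₁g _ ((h5 x hx.1.2 hx.1.1 hx.2.1).1 hx.2.2)
    have h8 := hset ψ O b fun x hx => by
      simp only [hO, mem_filter, mem_erase] at hx
      exact hB₂g _ ((h5 x hx.1.2 hx.1.1 hx.2.1).2 hx.2.2)
    nlinarith
  · obtain ⟨ψ, h1, h2, h3, h4, h5⟩ := main B₂ A₁ hB₂U hA₁U hB₂k.le hB₂c hA₁c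
      (fun p hp p' hp' => (hAB p' hp' p (hB₂ hp)).symm)
    refine ⟨ψ, h1, h2, h3, h4, ?_⟩
    rw [hsplit fun x => g (ψ x)]
    have h6 := hLsum ψ h4
    have h7 := hset ψ E b fun x hx => by
      simp only [hE, mem_filter, mem_erase] at hx
      exact hB₂g _ ((h5 x hx.1.2 hx.1.1 hx.2.1).1 hx.2.2)
    have h8 := hset ψ O a fun x hx => by
      simp only [hO, mem_filter, mem_erase] at hx
      exact hA₁g _ ((h5 x hx.1.2 hx.1.1 hx.2.1).2 hx.2.2)
    nlinarith

/-- An exponential potential measuring how small the relative degrees of the vertices of `B` into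
the set `U` are. -/
noncomputable def degPotential {V : Type*} (G : SimpleGraph V) (B : Finset V) (l : ℝ)
    (U : Finset V) : ℝ :=
  ∑ v ∈ B, Real.exp (-(l * (#(nbrs G U v) / #U)))

/-- The relative increase of the potential which is caused by deleting `w` from `U`. -/
noncomputable def degWeight {V : Type*} (G : SimpleGraph V) (B : Finset V) (l : ℝ)
    (U : Finset V) (w : V) : ℝ :=
  (∑ v ∈ nbrs G B w, Real.exp (-(l * (#(nbrs G U v) / #U)))) / degPotential G B l U

section degPotential

variable {V : Type*} {G : SimpleGraph V} {B U : Finset V} {l : ℝ}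

lemma degPotential_nonneg : 0 ≤ degPotential G B l U :=
  sum_nonneg fun _ _ => (Real.exp_pos _).le

lemma degWeight_nonneg (w : V) : 0 ≤ degWeight G B l U w :=
  div_nonneg (sum_nonneg fun _ _ => (Real.exp_pos _).le) degPotential_nonneg

lemma degWeight_le_one (w : V) : degWeight G B l U w ≤ 1 :=
  div_le_one_of_le₀ (sum_le_sum_of_subset_of_nonneg (nbrs_subset _ _ _)
    fun _ _ _ => (Real.exp_pos _).le) degPotential_nonneg

lemma sum_sum_nbrs (R : Finset V) (f : V → ℝ) :
    ∑ w ∈ R, ∑ v ∈ nbrs G B w, f v = ∑ v ∈ B, f v * #(nbrs G R v) := by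
  have : ∀ v ∈ B, f v * #(nbrs G R v) = ∑ w ∈ nbrs G R v, f v := fun v _ => by
    rw [sum_const, nsmul_eq_mul, mul_comm]
  rw [sum_congr rfl this]
  refine sum_comm' fun w v => ?_
  simp only [mem_nbrs, G.adj_comm w v]
  tauto

lemma degPotential_sdiff_le [DecidableEq V] {R : Finset V} (hR : R ⊆ U) (hRU : #R < #U)
    (hl : 0 ≤ l) (hl1 : l * #R ≤ #U - #R) {e : ℝ}
    (he : ∑ w ∈ R, degWeight G B l U w ≤ #R * ((∑ w ∈ U, degWeight G B l U w) / #U) + e) :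
    degPotential G B l (U \ R) ≤ degPotential G B l U *
      Real.exp (l * e / (#U - #R) + l ^ 2 * #R ^ 2 / (#U - #R) ^ 2) := by
  rcases B.eq_empty_or_nonempty with rfl | hB
  · simp [degPotential]
  set W := degPotential G B l U with hW
  have hWpos : 0 < W := sum_pos (fun _ _ => Real.exp_pos _) hB
  set ω : V → ℝ := fun v => Real.exp (-(l * (#(nbrs G U v) / #U))) with hω
  have hωpos : ∀ v, 0 < ω v := fun v => Real.exp_pos _
  have hRU' : (#R : ℝ) < #U := by exact_mod_cast hRU
  have hu : (0 : ℝ) < #U := lt_of_le_of_lt (Nat.cast_nonneg _) hRU'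
  have hur : (0 : ℝ) < #U - #R := by linarith
  have hsum : ∀ S : Finset V, ∑ w ∈ S, degWeight G B l U w = (∑ v ∈ B, ω v * #(nbrs G S v)) / W := by
    intro S
    rw [← sum_sum_nbrs, sum_div]
    rfl
  have hcard : (#(U \ R) : ℝ) = #U - #R := by
    rw [card_sdiff_of_subset hR, Nat.cast_sub (card_le_card hR)]
  have hd : ∀ v, (#(nbrs G (U \ R) v) : ℝ) = #(nbrs G U v) - #(nbrs G R v) := by
    intro v
    have h1 : nbrs G (U \ R) v = nbrs G U v \ nbrs G R v := by
      ext w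
      simp only [mem_nbrs, mem_sdiff]
      tauto
    have h2 : nbrs G R v ⊆ nbrs G U v := fun w hw => by
      rw [mem_nbrs] at hw ⊢
      exact ⟨hR hw.1, hw.2⟩
    rw [h1, card_sdiff_of_subset h2, Nat.cast_sub (card_le_card h2)]
  set x : V → ℝ := fun v => (#(nbrs G R v) - #R * #(nbrs G U v) / #U) / (#U - #R) with hx
  have hxabs : ∀ v, |x v| ≤ #R / (#U - #R) := by
    intro v
    rw [hx, abs_div, abs_of_pos hur]
    gcongr
    have h1 : (#(nbrs G R v) : ℝ) ≤ #R := by exact_mod_cast card_le_card (nbrs_subset _ _ _)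
    have h2 : (#(nbrs G U v) : ℝ) ≤ #U := by exact_mod_cast card_le_card (nbrs_subset _ _ _)
    have h3 : #R * #(nbrs G U v) / #U ≤ (#R : ℝ) := by
      rw [div_le_iff₀ hu]
      gcongr
    have h4 : (0 : ℝ) ≤ #R * #(nbrs G U v) / #U := by positivity
    have h5 : (0 : ℝ) ≤ #(nbrs G R v) := Nat.cast_nonneg _
    rw [abs_le]
    constructor <;> linarith
  have hterm : ∀ v ∈ B, Real.exp (-(l * (#(nbrs G (U \ R) v) / #(U \ R)))) ≤
      ω v * (1 + l * x v + l ^ 2 * #R ^ 2 / (#U - #R) ^ 2) := by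
    intro v _
    have h1 : -(l * (#(nbrs G (U \ R) v) / #(U \ R) : ℝ)) =
        -(l * (#(nbrs G U v) / #U)) + l * x v := by
      rw [hd, hcard, hx]
      field_simp
      ring
    have h2 : |l * x v| ≤ 1 := by
      rw [abs_mul, abs_of_nonneg hl]
      calc l * |x v| ≤ l * (#R / (#U - #R)) := by gcongr; exact hxabs v
        _ ≤ 1 := by rw [mul_div_assoc', div_le_one hur]; exact hl1
    have h3 := (abs_le.1 (Real.abs_exp_sub_one_sub_id_le h2)).2
    have h4 : (l * x v) ^ 2 ≤ l ^ 2 * #R ^ 2 / (#U - #R) ^ 2 := by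
      rw [mul_pow, ← sq_abs (x v), mul_div_assoc, ← div_pow]
      gcongr
      exact hxabs v
    rw [h1, Real.exp_add]
    exact mul_le_mul_of_nonneg_left (by linarith) (hωpos v).le
  have hxsum : ∑ v ∈ B, ω v * x v ≤ W * (e / (#U - #R)) := by
    rw [hsum, hsum] at he
    have h1 : ∑ v ∈ B, ω v * x v = (∑ v ∈ B, ω v * #(nbrs G R v) -
        #R * (∑ v ∈ B, ω v * #(nbrs G U v)) / #U) / (#U - #R) := by
      rw [mul_sum, sum_div, ← sum_sub_distrib, sum_div]
      refine sum_congr rfl fun v _ => ?_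
      rw [hx]
      field_simp
    rw [h1, mul_div_assoc']
    gcongr
    rw [div_le_iff₀ hWpos] at he
    have h2 : (#R * ((∑ v ∈ B, ω v * #(nbrs G U v)) / W / #U) + e) * W =
        #R * (∑ v ∈ B, ω v * #(nbrs G U v)) / #U + W * e := by
      field_simp
    linarith
  calc degPotential G B l (U \ R)
      ≤ ∑ v ∈ B, ω v * (1 + l * x v + l ^ 2 * #R ^ 2 / (#U - #R) ^ 2) := sum_le_sum hterm
    _ = W * (1 + l ^ 2 * #R ^ 2 / (#U - #R) ^ 2) + l * ∑ v ∈ B, ω v * x v := by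
        rw [hW, degPotential, mul_sum, sum_mul, ← sum_add_distrib]
        refine sum_congr rfl fun v _ => ?_
        ring
    _ ≤ W * (1 + l ^ 2 * #R ^ 2 / (#U - #R) ^ 2) + l * (W * (e / (#U - #R))) := by gcongr
    _ = W * ((l * e / (#U - #R) + l ^ 2 * #R ^ 2 / (#U - #R) ^ 2) + 1) := by ring
    _ ≤ _ := by
        gcongr
        exact Real.add_one_le_exp _

/-- A small potential forces every vertex to have a large degree. -/
lemma le_card_nbrs_of_degPotential_le (hU : U.Nonempty) (hl : 0 < l) {c : ℝ}
    (h : degPotential G B l U ≤ Real.exp (-(l * c))) {v : V} (hv : v ∈ B) :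
    c * #U ≤ #(nbrs G U v) := by
  have h1 : Real.exp (-(l * (#(nbrs G U v) / #U))) ≤ Real.exp (-(l * c)) :=
    (single_le_sum (f := fun v => Real.exp (-(l * (#(nbrs G U v) / #U : ℝ))))
      (fun _ _ => (Real.exp_pos _).le) hv).trans h
  rw [Real.exp_le_exp, neg_le_neg_iff] at h1
  have h2 := le_of_mul_le_mul_left h1 hl
  have hu : (0 : ℝ) < #U := by exact_mod_cast hU.card_pos
  rwa [le_div_iff₀ hu] at h2

lemma degPotential_le (hU : U.Nonempty) (hl : 0 ≤ l) {c : ℝ}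
    (h : ∀ v ∈ B, c * #U ≤ #(nbrs G U v)) :
    degPotential G B l U ≤ #B * Real.exp (-(l * c)) := by
  have hu : (0 : ℝ) < #U := by exact_mod_cast hU.card_pos
  rw [← nsmul_eq_mul, ← sum_const]
  refine sum_le_sum fun v hv => ?_
  rw [Real.exp_le_exp, neg_le_neg_iff]
  gcongr
  rw [le_div_iff₀ hu]
  exact h v hv

end degPotential

/-- `φ` embeds the rooted tree with vertex set `D` and root `r` into `G`, with image in `B` and
`r` mapped to `v`. -/
structure IsEmb {ι V : Type*} (G : SimpleGraph V) (par : ι → ι) (B : Finset V) (D : Finset ι)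
    (r : ι) (v : V) (φ : ι → V) : Prop where
  root : φ r = v
  mem : ∀ x ∈ D, φ x ∈ B
  inj : Set.InjOn φ D
  adj : ∀ x ∈ D, x ≠ r → G.Adj (φ (par x)) (φ x)

lemma IsEmb.card_sdiff_image {ι V : Type*} [DecidableEq V] {G : SimpleGraph V} {par : ι → ι}
    {B : Finset V} {D : Finset ι} {r : ι} {v : V} {φ : ι → V} (h : IsEmb G par B D r v φ) :
    (#(B \ D.image φ) : ℝ) = #B - #D := by
  have h1 : D.image φ ⊆ B := image_subset_iff.2 h.mem
  have h2 : #(D.image φ) = #D := card_image_of_injOn h.inj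
  rw [card_sdiff_of_subset h1, Nat.cast_sub (card_le_card h1), h2]

/-- An embedding of a tree can be extended by an embedding of a piece. -/
lemma IsEmb.glue {ι V : Type*} [DecidableEq ι] [DecidableEq V] {G : SimpleGraph V} {par : ι → ι}
    {dep : ι → ℕ} {Δ : ℕ} {B : Finset V} {D Q : Finset ι} {r q : ι} {v : V} {φ ψ : ι → V}
    (h : IsEmb G par B D r v φ) (hD : IsRootedTree par dep Δ D r)
    (hQ : IsRootedTree par dep Δ Q q) (hψ : Set.InjOn ψ Q)
    (hadj : ∀ x ∈ Q, x ≠ q → G.Adj (ψ (par x)) (ψ x)) (hagree : ∀ x ∈ Q, x ∈ D → φ x = ψ x)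
    (hnew : ∀ x ∈ Q, x ∉ D → ψ x ∈ B \ D.image φ)
    (hq : q ∉ D → par q ∈ D ∧ G.Adj (φ (par q)) (ψ q)) :
    ∃ φ' : ι → V, IsEmb G par B (D ∪ Q) r v φ' ∧ (∀ x ∈ D, φ' x = φ x) ∧
      ∀ x ∈ Q, φ' x = ψ x := by
  let φ' : ι → V := fun x => if x ∈ Q then ψ x else φ x
  have hφQ : ∀ x ∈ Q, φ' x = ψ x := fun x hx => if_pos hx
  have hφD : ∀ x ∈ D, φ' x = φ x := by
    intro x hx
    by_cases hxQ : x ∈ Q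
    · rw [hφQ x hxQ, hagree x hxQ hx]
    · exact if_neg hxQ
  have hne : ∀ x ∈ D, ∀ y ∈ Q, y ∉ D → φ' x ≠ φ' y := by
    intro x hx y hy hyD he
    rw [hφD x hx, hφQ y hy] at he
    exact (mem_sdiff.1 (hnew y hy hyD)).2 (mem_image.2 ⟨x, hx, he⟩)
  refine ⟨φ', ⟨?_, ?_, ?_, ?_⟩, hφD, hφQ⟩
  · rw [hφD r hD.root_mem, h.root]
  · intro x hx
    by_cases hxD : x ∈ D
    · rw [hφD x hxD]
      exact h.mem x hxD
    · have hxQ : x ∈ Q := (mem_union.1 hx).resolve_left hxD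
      rw [hφQ x hxQ]
      exact (mem_sdiff.1 (hnew x hxQ hxD)).1
  · intro x hx y hy hxy
    rw [mem_coe, mem_union] at hx hy
    by_cases hxD : x ∈ D <;> by_cases hyD : y ∈ D
    · rw [hφD x hxD, hφD y hyD] at hxy
      exact h.inj hxD hyD hxy
    · exact absurd hxy (hne x hxD y (hy.resolve_left hyD) hyD)
    · exact absurd hxy.symm (hne y hyD x (hx.resolve_left hxD) hxD)
    · have hxQ := hx.resolve_left hxD
      have hyQ := hy.resolve_left hyD
      rw [hφQ x hxQ, hφQ y hyQ] at hxy
      exact hψ hxQ hyQ hxy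
  · intro x hx hxr
    by_cases hxD : x ∈ D
    · rw [hφD x hxD, hφD _ (hD.par_mem x hxD hxr)]
      exact h.adj x hxD hxr
    · have hxQ : x ∈ Q := (mem_union.1 hx).resolve_left hxD
      rw [hφQ x hxQ]
      by_cases hxq : x = q
      · subst hxq
        obtain ⟨h1, h2⟩ := hq hxD
        rwa [hφD _ h1]
      · rw [hφQ _ (hQ.par_mem x hxQ hxq)]
        exact hadj x hxQ hxq

lemma PieceChain.subset {ι : Type*} [DecidableEq ι] {par : ι → ι} {dep : ι → ℕ} {Δ M : ℕ} {r : ι}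
    {S A : Finset ι} (h : PieceChain par dep Δ M r S A) : S ⊆ A := by
  induction h with
  | refl => exact subset_rfl
  | step A Q q _ _ _ _ _ _ _ _ ih => exact ih.trans subset_union_left

/-- The relations between the parameters which make it possible to attach a piece of size between
`M` and `Δ * M` to an embedded tree, while there remain at least `2 * ε * n` free vertices. -/
structure PieceParams (Δ M k : ℕ) (n ε β η l κ P : ℝ) : Prop where
  n_pos : 0 < n
  ε_pos : 0 < ε
  β_pos : 0 < β
  β_le : β ≤ 1 / 2
  η_pos : 0 < η
  η_le : η ≤ 1 / 4
  l_pos : 0 < l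
  P_pos : 0 < P
  κ_nonneg : 0 ≤ κ
  two_le : 2 ≤ M
  le_M : Δ + 1 ≤ η * M
  size_le : ((Δ * M : ℕ) : ℝ) ≤ ε * n
  size_le_k : 2 * ((Δ * M : ℕ) + 1) ≤ β ^ 2 * k
  k_le : k ≤ η * (2 * ε * n)
  k_exp_le : 4 * k * 2 ^ k ≤ β * (2 * ε * n)
  l_mul_le : l * (Δ * M : ℕ) ≤ ε * n
  le_κ : 10 * l * η / (ε * n) + l ^ 2 * (Δ * M : ℕ) / (ε * n) ^ 2 ≤ κ
  pot_le : P * Real.exp (κ * n) ≤ Real.exp (-(l * (1 / 2 + β)))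

set_option maxHeartbeats 1000000 in
/-- Attaching one piece to an embedded tree. -/
lemma IsEmb.attach_piece {ι V : Type*} [DecidableEq ι] [DecidableEq V] {G : SimpleGraph V}
    {par : ι → ι} {dep : ι → ℕ} {Δ M k : ℕ} {ε β η l κ P : ℝ} {B : Finset V} {D Q : Finset ι}
    {r q : ι} {v : V} {φ : ι → V} (hp : PieceParams Δ M k #B ε β η l κ P)
    (h : IsEmb G par B D r v φ) (hD : IsRootedTree par dep Δ D r)
    (hQ : IsRootedTree par dep Δ Q q) (hMQ : M ≤ #Q) (hQM : #Q ≤ Δ * M)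
    (hDQ : ∀ x ∈ Q, x ∈ D → x = q) (hq : par q ∈ D) (hcard : (#D : ℝ) ≤ (1 - 2 * ε) * #B)
    (hpot : degPotential G B l (B \ D.image φ) ≤ P * Real.exp (κ * #D)) :
    ∃ φ' : ι → V, IsEmb G par B (D ∪ Q) r v φ' ∧ (∀ x ∈ D, φ' x = φ x) ∧
      degPotential G B l (B \ (D ∪ Q).image φ') ≤ P * Real.exp (κ * #(D ∪ Q)) := by
  set U := B \ D.image φ with hUdef
  have hUB : U ⊆ B := sdiff_subset
  have hUc : (#U : ℝ) = #B - #D := h.card_sdiff_image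
  have hn := hp.n_pos
  have hεn : 0 < ε * #B := mul_pos hp.ε_pos hn
  have hUge : 2 * ε * #B ≤ #U := by rw [hUc]; linarith
  have hUpos : (0 : ℝ) < #U := by linarith
  have hUne : U.Nonempty := card_pos.1 (by exact_mod_cast hUpos)
  have hdeg : ∀ u ∈ B, (1 / 2 + β) * #U ≤ #(nbrs G U u) := by
    refine fun u hu => le_card_nbrs_of_degPotential_le hUne hp.l_pos
      (hpot.trans (le_trans ?_ hp.pot_le)) hu
    have : (#D : ℝ) ≤ #B := by linarith
    have := hp.P_pos
    have := hp.κ_nonneg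
    gcongr
  obtain ⟨ρ, hρB, hρ1, hρ2⟩ : ∃ ρ ∈ B, (q ∈ D → φ q = ρ) ∧
      (q ∉ D → ρ ∈ U ∧ G.Adj (φ (par q)) ρ) := by
    by_cases hqD : q ∈ D
    · exact ⟨φ q, h.mem q hqD, fun _ => rfl, fun hc => absurd hqD hc⟩
    · have h1 := hdeg (φ (par q)) (h.mem _ hq)
      have h2 : (0 : ℝ) < #(nbrs G U (φ (par q))) :=
        lt_of_lt_of_le (mul_pos (by linarith [hp.β_pos]) hUpos) h1
      obtain ⟨ρ, hρ⟩ := card_pos.1 (by exact_mod_cast h2 : 0 < #(nbrs G U (φ (par q))))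
      rw [mem_nbrs] at hρ
      exact ⟨ρ, hUB hρ.1, fun hc => absurd hc hqD, fun _ => hρ⟩
  have hQK : (#Q : ℝ) ≤ (Δ * M : ℕ) := by exact_mod_cast hQM
  obtain ⟨ψ, hψq, hψinj, hψadj, hψU, hψsum⟩ := hQ.exists_balanced_embedding (G := G) (U := U)
    (ρ := ρ) hp.β_pos hp.β_le hp.η_pos hp.η_le (k := k) (by linarith [hp.size_le_k])
    (hp.k_le.trans (mul_le_mul_of_nonneg_left hUge hp.η_pos.le))
    (hp.k_exp_le.trans (mul_le_mul_of_nonneg_left hUge hp.β_pos.le))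
    (fun u hu => hdeg u (hUB hu)) (hdeg ρ hρB) (degWeight G B l U)
    (fun u _ => degWeight_nonneg u) (fun u _ => degWeight_le_one u)
  have hnewU : ∀ x ∈ Q, x ∉ D → ψ x ∈ U := by
    intro x hx hxD
    by_cases hxq : x = q
    · subst hxq
      rw [hψq]
      exact (hρ2 hxD).1
    · exact hψU x hx hxq
  obtain ⟨φ', hφ', hφD, hφQ⟩ := h.glue hD hQ hψinj hψadj (fun x hx hxD => by
      have := hDQ x hx hxD
      subst this
      rw [hψq, hρ1 hxD]) hnewU (fun hqD => ⟨hq, by rw [hψq]; exact (hρ2 hqD).2⟩)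
  refine ⟨φ', hφ', hφD, ?_⟩
  set R := (Q \ D).image ψ with hR
  have hRU : R ⊆ U := image_subset_iff.2 fun x hx => by
    rw [mem_sdiff] at hx
    exact hnewU x hx.1 hx.2
  have hU' : B \ (D ∪ Q).image φ' = U \ R := by
    have h1 : (D ∪ Q).image φ' = D.image φ ∪ R := by
      rw [← union_sdiff_self_eq_union, image_union, hR]
      congr 1
      · exact image_congr hφD
      · exact image_congr fun x hx => hφQ x (mem_sdiff.1 hx).1
    rw [h1, hUdef, sdiff_sdiff_left, sup_eq_union]
  have hinjQD : Set.InjOn ψ (Q \ D : Finset ι) := hψinj.mono (by simp)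
  have hRc : #R = #(Q \ D) := card_image_of_injOn hinjQD
  have hRQ : #R ≤ #Q := hRc ▸ card_le_card sdiff_subset
  have hsub1 : Q.erase q ⊆ Q \ D := fun x hx => by
    rw [mem_erase] at hx
    exact mem_sdiff.2 ⟨hx.2, fun hxD => hx.1 (hDQ x hx.2 hxD)⟩
  have hQR : #Q ≤ #R + 1 := by
    have := card_le_card hsub1
    rw [card_erase_of_mem hQ.root_mem] at this
    omega
  have hDQc : #(D ∪ Q) = #D + #R := by
    rw [hRc, ← union_sdiff_self_eq_union, card_union_of_disjoint disjoint_sdiff]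
  have hRQ' : (#R : ℝ) ≤ #Q := by exact_mod_cast hRQ
  have hQR' : (#Q : ℝ) ≤ #R + 1 := by exact_mod_cast hQR
  have hM2 : (2 : ℝ) ≤ M := by exact_mod_cast hp.two_le
  have hMQ' : (M : ℝ) ≤ #Q := by exact_mod_cast hMQ
  set avg := (∑ w ∈ U, degWeight G B l U w) / #U with havg
  have havg0 : 0 ≤ avg := div_nonneg (sum_nonneg fun w _ => degWeight_nonneg w) hUpos.le
  have havg1 : avg ≤ 1 := by
    refine div_le_one_of_le₀ ?_ hUpos.le
    refine (sum_le_sum fun w _ => degWeight_le_one w).trans ?_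
    simp
  have hsumR : ∑ w ∈ R, degWeight G B l U w ≤ #R * avg + 10 * η * #R := by
    rw [hR, sum_image hinjQD, ← hR]
    have h1 : ∑ x ∈ Q \ D, degWeight G B l U (ψ x) ≤
        ∑ x ∈ Q.erase q, degWeight G B l U (ψ x) + (#R + 1 - #Q) := by
      have h2 : #((Q \ D) \ Q.erase q) + #Q = #R + 1 := by
        rw [card_sdiff_of_subset hsub1, card_erase_of_mem hQ.root_mem, ← hRc]
        have h6 := card_le_card hsub1
        have h7 : 0 < #Q := card_pos.2 ⟨q, hQ.root_mem⟩
        rw [card_erase_of_mem hQ.root_mem, ← hRc] at h6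
        omega
      have h2' : (#((Q \ D) \ Q.erase q) : ℝ) = #R + 1 - #Q := by
        have : (#((Q \ D) \ Q.erase q) : ℝ) + #Q = #R + 1 := by exact_mod_cast h2
        linarith
      rw [← sum_sdiff hsub1, add_comm, ← h2']
      gcongr
      refine (sum_le_sum fun x _ => degWeight_le_one (ψ x)).trans ?_
      simp
    have h3 : (#Q - #R : ℝ) * avg + (#R + 1 - #Q) ≤ 1 := by nlinarith
    have h4 : (Δ : ℝ) + 1 ≤ η * #Q := hp.le_M.trans (mul_le_mul_of_nonneg_left hMQ' hp.η_pos.le)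
    have h5 : η * #Q ≤ η * (2 * #R) := mul_le_mul_of_nonneg_left (by linarith) hp.η_pos.le
    nlinarith
  have hRK : (#R : ℝ) ≤ (Δ * M : ℕ) := hRQ'.trans hQK
  have hRε : (#R : ℝ) ≤ ε * #B := hRK.trans hp.size_le
  have hUR : ε * #B ≤ #U - #R := by linarith
  have hstep := degPotential_sdiff_le hRU (by
      have : (#R : ℝ) < #U := by linarith
      exact_mod_cast this) hp.l_pos.le (by
      have := mul_le_mul_of_nonneg_left hRK hp.l_pos.le
      linarith [hp.l_mul_le]) hsumR
  rw [hU', hDQc]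
  refine hstep.trans ?_
  have hexp : l * (10 * η * #R) / (#U - #R) + l ^ 2 * #R ^ 2 / (#U - #R) ^ 2 ≤ κ * #R := by
    have hl := hp.l_pos
    have hη := hp.η_pos
    calc l * (10 * η * #R) / (#U - #R) + l ^ 2 * #R ^ 2 / (#U - #R) ^ 2
        ≤ l * (10 * η * #R) / (ε * #B) + l ^ 2 * (#R * (Δ * M : ℕ)) / (ε * #B) ^ 2 := by
          have : (#R : ℝ) ^ 2 ≤ #R * (Δ * M : ℕ) := by
            rw [sq]
            gcongr
          gcongr
      _ = (10 * l * η / (ε * #B) + l ^ 2 * (Δ * M : ℕ) / (ε * #B) ^ 2) * #R := by ring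
      _ ≤ κ * #R := mul_le_mul_of_nonneg_right hp.le_κ (Nat.cast_nonneg _)
  calc _ ≤ P * Real.exp (κ * #D) * Real.exp (κ * #R) :=
        mul_le_mul hpot (Real.exp_le_exp.2 hexp) (Real.exp_pos _).le
          (mul_nonneg hp.P_pos.le (Real.exp_pos _).le)
    _ = _ := by
      rw [mul_assoc, ← Real.exp_add]
      push_cast
      ring_nf

/-- Attaching pieces until almost all vertices are used. -/
lemma PieceChain.exists_extension {ι V : Type*} [DecidableEq ι] [DecidableEq V]
    {G : SimpleGraph V} {par : ι → ι} {dep : ι → ℕ} {Δ M k : ℕ} {ε β η l κ P : ℝ} {B : Finset V}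
    {S A A₀ D₁ : Finset ι} {r : ι} {v : V} {φ₁ : ι → V} (hc : PieceChain par dep Δ M r S A)
    (hp : PieceParams Δ M k #B ε β η l κ P) (hA₀ : IsRootedTree par dep Δ A₀ r)
    (hSD : S ⊆ D₁) (hD₁A : D₁ ⊆ A₀) (hD₁ : IsRootedTree par dep Δ D₁ r)
    (hDS : ∀ x ∈ D₁, x ∉ S → par x ∈ S) (hφ₁ : IsEmb G par B D₁ r v φ₁)
    (hcard : (#D₁ : ℝ) ≤ (1 - ε) * #B)
    (hpot : degPotential G B l (B \ D₁.image φ₁) ≤ P * Real.exp (κ * #D₁)) (hA : A ⊆ A₀) :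
    ∃ D φ, D₁ ⊆ D ∧ D ⊆ A₀ ∧ IsRootedTree par dep Δ D r ∧ IsEmb G par B D r v φ ∧
      (∀ x ∈ D₁, φ x = φ₁ x) ∧ (#D : ℝ) ≤ (1 - ε) * #B ∧
      degPotential G B l (B \ D.image φ) ≤ P * Real.exp (κ * #D) ∧
      (D = A ∪ D₁ ∨ (1 - 2 * ε) * #B ≤ #D) := by
  induction hc with
  | refl =>
    exact ⟨D₁, φ₁, subset_rfl, hD₁A, hD₁, hφ₁, fun _ _ => rfl, hcard, hpot,
      .inl (union_eq_right.2 hSD).symm⟩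
  | step A Q q hc hAt hQ hAQ hq hdq hMQ hQM ih =>
    obtain ⟨D, φ, h1, h2, h3, h4, h5, h6, h7, h8⟩ := ih (subset_union_left.trans hA)
    by_cases hfull : (1 - 2 * ε) * #B ≤ #D
    · exact ⟨D, φ, h1, h2, h3, h4, h5, h6, h7, .inr hfull⟩
    have hDeq := h8.resolve_right hfull
    have hlt := not_le.1 hfull
    have hQD : ∀ x ∈ Q, x ∈ D → x = q := by
      intro x hx hxD
      rw [hDeq, mem_union] at hxD
      by_contra hxq
      rcases hxD with hxA | hxD
      · exact disjoint_left.1 hAQ hxA hx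
      · by_cases hxS : x ∈ S
        · exact disjoint_left.1 hAQ (hc.subset hxS) hx
        · exact disjoint_left.1 hAQ (hc.subset (hDS x hxD hxS)) (hQ.par_mem x hx hxq)
    have hqD : par q ∈ D := by
      rw [hDeq]
      exact mem_union_left _ hq
    obtain ⟨φ', h9, h10, h11⟩ := h4.attach_piece hp h3 hQ hMQ hQM hQD hqD hlt.le h7
    have hsub : D ∪ Q ⊆ A₀ := union_subset h2 (subset_union_right.trans hA)
    refine ⟨D ∪ Q, φ', h1.trans subset_union_left, hsub, ?_, h9, fun x hx => ?_, ?_, h11, .inl ?_⟩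
    · refine hA₀.subset hsub (mem_union_left _ h3.root_mem) fun x hx hxr => ?_
      by_cases hxD : x ∈ D
      · exact mem_union_left _ (h3.par_mem x hxD hxr)
      · by_cases hxq : x = q
        · rw [hxq]
          exact mem_union_left _ hqD
        · exact mem_union_right _ (hQ.par_mem x ((mem_union.1 hx).resolve_left hxD) hxq)
    · rw [h10 x (h1 hx), h5 x hx]
    · have h12 : (#(D ∪ Q) : ℝ) ≤ #D + (Δ * M : ℕ) := by
        exact_mod_cast (card_union_le _ _).trans (Nat.add_le_add_left hQM _)
      linarith [hp.size_le]
    · rw [hDeq, union_right_comm]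

/-- `x` can be moved to `w`, and then a child of a vertex at `u` can be placed at the old position
of `x`. -/
def IsSwitchable {ι V : Type*} (G : SimpleGraph V) (par : ι → ι) (A : Finset ι) (r : ι) (φ : ι → V)
    (x : ι) (w u : V) : Prop :=
  G.Adj (φ x) u ∧ G.Adj (φ (par x)) w ∧ ∀ c ∈ A, c ≠ r → par c = x → G.Adj (φ c) w

open Classical in
/-- An embedding of a subtree with enough switchable vertices extends to the whole tree. -/
lemma IsEmb.exists_of_isSwitchable {ι V : Type*} {G : SimpleGraph V}
    {par : ι → ι} {dep : ι → ℕ} {Δ : ℕ} {B : Finset V} {A : Finset ι} {r : ι} {v : V}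
    (hA : IsRootedTree par dep Δ A r) (hAB : #A = #B) (m : ℕ) :
    ∀ (D X : Finset ι) (φ : ι → V), #A = #D + m → D ⊆ A → IsRootedTree par dep Δ D r →
      IsEmb G par B D r v φ → X ⊆ D → r ∉ X → (∀ x ∈ X, par x ∉ X) →
      (∀ x ∈ X, ∀ c ∈ A, c ≠ r → par c = x → c ∈ D) →
      (∀ w ∈ B, ∀ u ∈ B, m ≤ #{x ∈ X | IsSwitchable G par A r φ x w u}) →
      ∃ φ', IsEmb G par B A r v φ' := by
  induction m with
  | zero =>
    intro D X φ hm hDA hD hφ _ _ _ _ _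
    have : D = A := eq_of_subset_of_card_le hDA (by omega)
    exact ⟨φ, this ▸ hφ⟩
  | succ m ih =>
    intro D X φ hm hDA hD hφ hXD hrX hXpar hXc hgood
    have hne : D ≠ A := by
      rintro rfl
      omega
    obtain ⟨y, hyA, hyD, hyr, hpy⟩ := hA.exists_next hDA hD.root_mem hne
    obtain ⟨w, hwB, hwD⟩ : ∃ w ∈ B, w ∉ D.image φ := by
      by_contra hcon
      push Not at hcon
      have h1 := card_le_card hcon
      have h2 := card_image_le (s := D) (f := φ)
      omega
    have hw : ∀ z ∈ D, φ z ≠ w := fun z hz he => hwD (mem_image.2 ⟨z, hz, he⟩)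
    have h1 := hgood w hwB (φ (par y)) (hφ.mem _ hpy)
    obtain ⟨x, hx⟩ := card_pos.1 (lt_of_lt_of_le (Nat.succ_pos m) h1)
    rw [mem_filter] at hx
    obtain ⟨hxX, hxu, hxw, hxc⟩ := hx
    have hxD := hXD hxX
    have hxr : x ≠ r := fun h0 => hrX (h0 ▸ hxX)
    have hxy : x ≠ y := fun h0 => hyD (h0 ▸ hxD)
    let φ' : ι → V := Function.update (Function.update φ x w) y (φ x)
    have hφy : φ' y = φ x := Function.update_self _ _ _
    have hφx : φ' x = w := by
      simp only [φ']
      rw [Function.update_of_ne hxy, Function.update_self]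
    have hφz : ∀ z, z ≠ y → z ≠ x → φ' z = φ z := fun z h1 h2 => by
      simp only [φ']
      rw [Function.update_of_ne h1, Function.update_of_ne h2]
    have hφD : ∀ z ∈ D, z ≠ x → φ' z = φ z := fun z hz h2 =>
      hφz z (fun h0 => hyD (h0 ▸ hz)) h2
    have hpx : par x ≠ x := fun h0 => by
      have := hD.dep_eq x hxD hxr
      rw [h0] at this
      omega
    have hemb : IsEmb G par B (insert y D) r v φ' := by
      refine ⟨?_, ?_, ?_, ?_⟩
      · rw [hφD r hD.root_mem hxr.symm, hφ.root]
      · intro z hz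
        rcases mem_insert.1 hz with rfl | hz
        · rw [hφy]
          exact hφ.mem x hxD
        · by_cases hzx : z = x
          · rw [hzx, hφx]
            exact hwB
          · rw [hφD z hz hzx]
            exact hφ.mem z hz
      · rw [coe_insert, Set.injOn_insert (by simpa using hyD)]
        constructor
        · intro a ha b hb hab
          by_cases hax : a = x <;> by_cases hbx : b = x
          · rw [hax, hbx]
          · rw [hax, hφx, hφD b hb hbx] at hab
            exact absurd hab.symm (hw b hb)
          · rw [hbx, hφx, hφD a ha hax] at hab
            exact absurd hab (hw a ha)
          · rw [hφD a ha hax, hφD b hb hbx] at hab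
            exact hφ.inj ha hb hab
        · rintro ⟨a, ha, hae⟩
          rw [hφy] at hae
          by_cases hax : a = x
          · rw [hax, hφx] at hae
            exact hw x hxD hae.symm
          · rw [hφD a ha hax] at hae
            exact hax (hφ.inj ha hxD hae)
      · intro z hz hzr
        rcases mem_insert.1 hz with rfl | hz
        · have : par z ≠ x := fun h0 => hyD (hXc x hxX z hyA hyr h0)
          rw [hφy, hφD _ hpy this]
          exact hxu.symm
        · have hpz := hD.par_mem z hz hzr
          by_cases hzx : z = x
          · rw [hzx, hφx, hφD _ (hzx ▸ hpz) hpx]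
            exact hxw
          · rw [hφD z hz hzx]
            by_cases hpzx : par z = x
            · rw [hpzx, hφx]
              exact (hxc z (hDA hz) hzr hpzx).symm
            · rw [hφD _ hpz hpzx]
              exact hφ.adj z hz hzr
    refine ih (insert y D) (X.erase x) φ' ?_ (insert_subset hyA hDA) ?_ hemb
      ((erase_subset _ _).trans (hXD.trans (subset_insert _ _)))
      (fun h0 => hrX (mem_of_mem_erase h0))
      (fun z hz h0 => hXpar z (mem_of_mem_erase hz) (mem_of_mem_erase h0))
      (fun z hz c hc hcr hcz => mem_insert_of_mem (hXc z (mem_of_mem_erase hz) c hc hcr hcz)) ?_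
    · rw [card_insert_of_notMem hyD]
      omega
    · refine hA.subset (insert_subset hyA hDA) (mem_insert_of_mem hD.root_mem) fun z hz hzr => ?_
      rcases mem_insert.1 hz with rfl | hz
      · exact mem_insert_of_mem hpy
      · exact mem_insert_of_mem (hD.par_mem z hz hzr)
    · intro w' hw' u' hu'
      have h2 := hgood w' hw' u' hu'
      have h3 : ({z ∈ X | IsSwitchable G par A r φ z w' u'}).erase x ⊆
          {z ∈ X.erase x | IsSwitchable G par A r φ' z w' u'} := by
        intro z hz
        rw [mem_erase, mem_filter] at hz
        obtain ⟨hzx, hzX, hz1, hz2, hz3⟩ := hz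
        have hzr : z ≠ r := fun h0 => hrX (h0 ▸ hzX)
        refine mem_filter.2 ⟨mem_erase.2 ⟨hzx, hzX⟩, ?_, ?_, fun c hc hcr hcz => ?_⟩
        · rwa [hφD z (hXD hzX) hzx]
        · rwa [hφD _ (hD.par_mem z (hXD hzX) hzr) fun h0 => hXpar z hzX (h0 ▸ hxX)]
        · rw [hφD c (hXc z hzX c hc hcr hcz) fun h0 => hXpar x hxX (h0 ▸ hcz ▸ hzX)]
          exact hz3 c hc hcr hcz
      have h4 := card_le_card h3
      have h5 := pred_card_le_card_erase (s := {z ∈ X | IsSwitchable G par A r φ z w' u'}) (a := x)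
      omega

lemma IsEmb.insert {ι V : Type*} [DecidableEq ι] {G : SimpleGraph V} {par : ι → ι} {dep : ι → ℕ}
    {Δ : ℕ} {B : Finset V} {D : Finset ι} {r y : ι} {v z : V} {φ : ι → V}
    (h : IsEmb G par B D r v φ) (hD : IsRootedTree par dep Δ D r) (hyD : y ∉ D) (hpy : par y ∈ D)
    (hzB : z ∈ B) (hz : ∀ x ∈ D, φ x ≠ z) (hadj : G.Adj (φ (par y)) z) :
    IsEmb G par B (insert y D) r v (Function.update φ y z) := by
  have hup : ∀ x ∈ D, Function.update φ y z x = φ x := fun x hx =>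
    Function.update_of_ne (ne_of_mem_of_not_mem hx hyD) _ _
  refine ⟨by rw [hup r hD.root_mem, h.root], fun x hx => ?_, ?_, fun x hx hxr => ?_⟩
  · rcases mem_insert.1 hx with rfl | hx
    · rwa [Function.update_self]
    · rw [hup x hx]
      exact h.mem x hx
  · rw [coe_insert, Set.injOn_insert (by simpa using hyD)]
    refine ⟨h.inj.congr fun x hx => (hup x hx).symm, ?_⟩
    rintro ⟨x, hx, hxe⟩
    rw [hup x hx, Function.update_self] at hxe
    exact hz x hx hxe
  · rcases mem_insert.1 hx with rfl | hx
    · rwa [Function.update_self, hup _ hpy]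
    · rw [hup x hx, hup _ (hD.par_mem x hx hxr)]
      exact h.adj x hx hxr

/-- The embedded neighbours of `x` are adjacent to `w`, and `x` itself, if embedded, to `u`. -/
def MeetsOn {ι V : Type*} [DecidableEq ι] (G : SimpleGraph V) (N : ι → Finset ι)
    (D : Finset ι) (φ : ι → V) (w u : V) (x : ι) : Prop :=
  ∀ y ∈ N x, y ∈ D → G.Adj (φ y) (if y = x then u else w)

open Classical in
/-- A lower bound for the conditional probability that `x` does not become switchable, when the
vertices of `D` are embedded by `φ`. -/
noncomputable def missFactor {ι V : Type*} [DecidableEq ι] (G : SimpleGraph V) (N : ι → Finset ι)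
    (b : ℝ) (D : Finset ι) (φ : ι → V) (w u : V) (x : ι) : ℝ :=
  1 - 1 / 2 * b ^ #(N x \ D) * if MeetsOn G N D φ w u x then 1 else 0

section missFactor

variable {ι V : Type*} [DecidableEq ι] {G : SimpleGraph V} {N : ι → Finset ι} {b : ℝ}
  {D : Finset ι} {φ : ι → V} {w u : V} {x y : ι}

lemma missFactor_nonneg (hb0 : 0 ≤ b) (hb1 : b ≤ 1) : 0 ≤ missFactor G N b D φ w u x := by
  unfold missFactor
  have h1 : b ^ #(N x \ D) ≤ 1 := pow_le_one₀ hb0 hb1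
  have h2 : 0 ≤ b ^ #(N x \ D) := by positivity
  split_ifs <;> linarith

lemma missFactor_update_of_notMem (hy : y ∉ N x) (z : V) :
    missFactor G N b (insert y D) (Function.update φ y z) w u x = missFactor G N b D φ w u x := by
  classical
  have h1 : N x \ insert y D = N x \ D := by
    ext a
    simp only [mem_sdiff, mem_insert]
    constructor
    · tauto
    · rintro ⟨h1, h2⟩
      exact ⟨h1, fun h3 => h3.elim (fun h4 => hy (h4 ▸ h1)) h2⟩
  have h2 : MeetsOn G N (insert y D) (Function.update φ y z) w u x ↔ MeetsOn G N D φ w u x := by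
    refine forall₂_congr fun a ha => ?_
    have hay : a ≠ y := fun h0 => hy (h0 ▸ ha)
    rw [Function.update_of_ne hay, mem_insert, or_iff_right hay]
  unfold missFactor
  rw [h1]
  congr 2
  exact if_congr h2 rfl rfl

lemma sum_missFactor_update_le (hb0 : 0 ≤ b) (hy : y ∈ N x) (hyD : y ∉ D) {C : Finset V}
    (hC : b * #C ≤ #(nbrs G C (if y = x then u else w))) :
    ∑ z ∈ C, missFactor G N b (insert y D) (Function.update φ y z) w u x ≤
      #C * missFactor G N b D φ w u x := by
  classical
  have h1 : #(N x \ D) = #(N x \ insert y D) + 1 := by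
    rw [← card_insert_of_notMem (s := N x \ insert y D) (a := y) (by simp)]
    congr 1
    ext a
    simp only [mem_sdiff, mem_insert]
    constructor
    · rintro ⟨h1, h2⟩
      by_cases h3 : a = y
      · exact .inl h3
      · exact .inr ⟨h1, fun h4 => h4.elim h3 h2⟩
    · rintro (rfl | h1)
      · exact ⟨hy, hyD⟩
      · exact ⟨h1.1, fun h2 => h1.2 (.inr h2)⟩
  have h2 : ∀ z, MeetsOn G N (insert y D) (Function.update φ y z) w u x ↔
      MeetsOn G N D φ w u x ∧ G.Adj (if y = x then u else w) z := by
    intro z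
    constructor
    · intro h
      refine ⟨fun a ha haD => ?_, ?_⟩
      · have := h a ha (mem_insert_of_mem haD)
        rwa [Function.update_of_ne (ne_of_mem_of_not_mem haD hyD)] at this
      · have := h y hy (mem_insert_self _ _)
        rw [Function.update_self] at this
        exact this.symm
    · rintro ⟨h3, h4⟩ a ha haD
      rcases mem_insert.1 haD with rfl | haD
      · rw [Function.update_self]
        exact h4.symm
      · rw [Function.update_of_ne (ne_of_mem_of_not_mem haD hyD)]
        exact h3 a ha haD
  unfold missFactor
  simp only [h1, h2, pow_succ]
  have hp0 : 0 ≤ b ^ #(N x \ insert y D) := pow_nonneg hb0 _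
  by_cases hok : MeetsOn G N D φ w u x
  · simp only [hok, true_and, if_true]
    have h5 : ({z ∈ C | G.Adj (if y = x then u else w) z} : Finset V) =
        nbrs G C (if y = x then u else w) := by
      ext z
      simp
    rw [sum_sub_distrib, ← mul_sum, sum_boole, h5]
    simp only [sum_const, nsmul_eq_mul, mul_one]
    nlinarith
  · simp [hok]

/-- The expected number of pairs for which few vertices are switchable does not increase if the
next vertex is embedded suitably. -/
lemma sum_prod_missFactor_update_le (hb0 : 0 ≤ b) (hb1 : b ≤ 1) {X : Finset ι}
    (hN : ∀ x ∈ X, ∀ x' ∈ X, x ≠ x' → Disjoint (N x) (N x')) (hyD : y ∉ D) {C : Finset V}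
    (hCw : b * #C ≤ #(nbrs G C w)) (hCu : b * #C ≤ #(nbrs G C u)) :
    ∑ z ∈ C, ∏ x ∈ X, missFactor G N b (insert y D) (Function.update φ y z) w u x ≤
      #C * ∏ x ∈ X, missFactor G N b D φ w u x := by
  by_cases hx : ∃ x ∈ X, y ∈ N x
  · obtain ⟨x, hxX, hyx⟩ := hx
    have h1 : ∀ z, ∏ x' ∈ X.erase x, missFactor G N b (insert y D) (Function.update φ y z) w u x' =
        ∏ x' ∈ X.erase x, missFactor G N b D φ w u x' := by
      refine fun z => prod_congr rfl fun x' hx' => missFactor_update_of_notMem (fun hy' => ?_) z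
      rw [mem_erase] at hx'
      exact disjoint_left.1 (hN x hxX x' hx'.2 hx'.1.symm) hyx hy'
    simp only [← mul_prod_erase X _ hxX, h1]
    rw [← sum_mul, ← mul_assoc]
    refine mul_le_mul_of_nonneg_right (sum_missFactor_update_le hb0 hyx hyD ?_)
      (prod_nonneg fun _ _ => missFactor_nonneg hb0 hb1)
    split_ifs <;> assumption
  · push Not at hx
    have h1 : ∀ z, ∏ x ∈ X, missFactor G N b (insert y D) (Function.update φ y z) w u x =
        ∏ x ∈ X, missFactor G N b D φ w u x :=
      fun z => prod_congr rfl fun x hxX => missFactor_update_of_notMem (hx x hxX) z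
    simp only [h1, sum_const, nsmul_eq_mul, le_refl]

end missFactor

open Classical in
/-- A small tree can be embedded in such a way that for every pair of vertices of the host graph
many of the vertices in `X` become switchable. -/
lemma IsRootedTree.exists_absorbing_embedding {ι V : Type*} {G : SimpleGraph V} {par : ι → ι}
    {dep : ι → ℕ} {Δ : ℕ} {B : Finset V} {D₁ X : Finset ι} {r : ι} {v : V} {α : ℝ}
    (hα : 0 < α) (hα1 : α ≤ 1) (hD₁ : IsRootedTree par dep Δ D₁ r) (hv : v ∈ B)
    (hdeg : ∀ u ∈ B, (1 / 2 + α) * #B ≤ #(nbrs G B u)) (hcard : (#D₁ : ℝ) ≤ α * #B)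
    (N : ι → Finset ι) (hND : ∀ x ∈ X, N x ⊆ D₁)
    (hN : ∀ x ∈ X, ∀ x' ∈ X, x ≠ x' → Disjoint (N x) (N x')) (hrN : ∀ x ∈ X, r ∉ N x)
    (hNc : ∀ x ∈ X, #(N x) ≤ Δ + 2) {m : ℕ}
    (hm : (#B : ℝ) ^ 2 * (1 - 1 / 2 * α ^ (Δ + 2)) ^ #X ≤ (1 / 2) ^ m) :
    ∃ φ : ι → V, IsEmb G par B D₁ r v φ ∧ ∀ w ∈ B, ∀ u ∈ B,
      m ≤ #{x ∈ X | ∀ y ∈ N x, G.Adj (φ y) (if y = x then u else w)} := by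
  have hBpos : (0 : ℝ) < #B := by exact_mod_cast card_pos.2 ⟨v, hv⟩
  have main : ∀ j < #D₁, ∃ D φ, D ⊆ D₁ ∧ #D = j + 1 ∧ IsRootedTree par dep Δ D r ∧
      IsEmb G par B D r v φ ∧ ∑ p ∈ B ×ˢ B, ∏ x ∈ X, missFactor G N α D φ p.1 p.2 x ≤
        (#B : ℝ) ^ 2 * (1 - 1 / 2 * α ^ (Δ + 2)) ^ #X := by
    intro j
    induction j with
    | zero =>
      intro _
      refine ⟨{r}, fun _ => v, by simpa using hD₁.root_mem, by simp, ?_, ?_, ?_⟩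
      · exact hD₁.subset (by simpa using hD₁.root_mem) (by simp) fun x hx hxr =>
          absurd (mem_singleton.1 hx) hxr
      · exact ⟨rfl, fun _ _ => hv, by simp, fun x hx hxr => absurd (mem_singleton.1 hx) hxr⟩
      · have h1 : ∀ p ∈ B ×ˢ B, ∏ x ∈ X, missFactor G N α {r} (fun _ => v) p.1 p.2 x ≤
            (1 - 1 / 2 * α ^ (Δ + 2)) ^ #X := by
          intro p _
          rw [← prod_const]
          refine prod_le_prod (fun _ _ => missFactor_nonneg hα.le hα1) fun x hx => ?_
          have h2 : MeetsOn G N {r} (fun _ => v) p.1 p.2 x := fun y hy hyr =>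
            absurd (mem_singleton.1 hyr ▸ hy) (hrN x hx)
          have h3 : N x \ {r} = N x := sdiff_eq_self_of_disjoint (disjoint_singleton_right.2 (hrN x hx))
          have h4 : α ^ (Δ + 2) ≤ α ^ #(N x) := pow_le_pow_of_le_one hα.le hα1 (hNc x hx)
          simp only [missFactor, h2, h3, if_true]
          linarith
        refine (sum_le_sum h1).trans (le_of_eq ?_)
        rw [sum_const, card_product, nsmul_eq_mul]
        push_cast
        ring
    | succ j ih =>
      intro hj
      obtain ⟨D, φ, hDD, hDc, hD, hφ, hpot⟩ := ih (by omega)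
      obtain ⟨y, hyD₁, hyD, hyr, hpy⟩ := hD₁.exists_next hDD hD.root_mem (by
        rintro rfl
        omega)
      set C := nbrs G (B \ D.image φ) (φ (par y)) with hC
      have hCcard : ∀ s ∈ B, α * #B ≤ #(nbrs G C s) := by
        intro s hs
        have h1 : (nbrs G B (φ (par y)) ∩ nbrs G B s) \ D.image φ ⊆ nbrs G C s := by
          intro z hz
          simp only [mem_sdiff, mem_inter, mem_nbrs, hC] at hz ⊢
          tauto
        have h2 := card_le_card h1
        have h3 := le_card_sdiff (D.image φ) (nbrs G B (φ (par y)) ∩ nbrs G B s)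
        have h4 := card_union_add_card_inter (nbrs G B (φ (par y))) (nbrs G B s)
        have h5 := card_le_card (union_subset (nbrs_subset G B (φ (par y))) (nbrs_subset G B s))
        have h6 := card_image_le (s := D) (f := φ)
        have h7 : #(nbrs G B (φ (par y))) + #(nbrs G B s) ≤ #B + #D + #(nbrs G C s) := by omega
        have h8 : (#(nbrs G B (φ (par y))) + #(nbrs G B s) : ℝ) ≤ #B + #D + #(nbrs G C s) := by
          exact_mod_cast h7
        have h9 := hdeg s hs
        have h10 := hdeg _ (hφ.mem _ hpy)
        have h11 : (#D : ℝ) ≤ #D₁ := by exact_mod_cast card_le_card hDD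
        linarith
      have hCB : (#C : ℝ) ≤ #B := by
        exact_mod_cast card_le_card ((nbrs_subset _ _ _).trans sdiff_subset)
      have hCs : ∀ s ∈ B, α * #C ≤ #(nbrs G C s) := fun s hs =>
        (mul_le_mul_of_nonneg_left hCB hα.le).trans (hCcard s hs)
      have hCne : C.Nonempty := by
        have h1 : (0 : ℝ) < #(nbrs G C v) := lt_of_lt_of_le (mul_pos hα hBpos) (hCcard v hv)
        exact (card_pos.1 (by exact_mod_cast h1 : 0 < #(nbrs G C v))).mono (nbrs_subset _ _ _)
      obtain ⟨z, hz, hzle⟩ := exists_le_of_sum_le hCne (f := fun z => ∑ p ∈ B ×ˢ B, ∏ x ∈ X,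
          missFactor G N α (insert y D) (Function.update φ y z) p.1 p.2 x)
          (g := fun _ => ∑ p ∈ B ×ˢ B, ∏ x ∈ X, missFactor G N α D φ p.1 p.2 x) (by
        rw [sum_comm, sum_const, nsmul_eq_mul, mul_sum]
        refine sum_le_sum fun p hp => ?_
        rw [mem_product] at hp
        exact sum_prod_missFactor_update_le hα.le hα1 hN hyD (hCs _ hp.1) (hCs _ hp.2))
      rw [hC, mem_nbrs, mem_sdiff] at hz
      refine ⟨insert y D, Function.update φ y z, insert_subset hyD₁ hDD,
        by rw [card_insert_of_notMem hyD, hDc], ?_, ?_, hzle.trans hpot⟩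
      · refine hD₁.subset (insert_subset hyD₁ hDD) (mem_insert_of_mem hD.root_mem)
          fun a ha har => ?_
        rcases mem_insert.1 ha with rfl | ha
        · exact mem_insert_of_mem hpy
        · exact mem_insert_of_mem (hD.par_mem a ha har)
      · exact hφ.insert hD hyD hpy hz.1.1
          (fun a ha h0 => hz.1.2 (mem_image.2 ⟨a, ha, h0⟩)) hz.2
  have hDpos : 0 < #D₁ := card_pos.2 ⟨r, hD₁.root_mem⟩
  obtain ⟨D, φ, hDD, hDc, -, hφ, hpot⟩ := main (#D₁ - 1) (by omega)
  obtain rfl : D = D₁ := eq_of_subset_of_card_le hDD (by omega)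
  refine ⟨φ, hφ, fun w hw u hu => ?_⟩
  have h1 := (single_le_sum (f := fun p : V × V => ∏ x ∈ X, missFactor G N α D φ p.1 p.2 x)
    (fun p _ => prod_nonneg fun _ _ => missFactor_nonneg hα.le hα1)
    (mk_mem_product hw hu)).trans (hpot.trans hm)
  have h2 : ∏ x ∈ X, missFactor G N α D φ w u x =
      (1 / 2) ^ #{x ∈ X | ∀ y ∈ N x, G.Adj (φ y) (if y = x then u else w)} := by
    rw [← prod_const, prod_filter]
    refine prod_congr rfl fun x hx => ?_
    have h3 : MeetsOn G N D φ w u x ↔ ∀ y ∈ N x, G.Adj (φ y) (if y = x then u else w) :=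
      ⟨fun h y hy => h y hy (hND x hx hy), fun h y hy _ => h y hy⟩
    have h4 : N x \ D = ∅ := sdiff_eq_empty_iff_subset.2 (hND x hx)
    unfold missFactor
    rw [h4, card_empty, pow_zero]
    simp only [h3]
    split_ifs <;> norm_num
  simp only [h2] at h1
  exact (pow_le_pow_iff_right_of_lt_one₀ (by norm_num) (by norm_num)).1 h1

/-- A rooted tree contains many vertices whose closed neighbourhoods are disjoint. -/
lemma IsRootedTree.exists_separated {ι : Type*} [DecidableEq ι] {par : ι → ι} {dep : ι → ℕ}
    {Δ : ℕ} {S : Finset ι} {r : ι} (hS : IsRootedTree par dep Δ S r) :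
    ∃ X ⊆ S, (∀ x ∈ X, x ≠ r ∧ par x ≠ r) ∧ Set.InjOn par X ∧
      (∀ x ∈ X, ∀ x' ∈ X, dep x % 3 = dep x' % 3) ∧ #S ≤ 1 + Δ + 3 * (Δ * #X) := by
  set S' : Finset ι := {x ∈ S | x ≠ r ∧ par x ≠ r} with hS'
  have hchild : ∀ y, #{x ∈ S | x ≠ r ∧ par x = y} ≤ Δ := fun y => by
    refine le_trans (card_le_card fun x hx => ?_) (hS.card_children y)
    rw [mem_filter] at hx ⊢
    refine ⟨hx.1, hx.2.2, ?_⟩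
    rw [← hx.2.2]
    exact hS.dep_eq x hx.1 hx.2.1
  have hcS : #S ≤ 1 + Δ + #S' := by
    have h1 : S ⊆ ({r} ∪ {x ∈ S | x ≠ r ∧ par x = r}) ∪ S' := by
      intro x hx
      simp only [mem_union, mem_singleton, mem_filter, hS', hx, true_and]
      tauto
    have h2 := card_le_card h1
    have h3 := card_union_le ({r} ∪ {x ∈ S | x ≠ r ∧ par x = r}) S'
    have h4 := card_union_le {r} {x ∈ S | x ≠ r ∧ par x = r}
    have h5 := hchild r
    rw [card_singleton] at h4
    omega
  obtain ⟨c, hc⟩ : ∃ c, #S' ≤ 3 * #{x ∈ S' | dep x % 3 = c} := by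
    have h1 := card_eq_sum_card_fiberwise (s := S') (t := range 3) (f := fun x => dep x % 3)
      (fun x _ => mem_coe.2 (mem_range.2 (Nat.mod_lt _ (by norm_num))))
    by_contra hcon
    push Not at hcon
    have h2 := hcon 0
    have h3 := hcon 1
    have h4 := hcon 2
    simp only [sum_range_succ, sum_range_zero] at h1
    omega
  set Y : Finset ι := {x ∈ S' | dep x % 3 = c} with hY
  obtain ⟨X, hXY, hXim, hXinj⟩ : ∃ X ⊆ Y, X.image par = Y.image par ∧ Set.InjOn par X := by
    have h1 : ∀ y ∈ Y.image par, ∃ x ∈ Y, par x = y := fun y hy => mem_image.1 hy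
    choose! f hf hpf using h1
    refine ⟨(Y.image par).image f, image_subset_iff.2 hf, ?_, ?_⟩
    · rw [image_image]
      exact (image_congr fun y hy => hpf y hy).trans image_id
    · intro a ha b hb hab
      rw [mem_coe, mem_image] at ha hb
      obtain ⟨a', ha', rfl⟩ := ha
      obtain ⟨b', hb', rfl⟩ := hb
      rw [hpf a' ha', hpf b' hb'] at hab
      rw [hab]
  have hYX : #Y ≤ Δ * #X := by
    rw [← card_image_of_injOn hXinj, hXim]
    refine card_le_mul_card_image Y Δ fun y _ => le_trans (card_le_card fun x hx => ?_) (hchild y)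
    simp only [hY, hS', mem_filter] at hx ⊢
    tauto
  refine ⟨X, hXY.trans ((filter_subset _ _).trans (filter_subset _ _)), fun x hx => ?_, hXinj,
    fun x hx x' hx' => ?_, by omega⟩
  · have := hXY hx
    simp only [hY, hS', mem_filter] at this
    exact this.1.2
  · rw [(mem_filter.1 (hXY hx)).2, (mem_filter.1 (hXY hx')).2]

/-- A parent-closed set which contains the closed neighbourhood of every vertex of `X`. -/
lemma IsRootedTree.exists_absorbing_tree {ι V : Type*} [iι : DecidableEq ι] [DecidableEq V]
    {G : SimpleGraph V} {par : ι → ι} {dep : ι → ℕ} {Δ : ℕ} {B : Finset V} {A S : Finset ι} {r : ι}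
    {v : V} {α : ℝ} (hΔ : 0 < Δ) (hα : 0 < α) (hα1 : α ≤ 1) (hA : IsRootedTree par dep Δ A r)
    (hS : IsRootedTree par dep Δ S r) (hSA : S ⊆ A) (hv : v ∈ B)
    (hdeg : ∀ u ∈ B, (1 / 2 + α) * #B ≤ #(nbrs G B u)) (hcard : (Δ + 1) * #S ≤ α / 4 * #B)
    {m t : ℕ} (ht : 1 + Δ + 3 * (Δ * t) ≤ #S)
    (hm : (#B : ℝ) ^ 2 * (1 - 1 / 2 * α ^ (Δ + 2)) ^ t ≤ (1 / 2) ^ m) :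
    ∃ D₁ φ, S ⊆ D₁ ∧ D₁ ⊆ A ∧ IsRootedTree par dep Δ D₁ r ∧ (∀ x ∈ D₁, x ∉ S → par x ∈ S) ∧
      (#D₁ : ℝ) ≤ α / 4 * #B ∧ IsEmb G par B D₁ r v φ ∧
      ∀ (D : Finset ι) (φ' : ι → V), D₁ ⊆ D → D ⊆ A → IsRootedTree par dep Δ D r →
        IsEmb G par B D r v φ' → (∀ x ∈ D₁, φ' x = φ x) → #A = #B → #A ≤ #D + m →
        ∃ φ'', IsEmb G par B A r v φ'' := by
  obtain rfl : iι = fun _ _ => Classical.propDecidable _ := Subsingleton.elim _ _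
  classical
  obtain ⟨X, hXS, hXr, hXinj, hX3, hXc⟩ := hS.exists_separated
  have hXA : X ⊆ A := hXS.trans hSA
  have htX : Δ * t ≤ Δ * #X := by omega
  let ch : ι → Finset ι := fun x => {c ∈ A | c ≠ r ∧ par c = x}
  have hchild : ∀ y, #(ch y) ≤ Δ := fun y => by
    refine le_trans (card_le_card fun x hx => ?_) (hA.card_children y)
    simp only [ch, mem_filter] at hx ⊢
    refine ⟨hx.1, hx.2.2, ?_⟩
    rw [← hx.2.2]
    exact hA.dep_eq x hx.1 hx.2.1
  let N : ι → Finset ι := fun x => insert (par x) (insert x (ch x))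
  set D₁ : Finset ι := S ∪ X.biUnion ch with hD₁
  have hD₁S : ∀ x ∈ D₁, x ∉ S → par x ∈ X := by
    intro x hx hxS
    obtain ⟨y, hy, hxy⟩ := mem_biUnion.1 ((mem_union.1 hx).resolve_left hxS)
    rw [(mem_filter.1 hxy).2.2]
    exact hy
  have hD₁A : D₁ ⊆ A := union_subset hSA (biUnion_subset.2 fun x _ => filter_subset _ _)
  have hD₁t : IsRootedTree par dep Δ D₁ r := by
    refine hA.subset hD₁A (mem_union_left _ hS.root_mem) fun x hx hxr => mem_union_left _ ?_
    by_cases hxS : x ∈ S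
    · exact hS.par_mem x hxS hxr
    · exact hXS (hD₁S x hx hxS)
  have hD₁c : (#D₁ : ℝ) ≤ α / 4 * #B := by
    have h1 : #D₁ ≤ #S + #X * Δ :=
      (card_union_le _ _).trans (Nat.add_le_add_left (card_biUnion_le_card_mul _ _ _
        fun x _ => hchild x) _)
    have h2 : #D₁ ≤ (Δ + 1) * #S := by
      have := Nat.mul_le_mul_right Δ (card_le_card hXS)
      nlinarith
    have h3 : (#D₁ : ℝ) ≤ (Δ + 1) * #S := by exact_mod_cast h2
    exact h3.trans hcard
  have hdep : ∀ x ∈ X, ∀ y ∈ N x, (y = par x ∧ dep y + 1 = dep x) ∨ y = x ∨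
      (par y = x ∧ dep y = dep x + 1 ∧ y ∈ A ∧ y ≠ r) := by
    intro x hx y hy
    simp only [N, ch, mem_insert, mem_filter] at hy
    rcases hy with rfl | rfl | hy
    · exact .inl ⟨rfl, (hA.dep_eq x (hXA hx) (hXr x hx).1).symm⟩
    · exact .inr (.inl rfl)
    · have := hA.dep_eq y hy.1 hy.2.1
      rw [hy.2.2] at this
      exact .inr (.inr ⟨hy.2.2, this, hy.1, hy.2.1⟩)
  have hND : ∀ x ∈ X, N x ⊆ D₁ := by
    intro x hx
    refine insert_subset (mem_union_left _ (hS.par_mem x (hXS hx) (hXr x hx).1))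
      (insert_subset (mem_union_left _ (hXS hx)) fun c hc => mem_union_right _ ?_)
    exact mem_biUnion.2 ⟨x, hx, hc⟩
  have hNdisj : ∀ x ∈ X, ∀ x' ∈ X, x ≠ x' → Disjoint (N x) (N x') := by
    intro x hx x' hx' hne
    rw [disjoint_left]
    intro y hy hy'
    have h3 := hX3 x hx x' hx'
    rcases hdep x hx y hy with h | h | h <;> rcases hdep x' hx' y hy' with h' | h' | h'
    · exact hne (hXinj hx hx' (h.1.symm.trans h'.1))
    · subst h'
      omega
    · omega
    · subst h
      omega
    · exact hne (h.symm.trans h')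
    · subst h
      omega
    · omega
    · subst h'
      omega
    · exact hne (h.1.symm.trans h'.1)
  have hrN : ∀ x ∈ X, r ∉ N x := by
    intro x hx hr
    rcases hdep x hx r hr with h | h | h
    · exact (hXr x hx).2 h.1.symm
    · exact (hXr x hx).1 h.symm
    · exact h.2.2.2 rfl
  have hNc : ∀ x ∈ X, #(N x) ≤ Δ + 2 := by
    intro x _
    have h1 := card_insert_le (par x) (insert x (ch x))
    have h2 := card_insert_le x (ch x)
    have h3 := hchild x
    simp only [N]
    omega
  obtain ⟨X', hX'X, hX'c⟩ := exists_subset_card_eq (le_of_mul_le_mul_left htX hΔ)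
  have hBpos : (0 : ℝ) ≤ #B := Nat.cast_nonneg _
  obtain ⟨φ, hφ, hgood⟩ := hD₁t.exists_absorbing_embedding (X := X') hα hα1 hv hdeg
    (by nlinarith) N (fun x hx => hND x (hX'X hx))
    (fun x hx x' hx' => hNdisj x (hX'X hx) x' (hX'X hx')) (fun x hx => hrN x (hX'X hx))
    (fun x hx => hNc x (hX'X hx)) (m := m) (by rw [hX'c]; exact hm)
  refine ⟨D₁, φ, subset_union_left, hD₁A, hD₁t, fun x hx hxS => hXS (hD₁S x hx hxS), hD₁c, hφ, ?_⟩
  intro D φ' hDD hDA hD hφ' hagree hAB hAm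
  have hcDA := card_le_card hDA
  refine IsEmb.exists_of_isSwitchable hA hAB (#A - #D) D X' φ' (by omega) hDA hD hφ'
    (fun x hx => hDD (mem_union_left _ (hXS (hX'X hx)))) (fun hr => (hXr r (hX'X hr)).1 rfl)
    (fun x hx hpx => ?_) (fun x hx c hc hcr hcx => hDD (hND x (hX'X hx) ?_)) fun w hw u hu => ?_
  · have h1 := hA.dep_eq x (hXA (hX'X hx)) (hXr x (hX'X hx)).1
    have h2 := hX3 x (hX'X hx) _ (hX'X hpx)
    omega
  · simp only [N, ch, mem_insert, mem_filter]
    exact .inr (.inr ⟨hc, hcr, hcx⟩)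
  · refine le_trans (by omega : #A - #D ≤ m) ((hgood w hw u hu).trans (card_le_card fun x hx => ?_))
    rw [mem_filter] at hx ⊢
    obtain ⟨hx, hN⟩ := hx
    have hN' : ∀ y ∈ N x, G.Adj (φ' y) (if y = x then u else w) := fun y hy => by
      rw [hagree y (hND x (hX'X hx) hy)]
      exact hN y hy
    have hne : ∀ c, dep c = dep x + 1 ∨ dep x = dep c + 1 → c ≠ x := by
      rintro c hc rfl
      omega
    refine ⟨hx, ?_, ?_, fun c hc hcr hcx => ?_⟩
    · simpa using hN' x (by simp [N])
    · have := hN' (par x) (by simp [N])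
      rwa [if_neg (hne _ (.inr (hA.dep_eq x (hXA (hX'X hx)) (hXr x (hX'X hx)).1)))] at this
    · have := hN' c (by simp [N, ch, hc, hcr, hcx])
      have h1 := hA.dep_eq c hc hcr
      rw [hcx] at h1
      rwa [if_neg (hne _ (.inl h1))] at this

lemma eventually_const_le_mul (C : ℝ) {a : ℝ} (ha : 0 < a) :
    ∀ᶠ n : ℕ in Filter.atTop, C ≤ a * n :=
  (tendsto_natCast_atTop_atTop.const_mul_atTop ha).eventually_ge_atTop C

lemma eventually_mul_sqrt_le_mul (C : ℝ) {a : ℝ} (ha : 0 < a) :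
    ∀ᶠ n : ℕ in Filter.atTop, C * √n ≤ a * n := by
  have h1 : ∀ᶠ x : ℝ in Filter.atTop, C ≤ a * √x :=
    (Real.tendsto_sqrt_atTop.const_mul_atTop ha).eventually_ge_atTop C
  filter_upwards [tendsto_natCast_atTop_atTop.eventually h1] with n hn
  calc C * √n ≤ a * √n * √n := mul_le_mul_of_nonneg_right hn (Real.sqrt_nonneg _)
    _ = a * n := by rw [mul_assoc, Real.mul_self_sqrt (Nat.cast_nonneg n)]

lemma eventually_log_le_mul_sqrt {a : ℝ} (ha : 0 < a) :
    ∀ᶠ n : ℕ in Filter.atTop, Real.log n ≤ a * √n := by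
  have h1 := (isLittleO_log_rpow_atTop (r := 1 / 2) (by norm_num)).bound ha
  filter_upwards [tendsto_natCast_atTop_atTop.eventually h1] with n hn
  rw [← Real.sqrt_eq_rpow, Real.norm_of_nonneg (Real.sqrt_nonneg _)] at hn
  exact (le_abs_self _).trans hn

lemma sq_mul_one_sub_pow_le {n c : ℝ} {t m : ℕ} (hn : 0 < n) (hc : c ≤ 1)
    (h : 2 * Real.log n + m ≤ c * t) : n ^ 2 * (1 - c) ^ t ≤ (1 / 2 : ℝ) ^ m := by
  have h1 : (1 - c) ^ t ≤ Real.exp (-(c * t)) := by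
    have := pow_le_pow_left₀ (by linarith) (Real.one_sub_le_exp_neg c) t
    rwa [← Real.exp_nat_mul, show (t : ℝ) * -c = -(c * t) by ring] at this
  have h2 : n ^ 2 = Real.exp (2 * Real.log n) := by
    rw [mul_comm, Real.exp_mul, Real.exp_log hn]
    norm_cast
  have h3 : Real.exp (-m) ≤ (1 / 2 : ℝ) ^ m := by
    have h4 : Real.exp (-1) ≤ 1 / 2 := by
      rw [Real.exp_neg, one_div]
      exact inv_anti₀ (by norm_num) (by linarith [Real.add_one_le_exp 1])
    have := pow_le_pow_left₀ (Real.exp_pos _).le h4 m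
    rwa [← Real.exp_nat_mul, show (m : ℝ) * -1 = -m by ring] at this
  calc n ^ 2 * (1 - c) ^ t ≤ Real.exp (2 * Real.log n) * Real.exp (-(c * t)) := by
        rw [h2]; gcongr
    _ = Real.exp (2 * Real.log n - c * t) := by rw [← Real.exp_add]; ring_nf
    _ ≤ Real.exp (-m) := Real.exp_le_exp.2 (by linarith)
    _ ≤ _ := h3

set_option maxHeartbeats 2000000 in
/-- A bounded degree spanning tree exists in every large graph of minimum degree noticeably above
half the order, and its root may be prescribed. -/
theorem exists_embedding (Δ : ℕ) (hΔ : 1 ≤ Δ) (α : ℝ) (hα : 0 < α) :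
    ∃ n₀ : ℕ, ∀ (ι V : Type) [DecidableEq ι] [DecidableEq V] (G : SimpleGraph V) (par : ι → ι)
      (dep : ι → ℕ) (A : Finset ι) (B : Finset V) (r : ι) (v : V), n₀ ≤ #B → #A = #B →
      IsRootedTree par dep Δ A r → v ∈ B → (∀ u ∈ B, (1 / 2 + α) * #B ≤ #(nbrs G B u)) →
      ∃ φ, IsEmb G par B A r v φ := by
  rcases lt_or_ge (1 / 2) α with hα2 | hα2
  · refine ⟨1, fun ι V _ _ G par dep A B r v hn _ _ hv hdeg => ?_⟩
    have h1 : (#(nbrs G B v) : ℝ) ≤ #B := by exact_mod_cast card_le_card (nbrs_subset _ _ _)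
    have h2 : (1 : ℝ) ≤ #B := by exact_mod_cast hn
    nlinarith [hdeg v hv]
  have hΔ' : (1 : ℝ) ≤ Δ := by exact_mod_cast hΔ
  obtain ⟨c₀, hc₀⟩ : ∃ c₀ : ℝ, c₀ = 1 / 2 * α ^ (Δ + 2) := ⟨_, rfl⟩
  have hc₀0 : 0 < c₀ := by rw [hc₀]; positivity
  have hc₀1 : c₀ ≤ 1 / 2 := by
    have := pow_le_one₀ (n := Δ + 2) hα.le (by linarith)
    rw [hc₀]
    linarith
  obtain ⟨σ, hσ⟩ : ∃ σ : ℝ, σ = α / (4 * (Δ + 1)) := ⟨_, rfl⟩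
  have hσ0 : 0 < σ := by rw [hσ]; positivity
  have hσΔ : (Δ + 1) * σ = α / 4 := by rw [hσ]; field_simp
  have hσ1 : σ ≤ 1 / 2 := by nlinarith
  obtain ⟨ε, hε⟩ : ∃ ε : ℝ, ε = c₀ * σ / (24 * Δ) := ⟨_, rfl⟩
  have hε0 : 0 < ε := by rw [hε]; positivity
  have hεσ : c₀ * (σ / (6 * Δ)) = 4 * ε := by rw [hε]; field_simp; ring
  have hε1 : ε ≤ 1 / 4 := by
    rw [hε, div_le_iff₀ (by positivity)]
    nlinarith
  obtain ⟨η, hη⟩ : ∃ η : ℝ, η = α * ε / 160 := ⟨_, rfl⟩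
  have hη0 : 0 < η := by rw [hη]; positivity
  have hη1 : η ≤ 1 / 160 := by rw [hη]; nlinarith
  obtain ⟨M, hM2, hMη⟩ : ∃ M : ℕ, 2 ≤ M ∧ (Δ + 1 : ℝ) ≤ η * M := by
    obtain ⟨M, hM⟩ := exists_nat_ge ((Δ + 1) / η)
    refine ⟨M + 2, by omega, ?_⟩
    rw [div_le_iff₀ hη0] at hM
    push_cast
    nlinarith
  obtain ⟨k, hk⟩ : ∃ k : ℕ, 2 * (((Δ * M : ℕ) : ℝ) + 1) ≤ (α / 4) ^ 2 * k := by
    obtain ⟨k, hk⟩ := exists_nat_ge (2 * (((Δ * M : ℕ) : ℝ) + 1) / (α / 4) ^ 2)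
    rw [div_le_iff₀ (by positivity)] at hk
    exact ⟨k, by linarith⟩
  obtain ⟨n₀, hn₀⟩ := Filter.eventually_atTop.1 <|
    (Filter.eventually_ge_atTop 1).and <|
    (eventually_const_le_mul (2 + Δ + (Δ * M : ℕ)) (half_pos hσ0)).and <|
    (eventually_const_le_mul ((Δ * M : ℕ)) hε0).and <|
    (eventually_const_le_mul (k : ℝ) (by positivity : 0 < η * (2 * ε))).and <|
    (eventually_const_le_mul (4 * k * 2 ^ k : ℝ) (by positivity : 0 < α / 4 * (2 * ε))).and <|
    (eventually_mul_sqrt_le_mul (Δ * M : ℕ) (by positivity : 0 < 10 * η * ε)).and <|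
    (eventually_mul_sqrt_le_mul 1 hε0).and <|
    (eventually_log_le_mul_sqrt (by positivity : 0 < α / 8)).and <|
    (eventually_log_le_mul_sqrt (by norm_num : (0 : ℝ) < 1 / 2)).and
    (eventually_const_le_mul 1 hε0)
  refine ⟨n₀, fun ι V _ _ G par dep A B r v hn hAB hA hv hdeg => ?_⟩
  obtain ⟨h1n, hn1, hn2, hn3, hn4, hn5, hn6, hn7, hn8, hn9⟩ := hn₀ #B hn
  have hnpos : (0 : ℝ) < #B := by exact_mod_cast h1n
  set n : ℝ := (#B : ℝ) with hndef
  have hσn : 0 < σ * n := mul_pos hσ0 hnpos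
  have hεn : 0 < ε * n := mul_pos hε0 hnpos
  have hαn : α * n ≤ 1 / 2 * n := mul_le_mul_of_nonneg_right hα2 hnpos.le
  have hσn' : σ * n ≤ 1 / 2 * n := mul_le_mul_of_nonneg_right hσ1 hnpos.le
  have hεn' : ε * n ≤ 1 / 4 * n := mul_le_mul_of_nonneg_right hε1 hnpos.le
  have hηεn : 10 * η * (ε * n) ≤ 1 * (ε * n) :=
    mul_le_mul_of_nonneg_right (by linarith) hεn.le
  have hlpos : 0 < √n := Real.sqrt_pos.2 hnpos
  have hKσ : Δ * M ≤ ⌊σ * n⌋₊ := Nat.le_floor (by linarith)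
  obtain ⟨S, hSA, hS, hchain, hSk, hkS⟩ := IsRootedTree.exists_pieceChain hΔ (by omega : 1 ≤ M) hKσ
    A hA (by rw [hAB]; exact Nat.floor_le_of_le (by linarith))
  have hfl := Nat.floor_le (by positivity : 0 ≤ σ * n)
  have hfl' := Nat.lt_floor_add_one (σ * n)
  have hSσ : (#S : ℝ) ≤ σ * n := le_trans (by exact_mod_cast hSk) hfl
  have hσS : σ * n - 1 - (Δ * M : ℕ) ≤ #S := by
    have : ((⌊σ * n⌋₊ : ℕ) : ℝ) ≤ #S + (Δ * M : ℕ) := by exact_mod_cast hkS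
    linarith
  have htfl := Nat.floor_le (by positivity : 0 ≤ σ / (6 * Δ) * n)
  have htfl' := Nat.lt_floor_add_one (σ / (6 * Δ) * n)
  have hmfl := Nat.floor_le (by positivity : 0 ≤ 2 * ε * n)
  have hmfl' := Nat.lt_floor_add_one (2 * ε * n)
  set t := ⌊σ / (6 * Δ) * n⌋₊
  set m := ⌊2 * ε * n⌋₊
  have ht : 1 + Δ + 3 * (Δ * t) ≤ #S := by
    have h1 : (3 * (Δ * t) : ℝ) ≤ σ / 2 * n := by
      have h2 : 3 * (Δ * (σ / (6 * Δ) * n)) = σ / 2 * n := by field_simp; norm_num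
      rw [← h2]
      gcongr
    have h3 : (1 + Δ + 3 * (Δ * t) : ℝ) ≤ #S := by linarith
    exact_mod_cast h3
  obtain ⟨D₁, φ₁, hSD, hD₁A, hD₁, hDS, hD₁c, hφ₁, habs⟩ :=
    hA.exists_absorbing_tree hΔ hα (by linarith) hS hSA hv hdeg
      (by rw [← hσΔ, mul_assoc]; gcongr) (m := m) ht (by
        rw [← hc₀]
        refine sq_mul_one_sub_pow_le hnpos (by linarith) ?_
        have h1 : 4 * ε * n - 1 ≤ c₀ * t := by
          have := mul_le_mul_of_nonneg_left htfl'.le hc₀0.le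
          rw [← hεσ]
          linarith
        linarith)
  have hUc := hφ₁.card_sdiff_image
  have hpp : PieceParams Δ M k #B ε (α / 4) η (√n) (20 * √n * η / (ε * n))
      (n * Real.exp (-(√n * (1 / 2 + α / 2)))) :=
    { n_pos := hnpos, ε_pos := hε0, β_pos := by positivity, β_le := by linarith, η_pos := hη0
      η_le := by linarith, l_pos := hlpos, P_pos := by positivity, κ_nonneg := by positivity
      two_le := hM2, le_M := hMη, size_le := hn2, size_le_k := hk
      k_le := by linarith
      k_exp_le := by linarith
      l_mul_le := by linarith
      le_κ := by
        have h1 : √n ^ 2 * (Δ * M : ℕ) / (ε * n) ^ 2 ≤ 10 * √n * η / (ε * n) := by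
          rw [div_le_div_iff₀ (by positivity) (by positivity)]
          have h2 : 0 ≤ √n * (ε * n) := by positivity
          linarith [mul_le_mul_of_nonneg_left hn5 h2]
        have h2 : 20 * √n * η / (ε * n) = 10 * √n * η / (ε * n) + 10 * √n * η / (ε * n) := by ring
        linarith
      pot_le := by
        have h1 : 20 * √n * η / (ε * n) * #B = √n * (α / 8) := by
          rw [← hndef, hη]
          field_simp
          norm_num
        rw [h1]
        nth_rewrite 1 [← Real.exp_log hnpos]
        rw [← Real.exp_add, ← Real.exp_add]
        exact Real.exp_le_exp.2 (by linarith) }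
  obtain ⟨D, φ, h1, h2, h3, h4, h5, h6, -, h7⟩ := hchain.exists_extension hpp hA hSD hD₁A hD₁ hDS
    hφ₁ (by linarith) (by
      have hU : 0 < #(B \ D₁.image φ₁) := by
        have : (0 : ℝ) < #(B \ D₁.image φ₁) := by rw [hUc]; linarith
        exact_mod_cast this
      have h1 : ∀ u ∈ B, (1 / 2 + α / 2) * #(B \ D₁.image φ₁) ≤
          #(nbrs G (B \ D₁.image φ₁) u) := by
        intro u hu
        have h2 : #(nbrs G B u) ≤ #(nbrs G (B \ D₁.image φ₁) u) + #D₁ := by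
          refine le_trans (card_le_card fun w hw => ?_) ((card_union_le _ (D₁.image φ₁)).trans
            (Nat.add_le_add_left card_image_le _))
          simp only [mem_nbrs, mem_union, mem_sdiff] at hw ⊢
          tauto
        have h3 : (#(nbrs G B u) : ℝ) ≤ #(nbrs G (B \ D₁.image φ₁) u) + #D₁ := by
          exact_mod_cast h2
        have h4 := hdeg u hu
        have h5 : 0 ≤ (1 / 2 + α / 2) * #D₁ := by positivity
        rw [hUc]
        linarith
      refine (degPotential_le (card_pos.1 hU) hlpos.le h1).trans ?_
      refine le_mul_of_one_le_right (by positivity) (Real.one_le_exp ?_)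
      positivity) subset_rfl
  refine habs D φ h1 h2 h3 h4 h5 hAB ?_
  rcases h7 with h7 | h7
  · exfalso
    rw [h7, union_eq_left.2 hD₁A, hAB] at h6
    linarith
  · have h8 : (#A : ℝ) < #D + m + 1 := by rw [hAB]; linarith
    have h9 : #A < #D + m + 1 := by exact_mod_cast h8
    omega

/-- The weight at the mean dominates all other weights of the binomial distribution. -/
lemma choose_mul_pow_le (k l j : ℕ) (hj : j ≤ k + l) :
    k ^ j * l ^ (k + l - j) * (k + l).choose j ≤ k ^ k * l ^ l * (k + l).choose k := by
  set w : ℕ → ℕ := fun j => k ^ j * l ^ (k + l - j) * (k + l).choose j with hw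
  have hstep : ∀ j < k + l, w (j + 1) * ((j + 1) * l) = w j * ((k + l - j) * k) := by
    intro j hj
    have h1 := Nat.choose_succ_right_eq (k + l) j
    have h2 : k + l - j = (k + l - (j + 1)) + 1 := by omega
    simp only [hw]
    calc k ^ (j + 1) * l ^ (k + l - (j + 1)) * (k + l).choose (j + 1) * ((j + 1) * l)
        = k ^ (j + 1) * l ^ (k + l - (j + 1)) * l * ((k + l).choose (j + 1) * (j + 1)) := by ring
      _ = k ^ (j + 1) * l ^ (k + l - (j + 1) + 1) * ((k + l).choose j * (k + l - j)) := by
        rw [h1]; ring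
      _ = _ := by rw [← h2]; ring
  have hup : ∀ i j, k ≤ j → j + i ≤ k + l → w (j + i) ≤ w j := by
    intro i
    induction i with
    | zero => intros; exact le_rfl
    | succ i ih =>
      intro j hkj hji
      refine le_trans ?_ (ih j hkj (by omega))
      have h1 := hstep (j + i) (by omega)
      have hl : 0 < l := by omega
      have h2 : (k + l - (j + i)) * k ≤ (j + i + 1) * l := by
        obtain ⟨d, hd⟩ := Nat.exists_eq_add_of_le (by omega : k ≤ j + i)
        rw [hd]
        have : (k + l - (k + d)) ≤ l := by omega
        nlinarith [Nat.mul_le_mul_right k this]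
      have h3 : w (j + i + 1) * ((j + i + 1) * l) ≤ w (j + i) * ((j + i + 1) * l) := by
        rw [h1]; gcongr
      exact Nat.le_of_mul_le_mul_right h3 (by positivity)
  have hdown : ∀ i j, j + i ≤ k → w j ≤ w (j + i) := by
    intro i
    induction i with
    | zero => intros; exact le_rfl
    | succ i ih =>
      intro j hji
      refine (ih j (by omega)).trans ?_
      have h1 := hstep (j + i) (by omega)
      have h2 : (j + i + 1) * l ≤ (k + l - (j + i)) * k := by
        have h4 : l + 1 ≤ k + l - (j + i) := by omega
        have h5 : j + i + 1 ≤ k := by omega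
        nlinarith [Nat.mul_le_mul_right k h4, Nat.mul_le_mul_right l h5]
      have h3 : w (j + i) * ((k + l - (j + i)) * k) ≤ w (j + i + 1) * ((k + l - (j + i)) * k) := by
        rw [← h1]; gcongr
      have h6 : 0 < k + l - (j + i) := by omega
      have h7 : 0 < k := by omega
      exact Nat.le_of_mul_le_mul_right h3 (by positivity)
  have hk : w k = k ^ k * l ^ l * (k + l).choose k := by simp [hw]
  rw [← hk]
  rcases le_total k j with h | h
  · obtain ⟨d, rfl⟩ := Nat.exists_eq_add_of_le h
    exact hup d k le_rfl hj
  · obtain ⟨d, rfl⟩ := Nat.exists_eq_add_of_le h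
    exact hdown d j le_rfl

lemma add_pow_le_succ_mul_choose (k l : ℕ) :
    (k + l) ^ (k + l) ≤ (k + l + 1) * (k ^ k * l ^ l * (k + l).choose k) := by
  rw [add_pow, ← smul_eq_mul (k + l + 1)]
  refine (sum_le_card_nsmul _ _ _ fun j hj => ?_).trans_eq (by rw [card_range])
  exact choose_mul_pow_le k l j (by rw [mem_range] at hj; omega)

/-- The lower tail of the hypergeometric distribution. -/
lemma card_powersetCard_inter_lt {V : Type*} [DecidableEq V] {E D : Finset V} (hD : D ⊆ E) {k : ℕ}
    (hk : k ≤ #E) (hE : 0 < #E) {τ : ℝ} (hτ : 0 ≤ τ) :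
    (#{S ∈ powersetCard k E | (#(S ∩ D) : ℝ) < k * #D / #E - τ} : ℝ) ≤
      (#E + 1) * Real.exp (-(τ ^ 2 / (2 * #E))) * (#E).choose k := by
  obtain ⟨l, hl⟩ := Nat.exists_eq_add_of_le hk
  have hN : (0 : ℝ) < #E := by exact_mod_cast hE
  have hNkl : (#E : ℝ) = k + l := by exact_mod_cast hl
  set N : ℝ := (#E : ℝ) with hNdef
  obtain ⟨p, hp⟩ : ∃ p : ℝ, p = k / N := ⟨_, rfl⟩
  obtain ⟨q, hq⟩ : ∃ q : ℝ, q = l / N := ⟨_, rfl⟩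
  have hp0 : 0 ≤ p := by rw [hp]; positivity
  have hq0 : 0 ≤ q := by rw [hq]; positivity
  have hpq : p + q = 1 := by rw [hp, hq, ← add_div, ← hNkl, div_self hN.ne']
  obtain ⟨L, hL⟩ : ∃ L : ℝ, L = τ / N := ⟨_, rfl⟩
  have hL0 : 0 ≤ L := by rw [hL]; positivity
  have hmode : 1 ≤ (N + 1) * (p ^ k * q ^ l * (#E).choose k) := by
    have h1 := add_pow_le_succ_mul_choose k l
    rw [← hl] at h1
    have h2 : N ^ #E ≤ (N + 1) * (k ^ k * l ^ l * (#E).choose k) := by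
      rw [hNdef]; exact_mod_cast h1
    have h3 : p ^ k * q ^ l = k ^ k * l ^ l / N ^ #E := by
      rw [hp, hq, div_pow, div_pow, hl, pow_add]
      field_simp
    rw [h3]
    have h4 : 0 < N ^ #E := by positivity
    calc (1 : ℝ) = N ^ #E / N ^ #E := (div_self h4.ne').symm
      _ ≤ (N + 1) * (k ^ k * l ^ l * (#E).choose k) / N ^ #E := by gcongr
      _ = _ := by ring
  set bad := {S ∈ powersetCard k E | (#(S ∩ D) : ℝ) < k * #D / N - τ} with hbad
  have hgen : ∑ S ∈ E.powerset, (∏ i ∈ S, (if i ∈ D then p * Real.exp (-L) else p)) *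
      ∏ _i ∈ E \ S, q ≤ Real.exp (-(L * p * #D) + N * L ^ 2 / 2) := by
    rw [← prod_add]
    have h1 : Real.exp (-L) ≤ 1 - L + L ^ 2 / 2 := by
      have h2 := Real.quadratic_le_exp_of_nonneg hL0
      have h3 : 0 < 1 - L + L ^ 2 / 2 := by nlinarith [sq_nonneg (L - 1)]
      rw [Real.exp_neg, inv_le_comm₀ (Real.exp_pos _) h3]
      refine le_trans ?_ h2
      rw [inv_le_iff_one_le_mul₀ h3]
      nlinarith [sq_nonneg (L ^ 2)]
    have h2 : ∀ i ∈ E, (if i ∈ D then p * Real.exp (-L) else p) + q ≤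
        if i ∈ D then Real.exp (-(L * p) + L ^ 2 / 2) else 1 := by
      intro i _
      split_ifs
      · refine le_trans ?_ (Real.add_one_le_exp _)
        have hp1 : p ≤ 1 := by linarith
        nlinarith [mul_le_mul_of_nonneg_left h1 hp0, mul_le_mul_of_nonneg_right hp1 (sq_nonneg L)]
      · exact hpq.le
    refine (prod_le_prod (fun i _ => ?_) h2).trans ?_
    · split_ifs <;> positivity
    · rw [prod_ite, prod_const_one, mul_one, prod_const, ← Real.exp_nat_mul,
        filter_mem_eq_inter, inter_eq_right.2 hD]
      refine Real.exp_le_exp.2 ?_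
      have h3 : (#D : ℝ) ≤ N := Nat.cast_le.2 (card_le_card hD)
      nlinarith [sq_nonneg L]
  have hlow : (#bad : ℝ) * (p ^ k * q ^ l * Real.exp (-(L * (p * #D - τ)))) ≤
      ∑ S ∈ E.powerset, (∏ i ∈ S, (if i ∈ D then p * Real.exp (-L) else p)) *
        ∏ _i ∈ E \ S, q := by
    have hsub : bad ⊆ E.powerset := fun S hS =>
      mem_powerset.2 (mem_powersetCard.1 (mem_filter.1 hS).1).1
    refine le_trans ?_ (sum_le_sum_of_subset_of_nonneg hsub fun S _ _ => ?_)
    · rw [← nsmul_eq_mul]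
      refine card_nsmul_le_sum _ _ _ fun S hS => ?_
      obtain ⟨hS, hlt⟩ := mem_filter.1 hS
      obtain ⟨hSE, hSk⟩ := mem_powersetCard.1 hS
      have h1 : ∏ i ∈ S, (if i ∈ D then p * Real.exp (-L) else p) =
          p ^ k * Real.exp (-(L * #(S ∩ D))) := by
        have h2 : ∀ i ∈ S, (if i ∈ D then p * Real.exp (-L) else p) =
            p * (if i ∈ D then Real.exp (-L) else 1) := by
          intro i _
          split_ifs <;> simp
        rw [prod_congr rfl h2, prod_mul_distrib, prod_const, hSk, prod_ite, prod_const_one,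
          mul_one, prod_const, filter_mem_eq_inter, ← Real.exp_nat_mul]
        congr 2
        ring
      have h3 : #(E \ S) = l := by rw [card_sdiff_of_subset hSE]; omega
      rw [h1, prod_const, h3, mul_right_comm]
      have h4 : -(L * (p * #D - τ)) ≤ -(L * #(S ∩ D)) := by
        have h5 : (#(S ∩ D) : ℝ) ≤ p * #D - τ := by
          rw [hp, div_mul_eq_mul_div]; exact hlt.le
        nlinarith
      have h6 := Real.exp_le_exp.2 h4
      gcongr
    · refine mul_nonneg (prod_nonneg fun i _ => ?_) (prod_nonneg fun i _ => hq0)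
      split_ifs <;> positivity
  have hmain : (#bad : ℝ) * (p ^ k * q ^ l) ≤ Real.exp (-(τ ^ 2 / (2 * N))) := by
    have h1 := hlow.trans hgen
    have h2 : 0 < Real.exp (-(L * (p * #D - τ))) := Real.exp_pos _
    rw [← mul_assoc, ← le_div_iff₀ h2, ← Real.exp_sub] at h1
    refine h1.trans_eq (congrArg _ ?_)
    rw [hL]
    field_simp
    ring
  calc (#bad : ℝ) ≤ #bad * ((N + 1) * (p ^ k * q ^ l * (#E).choose k)) :=
        le_mul_of_one_le_right (Nat.cast_nonneg _) hmode
    _ = (N + 1) * (#bad * (p ^ k * q ^ l)) * (#E).choose k := by ring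
    _ ≤ _ := by gcongr

/-- Most subsets of a given size split all members of a small family of sets evenly. -/
lemma card_powersetCard_uneven_le {U V : Type*} [DecidableEq V] {E : Finset V} {B : Finset U}
    {D : U → Finset V} (hD : ∀ u ∈ B, D u ⊆ E) {k : ℕ} (hk : k ≤ #E) (hE : 0 < #E) {τ : ℝ}
    (hτ : 0 ≤ τ) :
    (#{S ∈ powersetCard k E | ¬ ∀ u ∈ B, (k * #(D u) / #E - τ : ℝ) ≤ #(S ∩ D u) ∧
        ((#E - k) * #(D u) / #E - τ : ℝ) ≤ #(D u \ S)} : ℝ) ≤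
      #B * (2 * ((#E + 1) * Real.exp (-(τ ^ 2 / (2 * #E))) * (#E).choose k)) := by
  classical
  have hN : (0 : ℝ) < #E := by exact_mod_cast hE
  set W : ℝ := (#E + 1) * Real.exp (-(τ ^ 2 / (2 * #E))) * (#E).choose k with hW
  have hsub : {S ∈ powersetCard k E | ¬ ∀ u ∈ B, (k * #(D u) / #E - τ : ℝ) ≤ #(S ∩ D u) ∧
        ((#E - k) * #(D u) / #E - τ : ℝ) ≤ #(D u \ S)} ⊆
      B.biUnion fun u => {S ∈ powersetCard k E | (#(S ∩ D u) : ℝ) < k * #(D u) / #E - τ} ∪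
        {S ∈ powersetCard k E | (#(S ∩ (E \ D u)) : ℝ) < k * #(E \ D u) / #E - τ} := by
    intro S hS
    obtain ⟨hS, hnot⟩ := mem_filter.1 hS
    push Not at hnot
    obtain ⟨u, hu, hu'⟩ := hnot
    refine mem_biUnion.2 ⟨u, hu, ?_⟩
    rw [mem_union, mem_filter, mem_filter]
    by_contra hcon
    push Not at hcon
    have h1 := hcon.1 hS
    have h2 := hcon.2 hS
    have h3 := hu' h1
    obtain ⟨hSE, hSk⟩ := mem_powersetCard.1 hS
    have h4 : (#(S ∩ (E \ D u)) : ℝ) = k - #(S ∩ D u) := by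
      have h5 : #(S ∩ D u) + #(S \ D u) = k := by rw [card_inter_add_card_sdiff, hSk]
      have h6 : S ∩ (E \ D u) = S \ D u := by
        rw [← inter_sdiff_assoc, inter_eq_left.2 hSE]
      rw [h6, ← h5]
      push_cast
      ring
    have h7 : (#(D u \ S) : ℝ) = #(D u) - #(S ∩ D u) := by
      have h8 : #(D u ∩ S) + #(D u \ S) = #(D u) := card_inter_add_card_sdiff _ _
      rw [inter_comm, ← h8, inter_comm]
      push_cast
      ring
    have h9 : (#(E \ D u) : ℝ) = #E - #(D u) := by
      rw [card_sdiff_of_subset (hD u hu), Nat.cast_sub (card_le_card (hD u hu))]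
    rw [h4, h9] at h2
    rw [h7] at h3
    have h10 : (k * (#E - #(D u)) / #E : ℝ) = k - k * #(D u) / #E := by field_simp
    have h11 : ((#E - k) * #(D u) / #E : ℝ) = #(D u) - k * #(D u) / #E := by field_simp
    rw [h10] at h2
    rw [h11] at h3
    linarith
  have hc := (card_le_card hsub).trans card_biUnion_le
  have hc' : (#{S ∈ powersetCard k E | ¬ ∀ u ∈ B, (k * #(D u) / #E - τ : ℝ) ≤ #(S ∩ D u) ∧
        ((#E - k) * #(D u) / #E - τ : ℝ) ≤ #(D u \ S)} : ℝ) ≤ ∑ u ∈ B,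
      (#({S ∈ powersetCard k E | (#(S ∩ D u) : ℝ) < k * #(D u) / #E - τ} ∪
        {S ∈ powersetCard k E | (#(S ∩ (E \ D u)) : ℝ) < k * #(E \ D u) / #E - τ}) : ℝ) := by
    exact_mod_cast hc
  refine hc'.trans ?_
  rw [← nsmul_eq_mul]
  refine sum_le_card_nsmul _ _ _ fun u hu => ?_
  refine (Nat.cast_le.2 (card_union_le _ _)).trans ?_
  have h1 := card_powersetCard_inter_lt (hD u hu) hk hE hτ
  have h2 := card_powersetCard_inter_lt (sdiff_subset : E \ D u ⊆ E) hk hE hτ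
  push_cast
  linarith

lemma PMF.toOuterMeasure_bind_le {α β : Type*} (p : PMF α) (f : α → PMF β) {s : Set β} (E : Set α)
    {c : ENNReal} (h0 : ∀ a ∈ p.support, a ∉ E → (f a).toOuterMeasure s = 0)
    (hc : ∀ a ∈ p.support, a ∈ E → (f a).toOuterMeasure s ≤ c) :
    (p.bind f).toOuterMeasure s ≤ p.toOuterMeasure E * c := by
  rw [PMF.toOuterMeasure_bind_apply, PMF.toOuterMeasure_apply, ← ENNReal.tsum_mul_right]
  refine ENNReal.tsum_le_tsum fun a => ?_
  by_cases ha : a ∈ p.support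
  · by_cases haE : a ∈ E
    · rw [Set.indicator_of_mem haE]
      exact mul_le_mul_right (hc a ha haE) _
    · simp [h0 a ha haE]
  · simp [(PMF.apply_eq_zero_iff p a).2 ha]

lemma PMF.toOuterMeasure_le_one {α : Type*} (p : PMF α) (s : Set α) : p.toOuterMeasure s ≤ 1 := by
  rw [← (PMF.toOuterMeasure_apply_eq_one_iff p Set.univ).2 (Set.subset_univ _)]
  exact MeasureTheory.measure_mono (Set.subset_univ s)

lemma PMF.toOuterMeasure_uniformOfFinset_le {α : Type*} {F : Finset α} (hF : F.Nonempty) (E : Set α)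
    [DecidablePred (· ∈ E)] :
    (PMF.uniformOfFinset F hF).toOuterMeasure E = ENNReal.ofReal (#{a ∈ F | a ∈ E} / #F) := by
  rw [PMF.toOuterMeasure_uniformOfFinset_apply, ENNReal.ofReal_div_of_pos
    (by exact_mod_cast hF.card_pos), ENNReal.ofReal_natCast, ENNReal.ofReal_natCast]
  congr!

lemma div_sub_le_pow {n s : ℕ} (hs : s < n) :
    (n : ℝ) / (n - s) ≤ ((1 + 2 / √n) ^ 2) ^ s := by
  have hn : (0 : ℝ) < n := by exact_mod_cast (by omega : 0 < n)
  have hsn : (s : ℝ) + 1 ≤ n := by exact_mod_cast hs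
  have hs0 : (0 : ℝ) ≤ s := Nat.cast_nonneg s
  have hsq : √(n : ℝ) * √n = n := Real.mul_self_sqrt hn.le
  have hsqpos : 0 < √(n : ℝ) := Real.sqrt_pos.2 hn
  have hn1 : (1 : ℝ) ≤ √n := by
    rw [Real.one_le_sqrt]
    linarith
  have hb := one_add_mul_le_pow (a := 2 / √(n : ℝ)) (by
    have : 0 ≤ 2 / √(n : ℝ) := by positivity
    linarith) s
  have hb0 : 0 ≤ 1 + s * (2 / √(n : ℝ)) := by positivity
  rw [pow_right_comm]
  refine le_trans ?_ (pow_le_pow_left₀ hb0 hb 2)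
  rw [div_le_iff₀ (by linarith)]
  have h1 : (s : ℝ) * (2 / √n) = 2 * s / √n := by ring
  rw [h1]
  obtain ⟨y, hy⟩ : ∃ y : ℝ, y = 2 * s / √n := ⟨_, rfl⟩
  have hy0 : 0 ≤ y := by rw [hy]; positivity
  have hy1 : y * √n = 2 * s := by rw [hy]; field_simp
  rw [← hy]
  rcases le_total ((s : ℝ)) (n / 2) with h | h
  · have h2 : (2 * s : ℝ) ≤ y * n := by
      rw [← hy1]
      nlinarith
    nlinarith [mul_nonneg hy0 (by linarith : (0 : ℝ) ≤ n - s), sq_nonneg y,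
      mul_nonneg (sq_nonneg y) (by linarith : (0 : ℝ) ≤ n - s)]
  · have h2 : √(n : ℝ) ≤ y := by
      by_contra hcon
      nlinarith
    have h3 : (n : ℝ) ≤ (1 + y) ^ 2 := by nlinarith
    nlinarith [mul_le_mul h3 (by linarith : (1 : ℝ) ≤ n - s) (by norm_num) (by positivity)]

/-- A random embedding of the rooted tree `A` into `B` which is spread away from the root. -/
structure IsSpreadEmb {ι V : Type*} [DecidableEq ι] (G : SimpleGraph V) (par : ι → ι) (B : Finset V)
    (A : Finset ι) (r : ι) (v : V) (K : ℝ) (μ : PMF (ι → V)) : Prop where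
  isEmb : ∀ f ∈ μ.support, IsEmb G par B A r v f
  spread : ∀ X ⊆ A.erase r, ∀ h : ι → V, μ.toOuterMeasure {f | ∀ x ∈ X, f x = h x} ≤
    ENNReal.ofReal (K ^ #X / (#A - 1).descFactorial #X)

/-- Randomising the image of the root. -/
lemma exists_spread_random_root {ι V : Type*} [DecidableEq ι] {G : SimpleGraph V}
    {par : ι → ι} {S : Finset V} {A : Finset ι} {q : ι} {u : V} {K : ℝ} (hK : 2 ≤ K)
    (hqA : q ∈ A) (hu : (#A : ℝ) ≤ 2 * #(nbrs G S u))
    (h : ∀ w ∈ S, ∃ μ, IsSpreadEmb G par S A q w K μ) :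
    ∃ ν : PMF (ι → V), (∀ f ∈ ν.support, ∃ w, G.Adj u w ∧ IsEmb G par S A q w f) ∧
      ∀ X ⊆ A, ∀ h : ι → V, ν.toOuterMeasure {f | ∀ x ∈ X, f x = h x} ≤
        ENNReal.ofReal (((1 + 2 / √(#A : ℝ)) ^ 2 * K) ^ #X / (#A).descFactorial #X) := by
  classical
  have hA0 : 0 < #A := card_pos.2 ⟨q, hqA⟩
  have hApos : (0 : ℝ) < #A := by exact_mod_cast hA0
  have hne : (nbrs G S u).Nonempty := by
    rw [← card_pos]
    have : (0 : ℝ) < #(nbrs G S u) := by linarith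
    exact_mod_cast this
  have hnpos : (0 : ℝ) < #(nbrs G S u) := by exact_mod_cast hne.card_pos
  have : Nonempty (PMF (ι → V)) := ⟨PMF.pure fun _ => u⟩
  choose! μ hμ using h
  have hc1 : 1 ≤ (1 + 2 / √(#A : ℝ)) ^ 2 :=
    one_le_pow₀ (by have : 0 ≤ 2 / √(#A : ℝ) := by positivity
                    linarith)
  have hmem : ∀ w ∈ (PMF.uniformOfFinset _ hne).support, w ∈ S ∧ G.Adj u w := fun w hw => by
    simpa using (PMF.mem_support_uniformOfFinset_iff hne w).1 hw
  refine ⟨(PMF.uniformOfFinset _ hne).bind μ, fun f hf => ?_, fun X hX h => ?_⟩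
  · obtain ⟨w, hw, hf⟩ := (PMF.mem_support_bind_iff _ _ _).1 hf
    exact ⟨w, (hmem w hw).2, (hμ w (hmem w hw).1).isEmb f hf⟩
  by_cases hq : q ∈ X
  · have h1 := PMF.toOuterMeasure_bind_le (PMF.uniformOfFinset _ hne) μ
      (s := {f | ∀ x ∈ X, f x = h x}) {h q}
      (c := ENNReal.ofReal (K ^ #(X.erase q) / (#A - 1).descFactorial #(X.erase q)))
      (fun w hw hwq => by
        rw [PMF.toOuterMeasure_apply_eq_zero_iff, Set.disjoint_left]
        intro f hf hfX
        exact hwq (by rw [← hfX q hq, ((hμ w (hmem w hw).1).isEmb f hf).root]; rfl))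
      (fun w hw _ => le_trans' ((hμ w (hmem w hw).1).spread (X.erase q) (erase_subset_erase q hX) h)
        (MeasureTheory.measure_mono fun f hf x hx => hf x (mem_of_mem_erase hx)))
    refine h1.trans ?_
    rw [PMF.toOuterMeasure_uniformOfFinset_le, ← ENNReal.ofReal_mul (by positivity)]
    refine ENNReal.ofReal_le_ofReal ?_
    have h2 : #X = #(X.erase q) + 1 := (card_erase_add_one hq).symm
    have h3 : (#A).descFactorial #X = #A * (#A - 1).descFactorial #(X.erase q) := by
      have := Nat.succ_descFactorial_succ (#A - 1) #(X.erase q)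
      rwa [Nat.sub_add_cancel hA0, ← h2] at this
    have h4 : (#{w ∈ nbrs G S u | w ∈ ({h q} : Set V)} : ℝ) ≤ 1 := by
      have : #{w ∈ nbrs G S u | w ∈ ({h q} : Set V)} ≤ #{h q} :=
        card_le_card fun w hw => by simpa using (mem_filter.1 hw).2
      rw [card_singleton] at this
      exact_mod_cast this
    have h5 : (#{w ∈ nbrs G S u | w ∈ ({h q} : Set V)} / #(nbrs G S u) : ℝ) ≤ K / #A := by
      rw [div_le_div_iff₀ hnpos hApos]
      nlinarith
    have h6 : K ≤ (1 + 2 / √(#A : ℝ)) ^ 2 * K := le_mul_of_one_le_left (by linarith) hc1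
    rw [h3]
    calc _ ≤ K / #A * (K ^ #(X.erase q) / (#A - 1).descFactorial #(X.erase q)) := by gcongr
      _ = K ^ #X / (#A * (#A - 1).descFactorial #(X.erase q)) := by rw [h2]; ring
      _ ≤ ((1 + 2 / √(#A : ℝ)) ^ 2 * K) ^ #X / (#A * (#A - 1).descFactorial #(X.erase q)) := by
        gcongr
      _ = _ := by push_cast; rfl
  · have hXq : X ⊆ A.erase q := fun x hx => mem_erase.2 ⟨fun e => hq (e ▸ hx), hX hx⟩
    have h1 := PMF.toOuterMeasure_bind_le (PMF.uniformOfFinset _ hne) μ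
      (s := {f | ∀ x ∈ X, f x = h x}) Set.univ
      (c := ENNReal.ofReal (K ^ #X / (#A - 1).descFactorial #X))
      (fun w _ hw => absurd (Set.mem_univ w) hw)
      (fun w hw _ => (hμ w (hmem w hw).1).spread X hXq h)
    refine h1.trans ((mul_le_of_le_one_left' (PMF.toOuterMeasure_le_one _ _)).trans ?_)
    refine ENNReal.ofReal_le_ofReal ?_
    have hlt : #X < #A := card_lt_card (hX.ssubset_of_mem_notMem hqA hq)
    have hltr : (0 : ℝ) < #A - #X := by
      have : (#X : ℝ) < #A := by exact_mod_cast hlt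
      linarith
    have h2 : ((#A : ℝ) - #X) * (#A).descFactorial #X = #A * (#A - 1).descFactorial #X := by
      have := Nat.succ_descFactorial (#A - 1) #X
      rw [Nat.sub_add_cancel hA0] at this
      rw [← Nat.cast_sub hlt.le]
      exact_mod_cast this
    have h3 : (0 : ℝ) < (#A - 1).descFactorial #X := by
      exact_mod_cast Nat.pos_of_ne_zero fun h => by
        rw [Nat.descFactorial_eq_zero_iff_lt] at h
        omega
    have h4 : (0 : ℝ) < (#A).descFactorial #X := by
      exact_mod_cast Nat.pos_of_ne_zero fun h => by
        rw [Nat.descFactorial_eq_zero_iff_lt] at h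
        omega
    have h5 := div_sub_le_pow hlt
    rw [div_le_div_iff₀ h3 h4, mul_pow]
    rw [div_le_iff₀ hltr] at h5
    have h6 : 0 ≤ K ^ #X * (#A - 1).descFactorial #X := by positivity
    have h7 : K ^ #X * ((#A).descFactorial #X) * (#A - #X) =
        #A * (K ^ #X * (#A - 1).descFactorial #X) := by
      rw [mul_assoc, mul_comm (((#A).descFactorial #X : ℕ) : ℝ), h2]; ring
    have h8 : K ^ #X * ((#A).descFactorial #X) * (#A - #X) ≤
        ((1 + 2 / √(#A : ℝ)) ^ 2) ^ #X * K ^ #X * (#A - 1).descFactorial #X * (#A - #X) := by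
      rw [h7]
      calc _ ≤ ((1 + 2 / √(#A : ℝ)) ^ 2) ^ #X * (#A - #X) *
            (K ^ #X * (#A - 1).descFactorial #X) := by gcongr
        _ = _ := by ring
    exact le_of_mul_le_mul_right h8 hltr

/-- Combining random embeddings of two parts of a tree into two parts of the host graph. -/
lemma exists_spread_glue {ι V : Type*} [DecidableEq ι] [DecidableEq V] {G : SimpleGraph V}
    {par : ι → ι} {dep : ι → ℕ} {Δ : ℕ} {B S : Finset V} {A Q : Finset ι} {r q : ι} {v : V}
    {K₁ K₂ : ℝ} (hQ : IsRootedTree par dep Δ Q q)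
    (hAQ : IsRootedTree par dep Δ (A \ Q) r) (hq : par q ∈ A \ Q) (hS : S ⊆ B) (hK₂ : 2 ≤ K₂)
    (hdeg : ∀ u ∈ B, (#Q : ℝ) ≤ 2 * #(nbrs G S u))
    (h₁ : ∃ μ, IsSpreadEmb G par (B \ S) (A \ Q) r v K₁ μ)
    (h₂ : ∀ w ∈ S, ∃ μ, IsSpreadEmb G par S Q q w K₂ μ) :
    ∃ μ : PMF (ι → V), (∀ f ∈ μ.support, IsEmb G par B A r v f ∧ (∀ x ∈ A \ Q, f x ∉ S) ∧
      ∀ x ∈ Q, f x ∈ S) ∧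
      ∀ X₁ ⊆ (A \ Q).erase r, ∀ X₂ ⊆ Q, ∀ h : ι → V,
        μ.toOuterMeasure {f | ∀ x ∈ X₁ ∪ X₂, f x = h x} ≤
          ENNReal.ofReal (K₁ ^ #X₁ / (#(A \ Q) - 1).descFactorial #X₁) *
          ENNReal.ofReal (((1 + 2 / √(#Q : ℝ)) ^ 2 * K₂) ^ #X₂ / (#Q).descFactorial #X₂) := by
  obtain ⟨μ₁, hμ₁⟩ := h₁
  have h3 : ∀ u ∈ B, ∃ ν : PMF (ι → V),
      (∀ f ∈ ν.support, ∃ w, G.Adj u w ∧ IsEmb G par S Q q w f) ∧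
      ∀ X ⊆ Q, ∀ h : ι → V, ν.toOuterMeasure {f | ∀ x ∈ X, f x = h x} ≤
        ENNReal.ofReal (((1 + 2 / √(#Q : ℝ)) ^ 2 * K₂) ^ #X / (#Q).descFactorial #X) :=
    fun u hu => exists_spread_random_root hK₂ hQ.root_mem (hdeg u hu) h₂
  have : Nonempty (PMF (ι → V)) := ⟨μ₁⟩
  choose! ν hνe hνs using h3
  let g : (ι → V) → (ι → V) → ι → V := fun φ ψ x => if x ∈ Q then ψ x else φ x
  have hpB : ∀ φ ∈ μ₁.support, φ (par q) ∈ B := fun φ hφ =>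
    (mem_sdiff.1 ((hμ₁.isEmb φ hφ).mem _ hq)).1
  refine ⟨μ₁.bind fun φ => (ν (φ (par q))).map (g φ), fun f hf => ?_, fun X₁ hX₁ X₂ hX₂ h => ?_⟩
  · obtain ⟨φ, hφ, hf⟩ := (PMF.mem_support_bind_iff _ _ _).1 hf
    obtain ⟨ψ, hψ, rfl⟩ := (PMF.mem_support_map_iff _ _ _).1 hf
    have hE := hμ₁.isEmb φ hφ
    obtain ⟨w, hw, hF⟩ := hνe _ (hpB φ hφ) ψ hψ
    have hgQ : ∀ x ∈ Q, g φ ψ x = ψ x := fun x hx => if_pos hx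
    have hgA : ∀ x ∈ A \ Q, g φ ψ x = φ x := fun x hx => if_neg (mem_sdiff.1 hx).2
    have hAQ' : ∀ x ∈ A, x ∉ Q → x ∈ A \ Q := fun x hx hx' => mem_sdiff.2 ⟨hx, hx'⟩
    refine ⟨⟨?_, fun x hx => ?_, fun x hx y hy hxy => ?_, fun x hx hxr => ?_⟩, fun x hx => ?_,
      fun x hx => ?_⟩
    · rw [hgA r hAQ.root_mem, hE.root]
    · by_cases hxQ : x ∈ Q
      · rw [hgQ x hxQ]
        exact hS (hF.mem x hxQ)
      · rw [hgA x (hAQ' x hx hxQ)]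
        exact (mem_sdiff.1 (hE.mem x (hAQ' x hx hxQ))).1
    · by_cases hxQ : x ∈ Q <;> by_cases hyQ : y ∈ Q
      · rw [hgQ x hxQ, hgQ y hyQ] at hxy
        exact hF.inj hxQ hyQ hxy
      · rw [hgQ x hxQ, hgA y (hAQ' y hy hyQ)] at hxy
        exact absurd (hxy ▸ hF.mem x hxQ) (mem_sdiff.1 (hE.mem y (hAQ' y hy hyQ))).2
      · rw [hgQ y hyQ, hgA x (hAQ' x hx hxQ)] at hxy
        exact absurd (hxy ▸ hF.mem y hyQ) (mem_sdiff.1 (hE.mem x (hAQ' x hx hxQ))).2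
      · rw [hgA x (hAQ' x hx hxQ), hgA y (hAQ' y hy hyQ)] at hxy
        exact hE.inj (mem_coe.2 (hAQ' x hx hxQ)) (mem_coe.2 (hAQ' y hy hyQ)) hxy
    · by_cases hxQ : x ∈ Q
      · rw [hgQ x hxQ]
        rcases eq_or_ne x q with rfl | hxq
        · rw [hgA _ hq, hF.root]
          exact hw
        · rw [hgQ _ (hQ.par_mem x hxQ hxq)]
          exact hF.adj x hxQ hxq
      · have hxA := hAQ' x hx hxQ
        rw [hgA x hxA, hgA _ (hAQ.par_mem x hxA hxr)]
        exact hE.adj x hxA hxr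
    · rw [hgA x hx]
      exact (mem_sdiff.1 (hE.mem x hx)).2
    · rw [hgQ x hx]
      exact hF.mem x hx
  · have hX₁Q : ∀ x ∈ X₁, x ∉ Q := fun x hx => (mem_sdiff.1 (mem_of_mem_erase (hX₁ hx))).2
    refine (PMF.toOuterMeasure_bind_le _ _ {φ | ∀ x ∈ X₁, φ x = h x}
      (c := ENNReal.ofReal (((1 + 2 / √(#Q : ℝ)) ^ 2 * K₂) ^ #X₂ / (#Q).descFactorial #X₂))
      (fun φ hφ hne => ?_) (fun φ hφ _ => ?_)).trans
      (mul_le_mul_left (hμ₁.spread X₁ hX₁ h) _)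
    · rw [PMF.toOuterMeasure_apply_eq_zero_iff, Set.disjoint_left]
      intro f hf hfX
      obtain ⟨ψ, -, rfl⟩ := (PMF.mem_support_map_iff _ _ _).1 hf
      refine hne fun x hx => ?_
      rw [← hfX x (mem_union_left _ hx)]
      exact (if_neg (hX₁Q x hx)).symm
    · rw [PMF.toOuterMeasure_map_apply]
      refine le_trans' (hνs _ (hpB φ hφ) X₂ hX₂ h)
        (MeasureTheory.measure_mono fun ψ hψ x hx => ?_)
      rw [← hψ x (mem_union_right _ hx)]
      exact (if_pos (hX₂ hx)).symm

lemma choose_mul_descFactorial_add {k l s₁ s₂ : ℕ} (h₁ : s₁ ≤ l) (h₂ : s₂ ≤ k) :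
    (k + l - (s₁ + s₂)).choose (k - s₂) * (k + l).descFactorial (s₁ + s₂) =
      (k + l).choose k * (k.descFactorial s₂ * l.descFactorial s₁) := by
  obtain ⟨k', rfl⟩ := Nat.exists_eq_add_of_le' h₂
  obtain ⟨l', rfl⟩ := Nat.exists_eq_add_of_le' h₁
  have h3 := Nat.add_choose_mul_factorial_mul_factorial k' l'
  have h4 := Nat.factorial_mul_descFactorial (n := k' + s₂ + (l' + s₁)) (k := s₁ + s₂) (by omega)
  have h5 := Nat.add_choose_mul_factorial_mul_factorial (k' + s₂) (l' + s₁)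
  have h6 := Nat.factorial_mul_descFactorial (n := k' + s₂) (k := s₂) (by omega)
  have h7 := Nat.factorial_mul_descFactorial (n := l' + s₁) (k := s₁) (by omega)
  have h8 : k' + s₂ + (l' + s₁) - (s₁ + s₂) = k' + l' := by omega
  rw [Nat.choose_symm_add.symm] at h3 h5
  rw [Nat.add_sub_cancel] at h6 h7
  rw [h8] at h4 ⊢
  rw [Nat.add_sub_cancel]
  have hk : 0 < k'.factorial * l'.factorial := by positivity
  refine Nat.eq_of_mul_eq_mul_right hk ?_
  calc _ = (k' + l').choose k' * k'.factorial * l'.factorial *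
        (k' + s₂ + (l' + s₁)).descFactorial (s₁ + s₂) := by ring
    _ = (k' + s₂ + (l' + s₁)).choose (k' + s₂) * (k' + s₂).factorial * (l' + s₁).factorial := by
      rw [h3, h4, h5]
    _ = _ := by rw [← h6, ← h7]; ring

lemma card_powersetCard_between_le {V : Type*} [DecidableEq V] {E Y₁ Y₂ : Finset V} {k : ℕ}
    (hY₁ : Y₁ ⊆ E) (hY₂ : Y₂ ⊆ E) (hY : Disjoint Y₁ Y₂) :
    #{S ∈ powersetCard k E | Y₂ ⊆ S ∧ Disjoint Y₁ S} ≤ (#E - (#Y₁ + #Y₂)).choose (k - #Y₂) := by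
  rw [← card_union_of_disjoint hY, ← card_sdiff_of_subset (union_subset hY₁ hY₂),
    ← card_powersetCard]
  refine card_le_card_of_injOn (fun S => S \ Y₂) (fun S hS => ?_) fun S hS S' hS' hSS => ?_
  · obtain ⟨hS, h1, h2⟩ := mem_filter.1 hS
    obtain ⟨hSE, hSk⟩ := mem_powersetCard.1 hS
    refine mem_coe.2 (mem_powersetCard.2 ⟨fun x hx => ?_, by rw [card_sdiff_of_subset h1, hSk]⟩)
    obtain ⟨hx1, hx2⟩ := mem_sdiff.1 hx
    refine mem_sdiff.2 ⟨hSE hx1, fun hx3 => ?_⟩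
    exact (mem_union.1 hx3).elim (fun h => disjoint_left.1 h2 h hx1) hx2
  · have h1 := (mem_filter.1 hS).2.1
    have h2 := (mem_filter.1 hS').2.1
    rw [← sdiff_union_of_subset h1, ← sdiff_union_of_subset h2]
    exact congrArg (· ∪ Y₂) hSS

lemma spread_mul_le {k l s₁ s₂ : ℕ} (h₁ : s₁ ≤ l) (h₂ : s₂ ≤ k) (hs : s₁ + s₂ ≠ 0)
    {K K₁ L b c F : ℝ} (hK₁ : 0 ≤ K₁) (hL : 0 ≤ L) (hb0 : 0 ≤ b) (hb1 : b < 1)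
    (h₁K : K₁ ≤ (1 - b) * K) (hLK : L ≤ (1 - b) * K)
    (hF : (1 - b) * (k + l).choose k ≤ F)
    (hc : c ≤ (k + l - (s₁ + s₂)).choose (k - s₂)) :
    c / F * (K₁ ^ s₁ / l.descFactorial s₁ * (L ^ s₂ / k.descFactorial s₂)) ≤
      K ^ (s₁ + s₂) / (k + l).descFactorial (s₁ + s₂) := by
  have hpos : ∀ {m s : ℕ}, s ≤ m → (0 : ℝ) < m.descFactorial s := fun {m s} h => by
    exact_mod_cast Nat.pos_of_ne_zero fun h0 => by
      rw [Nat.descFactorial_eq_zero_iff_lt] at h0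
      omega
  have hl := hpos h₁
  have hk := hpos h₂
  have hkl := hpos (by omega : s₁ + s₂ ≤ k + l)
  have hC : (0 : ℝ) < (k + l).choose k := by exact_mod_cast Nat.choose_pos (by omega)
  have hb : 0 < 1 - b := by linarith
  have hK : 0 ≤ K := by
    by_contra hcon
    nlinarith
  have hid : (((k + l - (s₁ + s₂)).choose (k - s₂) : ℕ) : ℝ) =
      (k + l).choose k * (k.descFactorial s₂ * l.descFactorial s₁) /
        (k + l).descFactorial (s₁ + s₂) := by
    rw [eq_div_iff hkl.ne']
    exact_mod_cast choose_mul_descFactorial_add h₁ h₂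
  have hF0 : 0 < F := lt_of_lt_of_le (by positivity) hF
  calc _ ≤ (((k + l - (s₁ + s₂)).choose (k - s₂) : ℕ) : ℝ) / ((1 - b) * (k + l).choose k) *
        (K₁ ^ s₁ / l.descFactorial s₁ * (L ^ s₂ / k.descFactorial s₂)) := by
        have : 0 ≤ K₁ ^ s₁ / l.descFactorial s₁ * (L ^ s₂ / k.descFactorial s₂) := by positivity
        gcongr
    _ = K₁ ^ s₁ * L ^ s₂ / (1 - b) / (k + l).descFactorial (s₁ + s₂) := by
      rw [hid]
      field_simp
    _ ≤ _ := by
      gcongr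
      rw [div_le_iff₀ hb]
      calc K₁ ^ s₁ * L ^ s₂ ≤ ((1 - b) * K) ^ s₁ * ((1 - b) * K) ^ s₂ := by gcongr
        _ = K ^ (s₁ + s₂) * (1 - b) ^ (s₁ + s₂) := by
          rw [← pow_add, mul_pow, mul_comm]
        _ ≤ K ^ (s₁ + s₂) * (1 - b) := by
          gcongr
          exact pow_le_of_le_one hb.le (by linarith) hs

/-- Choosing the part of the host graph which receives a branch of the tree at random. -/
lemma exists_isSpreadEmb_of_split {ι V : Type*} [DecidableEq ι] [DecidableEq V]
    {G : SimpleGraph V} {par : ι → ι} {dep : ι → ℕ} {Δ : ℕ} {B : Finset V} {A Q : Finset ι}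
    {r q : ι} {v : V} {K K₁ K₂ b : ℝ} {F : Finset (Finset V)} (hAB : #A = #B) (hQA : Q ⊆ A)
    (hQ : IsRootedTree par dep Δ Q q) (hAQ : IsRootedTree par dep Δ (A \ Q) r)
    (hq : par q ∈ A \ Q) (hv : v ∈ B)
    (hF : F ⊆ powersetCard #Q (B.erase v))
    (hFc : (1 - b) * (#A - 1).choose #Q ≤ #F) (hb0 : 0 ≤ b) (hb1 : b < 1) (hK₁0 : 0 ≤ K₁)
    (hK₂ : 2 ≤ K₂) (hK₁ : K₁ ≤ (1 - b) * K) (hK₂K : (1 + 2 / √(#Q : ℝ)) ^ 2 * K₂ ≤ (1 - b) * K)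
    (hdeg : ∀ S ∈ F, ∀ u ∈ B, (#Q : ℝ) ≤ 2 * #(nbrs G S u))
    (h₁ : ∀ S ∈ F, ∃ μ, IsSpreadEmb G par (B \ S) (A \ Q) r v K₁ μ)
    (h₂ : ∀ S ∈ F, ∀ w ∈ S, ∃ μ, IsSpreadEmb G par S Q q w K₂ μ) :
    ∃ μ, IsSpreadEmb G par B A r v K μ := by
  classical
  have hSB : ∀ S ∈ F, S ⊆ B := fun S hS =>
    (mem_powersetCard.1 (hF hS)).1.trans (erase_subset _ _)
  have hcA : #(A \ Q) + #Q = #A := by rw [card_sdiff_add_card_eq_card hQA]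
  have hcAQ : 0 < #(A \ Q) := card_pos.2 ⟨r, hAQ.root_mem⟩
  have hFne : F.Nonempty := by
    have h1 : (0 : ℝ) < (#A - 1).choose #Q := by exact_mod_cast Nat.choose_pos (by omega)
    have h2 : (0 : ℝ) < #F := lt_of_lt_of_le (mul_pos (by linarith) h1) hFc
    exact card_pos.1 (by exact_mod_cast h2)
  have hμ := fun S hS => exists_spread_glue hQ hAQ hq (hSB S hS) hK₂ (hdeg S hS) (h₁ S hS) (h₂ S hS)
  have : Nonempty (PMF (ι → V)) := ⟨PMF.pure fun _ => v⟩
  choose! μ hμe hμs using hμ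
  have hmem : ∀ S ∈ (PMF.uniformOfFinset F hFne).support, S ∈ F := fun S hS =>
    (PMF.mem_support_uniformOfFinset_iff hFne S).1 hS
  have hemb : ∀ f ∈ ((PMF.uniformOfFinset F hFne).bind μ).support, IsEmb G par B A r v f := by
    intro f hf
    obtain ⟨S, hS, hf⟩ := (PMF.mem_support_bind_iff _ _ _).1 hf
    exact (hμe S (hmem S hS) f hf).1
  refine ⟨(PMF.uniformOfFinset F hFne).bind μ, hemb, fun X hX h => ?_⟩
  rcases eq_or_ne X ∅ with rfl | hXne
  · refine (PMF.toOuterMeasure_le_one _ _).trans_eq ?_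
    simp
  by_cases h0 : ((PMF.uniformOfFinset F hFne).bind μ).toOuterMeasure {f | ∀ x ∈ X, f x = h x} = 0
  · rw [h0]
    exact zero_le
  rw [PMF.toOuterMeasure_apply_eq_zero_iff, Set.not_disjoint_iff] at h0
  obtain ⟨f, hf, hfX⟩ := h0
  have hfe := hemb f hf
  have hXA : ∀ x ∈ X, x ∈ A := fun x hx => mem_of_mem_erase (hX hx)
  have hhB : ∀ x ∈ X, h x ∈ B.erase v := fun x hx => by
    rw [← hfX x hx, ← hfe.root]
    refine mem_erase.2 ⟨fun e => ?_, hfe.mem x (hXA x hx)⟩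
    exact (mem_erase.1 (hX hx)).1 (hfe.inj (hXA x hx) (mem_sdiff.1 hAQ.root_mem).1 e)
  have hinj : Set.InjOn h X := fun x hx y hy hxy => by
    rw [← hfX x hx, ← hfX y hy] at hxy
    exact hfe.inj (hXA x hx) (hXA y hy) hxy
  have hX₁ : X \ Q ⊆ (A \ Q).erase r := fun x hx => by
    obtain ⟨hx, hxQ⟩ := mem_sdiff.1 hx
    exact mem_erase.2 ⟨(mem_erase.1 (hX hx)).1, mem_sdiff.2 ⟨hXA x hx, hxQ⟩⟩
  have hXu : X \ Q ∪ X ∩ Q = X := sdiff_union_inter X Q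
  have hXc : #(X \ Q) + #(X ∩ Q) = #X := card_sdiff_add_card_inter X Q
  have hc₁ : #((X \ Q).image h) = #(X \ Q) :=
    card_image_of_injOn (hinj.mono (coe_subset.2 sdiff_subset))
  have hc₂ : #((X ∩ Q).image h) = #(X ∩ Q) :=
    card_image_of_injOn (hinj.mono (coe_subset.2 inter_subset_left))
  have hdisj : Disjoint ((X \ Q).image h) ((X ∩ Q).image h) := by
    rw [disjoint_left]
    intro y hy hy'
    obtain ⟨a, ha, rfl⟩ := mem_image.1 hy
    obtain ⟨c, hc, hac⟩ := mem_image.1 hy'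
    have := hinj (mem_inter.1 hc).1 (mem_sdiff.1 ha).1 hac
    exact (mem_sdiff.1 ha).2 (this ▸ (mem_inter.1 hc).2)
  have hNc : #(B.erase v) = #Q + (#(A \ Q) - 1) := by
    rw [card_erase_of_mem hv, ← hAB]
    omega
  refine (PMF.toOuterMeasure_bind_le _ _
    {S | (X ∩ Q).image h ⊆ S ∧ Disjoint ((X \ Q).image h) S}
    (c := ENNReal.ofReal (K₁ ^ #(X \ Q) / (#(A \ Q) - 1).descFactorial #(X \ Q)) *
      ENNReal.ofReal (((1 + 2 / √(#Q : ℝ)) ^ 2 * K₂) ^ #(X ∩ Q) / (#Q).descFactorial #(X ∩ Q)))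
    (fun S hS hne => ?_) (fun S hS _ => ?_)).trans ?_
  · rw [PMF.toOuterMeasure_apply_eq_zero_iff, Set.disjoint_left]
    intro g hg hgX
    obtain ⟨-, h3, h4⟩ := hμe S (hmem S hS) g hg
    refine hne ⟨fun y hy => ?_, disjoint_left.2 fun y hy => ?_⟩
    · obtain ⟨x, hx, rfl⟩ := mem_image.1 hy
      obtain ⟨hx, hxQ⟩ := mem_inter.1 hx
      rw [← hgX x hx]
      exact h4 x hxQ
    · obtain ⟨x, hx, rfl⟩ := mem_image.1 hy
      obtain ⟨hx, hxQ⟩ := mem_sdiff.1 hx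
      rw [← hgX x hx]
      exact h3 x (mem_sdiff.2 ⟨hXA x hx, hxQ⟩)
  · have h3 := hμs S (hmem S hS) (X \ Q) hX₁ (X ∩ Q) inter_subset_right h
    rwa [hXu] at h3
  · have hL0 : 0 ≤ (1 + 2 / √(#Q : ℝ)) ^ 2 * K₂ := by positivity
    rw [PMF.toOuterMeasure_uniformOfFinset_le, ← ENNReal.ofReal_mul (by positivity),
      ← ENNReal.ofReal_mul (by positivity)]
    refine ENNReal.ofReal_le_ofReal ?_
    have hA1 : #A - 1 = #Q + (#(A \ Q) - 1) := by omega
    rw [hA1, ← hXc]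
    have hle₁ := card_le_card hX₁
    rw [card_erase_of_mem hAQ.root_mem] at hle₁
    refine spread_mul_le hle₁ (card_le_card inter_subset_right) ?_ hK₁0 hL0 hb0 hb1 hK₁ hK₂K
      (by rw [← hA1]; exact hFc) (Nat.cast_le.2 ?_)
    · rw [hXc]
      exact (card_pos.2 (nonempty_iff_ne_empty.2 hXne)).ne'
    · have h5 := card_powersetCard_between_le (k := #Q) (image_subset_iff.2 fun x hx =>
        hhB x (mem_sdiff.1 hx).1) (image_subset_iff.2 fun x hx => hhB x (mem_inter.1 hx).1) hdisj
      rw [hc₁, hc₂, hNc] at h5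
      refine le_trans (card_le_card fun S hS => ?_) h5
      obtain ⟨hS, hSE⟩ := mem_filter.1 hS
      exact mem_filter.2 ⟨hF hS, hSE⟩

/-- The error term in the degree condition and in the spread constant. -/
noncomputable def spreadError (n : ℕ) : ℝ := ((n : ℝ) ^ (1 / 8 : ℝ))⁻¹

lemma rpow_eighth_pow (n : ℕ) : ((n : ℝ) ^ (1 / 8 : ℝ)) ^ 8 = n := by
  rw [← Real.rpow_natCast, ← Real.rpow_mul (Nat.cast_nonneg n)]
  norm_num

lemma spreadError_nonneg (n : ℕ) : 0 ≤ spreadError n := by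
  unfold spreadError
  positivity

lemma spreadError_le_one (n : ℕ) (hn : 1 ≤ n) : spreadError n ≤ 1 :=
  inv_le_one_of_one_le₀ (Real.one_le_rpow (by exact_mod_cast hn) (by norm_num))

lemma tendsto_rpow_eighth : Filter.Tendsto (fun n : ℕ => (n : ℝ) ^ (1 / 8 : ℝ)) Filter.atTop
    Filter.atTop :=
  (tendsto_rpow_atTop (by norm_num)).comp tendsto_natCast_atTop_atTop

lemma eventually_spreadError_le {a : ℝ} (ha : 0 < a) :
    ∀ᶠ n : ℕ in Filter.atTop, spreadError n ≤ a :=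
  (tendsto_rpow_eighth.inv_tendsto_atTop).eventually_le_const ha

/-- The numerical conditions for passing from parts of size proportional to `n` to `n`. -/
lemma eventually_spreadError_sub (Δ : ℕ) (hΔ : 1 ≤ Δ) :
    ∀ᶠ n : ℕ in Filter.atTop, ∃ b τ : ℝ, 0 ≤ b ∧ b < 1 ∧ 0 ≤ τ ∧
      n * (2 * (n * Real.exp (-(τ ^ 2 / (2 * n))))) = b ∧
      ∀ n' : ℕ, n ≤ 8 * Δ * n' → 8 * Δ * n' ≤ (8 * Δ - 1) * n →
        τ + 2 ≤ (spreadError n' - spreadError n) * n' ∧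
        2 * b + 16 / √(n' : ℝ) ≤ spreadError n' - spreadError n := by
  have hΔ' : (1 : ℝ) ≤ Δ := by exact_mod_cast hΔ
  obtain ⟨θ, hθ⟩ : ∃ θ : ℝ, θ = 1 - 1 / (8 * Δ) := ⟨_, rfl⟩
  have hθ0 : 0 < θ := by
    have : (1 : ℝ) / (8 * Δ) < 1 := by
      rw [div_lt_one (by positivity)]
      linarith
    rw [hθ]
    linarith
  have hθ1 : θ < 1 := by
    have : (0 : ℝ) < 1 / (8 * Δ) := by positivity
    rw [hθ]
    linarith
  obtain ⟨κ, hκ⟩ : ∃ κ : ℝ, κ = (θ ^ (1 / 8 : ℝ))⁻¹ - 1 := ⟨_, rfl⟩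
  have hθ8 : 0 < θ ^ (1 / 8 : ℝ) := by positivity
  have hκ0 : 0 < κ := by
    have := (one_lt_inv₀ hθ8).2 (Real.rpow_lt_one hθ0.le hθ1 (by norm_num))
    rw [hκ]
    linarith
  have hexp := Real.tendsto_pow_mul_exp_neg_atTop_nhds_zero 17
  have hev : ∀ᶠ y : ℝ in Filter.atTop, 2 ≤ y ∧ 256 * Δ ≤ κ * y ∧
      y ^ 17 * Real.exp (-y) ≤ κ / 8 ∧ y ^ 17 * Real.exp (-y) ≤ 1 / 4 :=
    (Filter.eventually_ge_atTop 2).and <|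
      ((Filter.tendsto_id.const_mul_atTop hκ0).eventually_ge_atTop (256 * (Δ : ℝ))).and <|
      (hexp.eventually_le_const (by positivity)).and (hexp.eventually_le_const (by norm_num))
  filter_upwards [tendsto_rpow_eighth.eventually hev] with n hn
  obtain ⟨hy2, hy3, hy4, hy5⟩ := hn
  obtain ⟨y, hy⟩ : ∃ y : ℝ, y = (n : ℝ) ^ (1 / 8 : ℝ) := ⟨_, rfl⟩
  have hyn : y ^ 8 = n := by rw [hy, rpow_eighth_pow]
  have hxn : spreadError n = y⁻¹ := by rw [hy, spreadError]
  rw [← hy] at hy2 hy3 hy4 hy5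
  have hy0 : 0 < y := by linarith
  have hb : (n : ℝ) * (2 * (n * Real.exp (-((y ^ 6) ^ 2 / (2 * n))))) ≤
      2 * (y ^ 17 * Real.exp (-y)) / y := by
    have h1 : (y ^ 6) ^ 2 / (2 * n) = y ^ 4 / 2 := by
      rw [← hyn]
      field_simp
    have h2 : Real.exp (-(y ^ 4 / 2)) ≤ Real.exp (-y) := by
      refine Real.exp_le_exp.2 ?_
      have : 2 * y ≤ y ^ 4 := by
        have h3 : (2 : ℝ) ^ 3 ≤ y ^ 3 := by gcongr
        nlinarith
      linarith
    rw [h1, ← hyn]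
    calc _ = 2 * (y ^ 16 * Real.exp (-(y ^ 4 / 2))) := by ring
      _ ≤ 2 * (y ^ 16 * Real.exp (-y)) := by gcongr
      _ = _ := by field_simp
  refine ⟨_, y ^ 6, by positivity, ?_, by positivity, rfl, fun n' h1 h2 => ?_⟩
  · refine hb.trans_lt ?_
    rw [div_lt_one hy0]
    linarith
  · have hnpos : (0 : ℝ) < n := by rw [← hyn]; positivity
    have hn'pos : (0 : ℝ) < n' := by
      have h3 : 0 < n' := by
        rcases Nat.eq_zero_or_pos n' with rfl | h
        · have h4 : (0 : ℕ) < n := by exact_mod_cast hnpos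
          omega
        · exact h
      exact_mod_cast h3
    have h1' : (n : ℝ) ≤ 8 * Δ * n' := by exact_mod_cast h1
    have h2' : (8 * Δ * n' : ℝ) ≤ (8 * Δ - 1) * n := by
      have h3 : ((8 * Δ - 1 : ℕ) : ℝ) = 8 * Δ - 1 := by
        rw [Nat.cast_sub (by omega)]
        push_cast
        ring
      rw [← h3]
      exact_mod_cast h2
    have h4 : (n' : ℝ) ≤ θ * n := by
      have h5 : θ * n = (8 * Δ - 1) * n / (8 * Δ) := by
        rw [hθ]
        field_simp
      rw [h5, le_div_iff₀ (by positivity)]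
      linarith
    have h5 : κ / y ≤ spreadError n' - spreadError n := by
      have h6 : (n' : ℝ) ^ (1 / 8 : ℝ) ≤ θ ^ (1 / 8 : ℝ) * y := by
        rw [hy, ← Real.mul_rpow hθ0.le hnpos.le]
        exact Real.rpow_le_rpow hn'pos.le h4 (by norm_num)
      have h7 : (θ ^ (1 / 8 : ℝ) * y)⁻¹ ≤ spreadError n' :=
        inv_anti₀ (Real.rpow_pos_of_pos hn'pos _) h6
      rw [mul_inv] at h7
      have h8 : κ / y = (θ ^ (1 / 8 : ℝ))⁻¹ * y⁻¹ - y⁻¹ := by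
        rw [hκ]
        ring
      rw [h8, hxn]
      linarith
    have hn'y : y ^ 8 / (8 * Δ) ≤ n' := by
      rw [hyn, div_le_iff₀ (by positivity)]
      linarith
    constructor
    · have h9 : y ^ 6 + 2 ≤ κ / y * (y ^ 8 / (8 * Δ)) := by
        have h10 : κ / y * (y ^ 8 / (8 * Δ)) = κ * y * y ^ 6 / (8 * Δ) := by field_simp
        rw [h10, le_div_iff₀ (by positivity)]
        have h11 : (2 : ℝ) ^ 6 ≤ y ^ 6 := by gcongr
        nlinarith [mul_le_mul_of_nonneg_right hy3 (by positivity : 0 ≤ y ^ 6)]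
      refine h9.trans ?_
      have h12 : 0 ≤ κ / y := by positivity
      exact mul_le_mul h5 hn'y (by positivity) (h12.trans h5)
    · have h9 : 16 / √(n' : ℝ) ≤ κ / (2 * y) := by
        have h10 : y ^ 4 / (8 * Δ) ≤ √(n' : ℝ) := by
          refine Real.le_sqrt_of_sq_le (le_trans ?_ hn'y)
          have h11 : (y ^ 4 / (8 * Δ)) ^ 2 = y ^ 8 / (8 * Δ) / (8 * Δ) := by field_simp
          rw [h11]
          exact div_le_self (by positivity) (by linarith)
        have h12 : 0 < y ^ 4 / (8 * Δ : ℝ) := by positivity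
        calc 16 / √(n' : ℝ) ≤ 16 / (y ^ 4 / (8 * Δ)) := by gcongr
          _ = 128 * Δ / y ^ 4 := by field_simp; norm_num
          _ ≤ κ / (2 * y) := by
            rw [div_le_div_iff₀ (by positivity) (by positivity)]
            have h13 : y ^ 2 ≤ y ^ 4 := pow_le_pow_right₀ (by linarith) (by norm_num)
            nlinarith [mul_le_mul_of_nonneg_right hy3 hy0.le,
              mul_le_mul_of_nonneg_left h13 hκ0.le]
      have h14 : 2 * (y ^ 17 * Real.exp (-y)) / y ≤ κ / 4 / y := by
        gcongr
        linarith
      have h15 : 2 * (κ / 4 / y) + κ / (2 * y) = κ / y := by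
        field_simp
        norm_num
      linarith

/-- Most subsets of a set of large minimum degree leave a large degree into both parts. -/
lemma exists_even_splits {V : Type*} [DecidableEq V] {G : SimpleGraph V} {B : Finset V} {v : V}
    {k n : ℕ} {c τ b : ℝ} (hB : #B = n) (hv : v ∈ B) (hn : 2 ≤ n) (hk : k ≤ n - 1) (hτ : 0 ≤ τ)
    (hc : 0 ≤ c) (hdeg : ∀ u ∈ B, c * n ≤ #(nbrs G B u))
    (hb : n * (2 * (n * Real.exp (-(τ ^ 2 / (2 * n))))) = b) :
    ∃ F ⊆ powersetCard k (B.erase v), (1 - b) * (n - 1).choose k ≤ #F ∧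
      ∀ S ∈ F, ∀ u ∈ B, c * k - (τ + 2) ≤ #(nbrs G S u) ∧
        c * (n - k) - (τ + 2) ≤ #(nbrs G (B \ S) u) := by
  classical
  have hE : #(B.erase v) = n - 1 := by rw [card_erase_of_mem hv, hB]
  have hEr : (#(B.erase v) : ℝ) = n - 1 := by
    rw [hE, Nat.cast_sub (by omega), Nat.cast_one]
  have hn2 : (2 : ℝ) ≤ n := by exact_mod_cast hn
  have hkr : (k : ℝ) ≤ n - 1 := by
    rw [← hEr, hE]
    exact_mod_cast hk
  have hc1 : c ≤ 1 := by
    have h1 : (#(nbrs G B v) : ℝ) ≤ n := by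
      exact_mod_cast hB ▸ card_le_card (nbrs_subset G B v)
    nlinarith [hdeg v hv]
  have hD : ∀ u ∈ B, nbrs G (B.erase v) u ⊆ B.erase v := fun u _ => nbrs_subset _ _ _
  obtain ⟨P, hP⟩ : ∃ P : Finset V → Prop, ∀ S, P S ↔ ∀ u ∈ B,
      (k * #(nbrs G (B.erase v) u) / #(B.erase v) - τ : ℝ) ≤ #(S ∩ nbrs G (B.erase v) u) ∧
        ((#(B.erase v) - k) * #(nbrs G (B.erase v) u) / #(B.erase v) - τ : ℝ) ≤
          #(nbrs G (B.erase v) u \ S) := ⟨_, fun _ => Iff.rfl⟩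
  have hbad := card_powersetCard_uneven_le hD (hk.trans hE.ge) (by omega) hτ
  simp_rw [← hP] at hbad
  have hsum := card_filter_add_card_filter_not (s := powersetCard k (B.erase v)) P
  rw [card_powersetCard, hE] at hsum
  refine ⟨_, filter_subset P _, ?_, fun S hS u hu => ?_⟩
  rotate_left
  · obtain ⟨hS, hS2⟩ := mem_filter.1 hS
    obtain ⟨hSE, hSk⟩ := mem_powersetCard.1 hS
    obtain ⟨h1, h2⟩ := (hP S).1 hS2 u hu
    have hDu : c * n - 1 ≤ (#(nbrs G (B.erase v) u) : ℝ) := by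
      have h3 : nbrs G B u ⊆ insert v (nbrs G (B.erase v) u) := fun w hw => by
        by_cases hwv : w = v <;> simp_all
      have h4 := (card_le_card h3).trans (card_insert_le _ _)
      have h5 : (#(nbrs G B u) : ℝ) ≤ #(nbrs G (B.erase v) u) + 1 := by exact_mod_cast h4
      linarith [hdeg u hu]
    have hfrac : ∀ m : ℝ, 0 ≤ m → m ≤ n - 1 →
        c * m - 1 ≤ m * #(nbrs G (B.erase v) u) / (n - 1) := fun m hm0 hm1 => by
      rw [le_div_iff₀ (by linarith)]
      nlinarith [mul_le_mul_of_nonneg_left hDu hm0]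
    rw [hEr] at h1 h2
    constructor
    · have h3 : S ∩ nbrs G (B.erase v) u ⊆ nbrs G S u := fun w hw => by
        simp_all
      have h4 : (#(S ∩ nbrs G (B.erase v) u) : ℝ) ≤ #(nbrs G S u) := by
        exact_mod_cast card_le_card h3
      linarith [hfrac k (by positivity) hkr]
    · have h3 : nbrs G (B.erase v) u \ S ⊆ nbrs G (B \ S) u := fun w hw => by
        simp_all
      have h4 : (#(nbrs G (B.erase v) u \ S) : ℝ) ≤ #(nbrs G (B \ S) u) := by
        exact_mod_cast card_le_card h3
      nlinarith [hfrac (n - 1 - k) (by linarith) (by linarith [Nat.cast_nonneg (α := ℝ) k])]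
  · have hexp : Real.exp (-(τ ^ 2 / (2 * (n - 1)))) ≤ Real.exp (-(τ ^ 2 / (2 * n))) := by
      refine Real.exp_le_exp.2 (neg_le_neg ?_)
      exact div_le_div_of_nonneg_left (by positivity) (by linarith) (by linarith)
    have hle : (#B : ℝ) * (2 * ((#(B.erase v) + 1) *
        Real.exp (-(τ ^ 2 / (2 * #(B.erase v)))) * (#(B.erase v)).choose k)) ≤
          b * (n - 1).choose k := by
      rw [hEr, hE, hB, ← hb, sub_add_cancel]
      calc _ = (n : ℝ) * (2 * (n * Real.exp (-(τ ^ 2 / (2 * (n - 1)))))) * (n - 1).choose k := by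
            ring
        _ ≤ _ := by gcongr
    have hsum' := congrArg (Nat.cast (R := ℝ)) hsum
    rw [Nat.cast_add] at hsum'
    have := hbad.trans hle
    linarith

set_option maxHeartbeats 800000 in
/-- Bounded degree spanning trees embed randomly and with good spread. -/
theorem exists_isSpreadEmb (Δ : ℕ) (hΔ : 1 ≤ Δ) (α : ℝ) (hα : 0 < α) :
    ∃ (m : ℕ) (K : ℝ), 0 < K ∧ ∀ n ≥ m, ∀ (ι V : Type) [DecidableEq ι] [DecidableEq V]
      (G : SimpleGraph V) (par : ι → ι) (dep : ι → ℕ) (A : Finset ι) (B : Finset V) (r : ι)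
      (v : V), #A = n → #B = n → IsRootedTree par dep Δ A r → v ∈ B →
      (∀ u ∈ B, (1 / 2 + α - spreadError n) * n ≤ #(nbrs G B u)) →
      ∃ μ, IsSpreadEmb G par B A r v (K * (2 - spreadError n)) μ := by
  obtain ⟨n₀, hn₀⟩ := exists_embedding Δ hΔ (α / 2) (by positivity)
  obtain ⟨m₁, hm₁⟩ := Filter.eventually_atTop.1 <| (eventually_spreadError_sub Δ hΔ).and
    (eventually_spreadError_le (half_pos hα))
  obtain ⟨m, hm⟩ : ∃ m, m = max (max n₀ m₁) 2 := ⟨_, rfl⟩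
  have hΔ' : (1 : ℝ) ≤ Δ := by exact_mod_cast hΔ
  have hm2 : (2 : ℝ) ≤ m := by exact_mod_cast (by omega : 2 ≤ m)
  refine ⟨m, 8 * Δ * m, by positivity, fun n => ?_⟩
  induction n using Nat.strong_induction_on with
  | _ n ih =>
  intro hn ι V _ _ G par dep A B r v hA hB hT hv hdeg
  obtain ⟨⟨b, τ, hb0, hb1, hτ0, hb, hsub⟩, hx⟩ := hm₁ n (by omega)
  have hx1 := spreadError_le_one n (by omega)
  have hx0 := spreadError_nonneg n
  rcases lt_or_ge n (8 * Δ * m) with hlt | hge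
  · obtain ⟨φ, hφ⟩ := hn₀ ι V G par dep A B r v (by omega) (by omega) hT hv fun u hu => by
      refine le_trans ?_ (hdeg u hu)
      rw [hB]
      gcongr
      linarith
    refine ⟨PMF.pure φ, fun f hf => ?_, fun X hX h => ?_⟩
    · rw [PMF.support_pure, Set.mem_singleton_iff] at hf
      rwa [hf]
    · refine (PMF.toOuterMeasure_le_one _ _).trans ?_
      rw [← ENNReal.ofReal_one]
      refine ENNReal.ofReal_le_ofReal ?_
      have hXc : #X ≤ n - 1 := by
        rw [← hA, ← card_erase_of_mem hT.root_mem]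
        exact card_le_card hX
      have hpos : (0 : ℝ) < (#A - 1).descFactorial #X := by
        exact_mod_cast Nat.pos_of_ne_zero fun h0 => by
          rw [Nat.descFactorial_eq_zero_iff_lt] at h0
          omega
      rw [one_le_div hpos]
      have h1 : ((#A - 1).descFactorial #X : ℝ) ≤ (8 * Δ * m : ℝ) ^ #X := by
        exact_mod_cast (Nat.descFactorial_le_pow _ _).trans (Nat.pow_le_pow_left (by omega) _)
      refine h1.trans (pow_le_pow_left₀ (by positivity) ?_ _)
      exact le_mul_of_one_le_right (by positivity) (by linarith)
  · have hnm : 8 * Δ * m ≤ n := hge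
    have h8 : 8 * Δ * 2 ≤ 8 * Δ * m := Nat.mul_le_mul_left _ (by omega)
    have hM4 : 4 * Δ * (n / (4 * Δ)) ≤ n := Nat.mul_div_le _ _
    have hM5 : n < 4 * Δ * (n / (4 * Δ) + 1) := Nat.lt_mul_div_succ n (by positivity)
    have hM1 : 1 ≤ n / (4 * Δ) := (Nat.one_le_div_iff (by positivity)).2 (by omega)
    obtain ⟨M, hM⟩ : ∃ M, M = n / (4 * Δ) := ⟨_, rfl⟩
    rw [← hM] at hM1 hM4 hM5
    have hM4' : 4 * (Δ * M) ≤ n := by linarith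
    obtain ⟨q, Q, hQA, hqr, hMQ, hQM, hQ, hAQ, hq⟩ := hT.exists_branch hΔ hM1 (by omega)
    obtain ⟨k, hk⟩ : ∃ k, k = #Q := ⟨_, rfl⟩
    rw [← hk] at hMQ hQM
    have hAQc : #(A \ Q) = n - k := by rw [card_sdiff_of_subset hQA, hA, hk]
    have hΔM : Δ * M ≤ Δ * k := Nat.mul_le_mul_left _ hMQ
    have hk8 : n ≤ 8 * Δ * k := by
      have : 4 * Δ * 1 ≤ 4 * Δ * M := Nat.mul_le_mul_left _ hM1
      nlinarith
    have hk4 : 4 * k ≤ n := by omega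
    have h81 : (8 * Δ - 1) * n = 8 * Δ * n - n := by rw [Nat.sub_mul, one_mul]
    have hΔn : 8 * n ≤ 8 * Δ * n := Nat.mul_le_mul_right _ (by omega)
    have hk8' : 8 * Δ * k ≤ (8 * Δ - 1) * n := by
      rw [h81]
      have : 8 * Δ * (4 * k) ≤ 8 * Δ * n := Nat.mul_le_mul_left _ hk4
      have h3 : 8 * Δ * (4 * k) = 4 * (8 * Δ * k) := by ring
      omega
    have hl8 : n ≤ 8 * Δ * (n - k) := by
      have : 8 * (n - k) ≤ 8 * Δ * (n - k) := Nat.mul_le_mul_right _ (by omega)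
      omega
    have hl8' : 8 * Δ * (n - k) ≤ (8 * Δ - 1) * n := by
      rw [h81, Nat.mul_sub]
      omega
    have hge' : ∀ n', n ≤ 8 * Δ * n' → m ≤ n' := fun n' h => by
      by_contra hlt
      have h3 : 8 * Δ * (n' + 1) ≤ 8 * Δ * m := Nat.mul_le_mul_left _ (by omega)
      rw [mul_add] at h3
      omega
    have hmk := hge' k hk8
    have hml := hge' (n - k) hl8
    obtain ⟨hτk, hbk⟩ := hsub k hk8 hk8'
    obtain ⟨hτl, hbl⟩ := hsub (n - k) hl8 hl8'
    have hcast : ((n - k : ℕ) : ℝ) = n - k := Nat.cast_sub (by omega)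
    obtain ⟨F, hF, hFc, hFdeg⟩ := exists_even_splits (k := k) hB hv (by omega) (by omega) hτ0
      (by linarith) hdeg hb
    have hxk1 := spreadError_le_one k (by omega)
    have hxl1 := spreadError_le_one (n - k) (by omega)
    have hxk := (hm₁ k (by omega)).2
    have hK0 : (0 : ℝ) < 8 * Δ * m := by positivity
    have hcardS : ∀ S ∈ F, S ⊆ B ∧ #S = k := fun S hS =>
      have h := mem_powersetCard.1 (hF hS)
      ⟨h.1.trans (erase_subset _ _), h.2⟩
    have hsq : (0 : ℝ) < √(k : ℝ) := Real.sqrt_pos.2 (by exact_mod_cast (by omega : 0 < k))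
    have hsq1 : (1 : ℝ) ≤ √(k : ℝ) := Real.one_le_sqrt.2 (by exact_mod_cast (by omega : 1 ≤ k))
    have hdegS : ∀ S ∈ F, ∀ u ∈ B, (1 / 2 + α - spreadError k) * k ≤ #(nbrs G S u) :=
      fun S hS u hu => by linarith [(hFdeg S hS u hu).1]
    refine exists_isSpreadEmb_of_split (K₁ := 8 * Δ * m * (2 - spreadError (n - k)))
      (K₂ := 8 * Δ * m * (2 - spreadError k)) (hA.trans hB.symm) hQA hQ hAQ hq hv (hk ▸ hF)
      (by rwa [hA, ← hk]) hb0 hb1 (mul_nonneg hK0.le (by linarith)) ?_ ?_ ?_ ?_ ?_ ?_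
    · have h16 : (16 : ℝ) ≤ 8 * Δ * m := by nlinarith
      nlinarith
    · have h1 : 0 ≤ 16 / √((n - k : ℕ) : ℝ) := by positivity
      rw [mul_left_comm]
      refine mul_le_mul_of_nonneg_left ?_ hK0.le
      nlinarith
    · rw [← hk, mul_left_comm, mul_left_comm (1 - b)]
      refine mul_le_mul_of_nonneg_left ?_ hK0.le
      obtain ⟨z, hz⟩ : ∃ z : ℝ, z = 1 / √(k : ℝ) := ⟨_, rfl⟩
      have hz0 : 0 ≤ z := by rw [hz]; positivity
      have hz1 : z ≤ 1 := by rw [hz]; exact (div_le_one hsq).2 hsq1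
      have h2z : 2 / √(k : ℝ) = 2 * z := by rw [hz]; ring
      have h16z : 16 / √(k : ℝ) = 16 * z := by rw [hz]; ring
      rw [h16z] at hbk
      rw [h2z]
      have hxk0 := spreadError_nonneg k
      have h1 : (1 + 2 * z) ^ 2 ≤ 1 + 8 * z := by nlinarith
      have h2 : (1 + 2 * z) ^ 2 * (2 - spreadError k) ≤ (1 + 8 * z) * (2 - spreadError k) :=
        mul_le_mul_of_nonneg_right h1 (by linarith)
      linarith [mul_nonneg hz0 hxk0, mul_nonneg hb0 hx0]
    · intro S hS u hu
      rw [← hk]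
      have hk0 : (0 : ℝ) ≤ k := by positivity
      nlinarith [hdegS S hS u hu]
    · intro S hS
      obtain ⟨hSB, hSk⟩ := hcardS S hS
      have hvS : v ∈ B \ S := mem_sdiff.2 ⟨hv, fun h =>
        (mem_erase.1 ((mem_powersetCard.1 (hF hS)).1 h)).1 rfl⟩
      refine ih (n - k) (by omega) hml ι V G par dep (A \ Q) (B \ S) r v hAQc
        (by rw [card_sdiff_of_subset hSB, hB, hSk]) hAQ hvS fun u hu => ?_
      have := (hFdeg S hS u (mem_sdiff.1 hu).1).2
      rw [← hcast] at this
      linarith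
    · intro S hS w hw
      obtain ⟨hSB, hSk⟩ := hcardS S hS
      exact ih k (by omega) hmk ι V G par dep Q S q w hk.symm hSk hQ hw
        fun u hu => hdegS S hS u (hSB hu)

lemma pow_le_four_pow_mul_descFactorial : ∀ {N s : ℕ}, s ≤ N →
    (N : ℝ) ^ s ≤ 4 ^ s * N.descFactorial s := by
  intro N
  induction N with
  | zero =>
    intro s hs
    obtain rfl : s = 0 := by omega
    simp
  | succ N ih =>
    intro s hs
    rcases s with _ | s
    · simp
    have hsN : s ≤ N := by omega
    have h1 : ((N + 1 : ℕ) : ℝ) ^ s ≤ 4 * (N : ℝ) ^ s := by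
      rcases Nat.eq_zero_or_pos N with rfl | hN
      · obtain rfl : s = 0 := by omega
        norm_num
      have hN' : (0 : ℝ) < N := by exact_mod_cast hN
      have h2 : ((N + 1 : ℕ) : ℝ) = (1 + 1 / N) * N := by
        push_cast
        field_simp
      rw [h2, mul_pow]
      gcongr
      calc (1 + 1 / (N : ℝ)) ^ s ≤ Real.exp (1 / N) ^ s := by
            gcongr
            rw [add_comm]
            exact Real.add_one_le_exp _
        _ = Real.exp (s * (1 / N)) := (Real.exp_nat_mul _ _).symm
        _ ≤ Real.exp 1 := by
          refine Real.exp_le_exp.2 ?_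
          rw [mul_one_div, div_le_one hN']
          exact_mod_cast hsN
        _ ≤ 4 := by linarith [Real.exp_one_lt_d9]
    rw [Nat.succ_descFactorial_succ, Nat.cast_mul, pow_succ]
    calc ((N + 1 : ℕ) : ℝ) ^ s * ((N + 1 : ℕ) : ℝ) ≤
          4 * (4 ^ s * N.descFactorial s) * ((N + 1 : ℕ) : ℝ) := by
          gcongr
          exact h1.trans (by gcongr; exact ih hsN)
      _ = _ := by push_cast; ring

lemma pow_div_descFactorial_le {K : ℝ} (hK : 0 ≤ K) {n s : ℕ} (hn : 2 ≤ n) (hs : s ≤ n - 1) :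
    K ^ s / (n - 1).descFactorial s ≤ (8 * K / n) ^ s := by
  have hpos : (0 : ℝ) < (n - 1).descFactorial s := by
    exact_mod_cast Nat.pos_of_ne_zero fun h0 => by
      rw [Nat.descFactorial_eq_zero_iff_lt] at h0
      omega
  have hn' : (2 : ℝ) ≤ n := by exact_mod_cast hn
  have h1 := pow_le_four_pow_mul_descFactorial hs
  rw [Nat.cast_sub (by omega), Nat.cast_one] at h1
  have h2 : (n : ℝ) ^ s ≤ 8 ^ s * (n - 1).descFactorial s := by
    calc (n : ℝ) ^ s ≤ (2 * (n - 1)) ^ s := by gcongr; linarith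
      _ = 2 ^ s * (n - 1 : ℝ) ^ s := mul_pow _ _ _
      _ ≤ 2 ^ s * (4 ^ s * (n - 1).descFactorial s) := by gcongr
      _ = _ := by rw [← mul_assoc, ← mul_pow]; norm_num
  rw [div_pow, mul_pow, div_le_div_iff₀ hpos (by positivity)]
  calc K ^ s * (n : ℝ) ^ s ≤ K ^ s * (8 ^ s * (n - 1).descFactorial s) := by gcongr
    _ = _ := by ring

/-- Rooting a tree at a vertex. -/
lemma SimpleGraph.IsTree.exists_isRootedTree {ι : Type*} [Fintype ι] [DecidableEq ι]
    {T : SimpleGraph ι} [DecidableRel T.Adj] (hT : T.IsTree) {Δ : ℕ} (hΔ : T.maxDegree ≤ Δ)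
    (t : ι) : ∃ par : ι → ι, IsRootedTree par (T.dist t) Δ univ t ∧
      ∀ a b, T.Adj a b → (a ≠ t ∧ par a = b) ∨ (b ≠ t ∧ par b = a) := by
  choose p hp hpl using fun x => hT.connected.exists_path_of_dist t x
  have hnil : ∀ x, x ≠ t → ¬(p x).Nil := fun x hx h => hx h.eq.symm
  have hadj : ∀ x, x ≠ t → T.Adj (p x).penultimate x := fun x hx =>
    (p x).adj_penultimate (hnil x hx)
  have hdist : ∀ x, x ≠ t → T.dist t x = T.dist t (p x).penultimate + 1 := fun x hx => by
    rcases hT.dist_eq_dist_add_one_of_adj t (hadj x hx) with h | h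
    · have h1 := SimpleGraph.dist_le (p x).dropLast
      have h2 := hpl x
      have h3 : (p x).dropLast.length ≤ (p x).length := by
        simp
      omega
    · exact h
  have hpen : ∀ a b, T.Adj a b → T.dist t b = T.dist t a + 1 → b ≠ t ∧ (p b).penultimate = a := by
    intro a b hab hd
    have hb : b ≠ t := by
      rintro rfl
      simp at hd
    refine ⟨hb, ?_⟩
    have h1 : ((p a).concat hab).IsPath := by
      refine SimpleGraph.Walk.isPath_of_length_eq_dist _ ?_
      rw [SimpleGraph.Walk.length_concat, hpl, hd]
    rw [(hT.existsUnique_path t b).unique (hp b) h1, SimpleGraph.Walk.penultimate_concat]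
  refine ⟨fun x => (p x).penultimate, ⟨mem_univ _, fun _ _ _ => mem_univ _,
    fun x _ hx => hdist x hx, fun y => ?_⟩, fun a b hab => ?_⟩
  · refine le_trans (card_le_card ?_) ((T.degree_le_maxDegree y).trans hΔ)
    intro x hx
    obtain ⟨-, h1, h2⟩ := mem_filter.1 hx
    have hxt : x ≠ t := by
      rintro rfl
      simp at h2
    rw [SimpleGraph.mem_neighborFinset, ← h1]
    exact hadj x hxt
  · rcases hT.dist_eq_dist_add_one_of_adj t hab with h | h
    · exact Or.inl (hpen b a hab.symm h)
    · exact Or.inr (hpen a b hab h)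

/-- A distribution supported on a property can be viewed as a distribution on the subtype. -/
lemma PMF.exists_subtype {β : Type*} (p : PMF β) {P : β → Prop} (h : ∀ a ∈ p.support, P a) :
    ∃ q : PMF {a // P a}, ∀ s : Set β, q.toOuterMeasure {a | a.1 ∈ s} = p.toOuterMeasure s := by
  classical
  obtain ⟨a₀, ha₀⟩ := p.support_nonempty
  refine ⟨p.map fun a => if ha : P a then ⟨a, ha⟩ else ⟨a₀, h a₀ ha₀⟩, fun s => ?_⟩
  rw [PMF.toOuterMeasure_map_apply]
  refine PMF.toOuterMeasure_apply_eq_of_inter_support_eq p ?_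
  ext a
  simp only [Set.mem_inter_iff, Set.mem_preimage, Set.mem_ofPred_eq, and_congr_left_iff]
  intro ha
  rw [dif_pos (h a ha)]

/-- rooted spread embedding theorem.
For every `Δ ∈ ℕ` and `α > 0` there exist `C⋆, n₀ ∈ ℕ` such that for all `n ≥ n₀`:
if `G` is an `n`-vertex graph with `δ(G) ≥ (1/2+α)n`, `T` is an `n`-vertex tree with
`Δ(T) ≤ Δ`, `t ∈ V(T)` and `v ∈ V(G)`, then there is a random embedding `φ` of `T`
into `G` with `φ(t) = v` almost surely, whose restriction to `V(T) \ {t}` is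
`(C⋆/n)`-spread. -/
theorem stmt_1 (Δ : ℕ) (α : ℝ) (hα : 0 < α) :
    ∃ Cstar n₀ : ℕ, ∀ n : ℕ, n₀ ≤ n →
      ∀ (G T : SimpleGraph (Fin n)) [DecidableRel G.Adj] [DecidableRel T.Adj],
        (1 / 2 + α) * n ≤ (G.minDegree : ℝ) →
        T.IsTree → T.maxDegree ≤ Δ →
        ∀ t v : Fin n,
        ∃ μ : PMF {f : Fin n → Fin n //
            Function.Injective f ∧ ∀ a b, T.Adj a b → G.Adj (f a) (f b)},
          μ.toOuterMeasure {f | f.1 t = v} = 1 ∧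
          ∀ (s : ℕ) (x : Fin s → Fin n) (y : Fin s → Fin n),
            (∀ i, x i ≠ t) →
            Function.Injective x → Function.Injective y →
            μ.toOuterMeasure {f | ∀ i, f.1 (x i) = y i} ≤
              ENNReal.ofReal (((Cstar : ℝ) / n) ^ s) := by
  obtain ⟨m, K, hK, hm⟩ := exists_isSpreadEmb (Δ + 1) (by omega) α hα
  refine ⟨⌈16 * K⌉₊, max m 2, fun n hn G T _ _ hG hT hTΔ t v => ?_⟩
  have hn2 : 2 ≤ n := (le_max_right _ _).trans hn
  obtain ⟨par, hpar, hparadj⟩ := hT.exists_isRootedTree (hTΔ.trans (Nat.le_succ Δ)) t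
  obtain ⟨ν, hν⟩ := hm n ((le_max_left _ _).trans hn) (Fin n) (Fin n) G par _ univ univ t v
    (by simp) (by simp) hpar (mem_univ v) fun u _ => by
      have h1 : #(nbrs G univ u) = G.degree u := by
        rw [← SimpleGraph.card_neighborFinset_eq_degree]
        congr 1
        ext w
        simp
      have h2 : (G.minDegree : ℝ) ≤ G.degree u := by exact_mod_cast G.minDegree_le_degree u
      rw [h1]
      nlinarith [mul_nonneg (spreadError_nonneg n) (Nat.cast_nonneg (α := ℝ) n)]
  have hgood : ∀ f ∈ ν.support,
      Function.Injective f ∧ ∀ a b, T.Adj a b → G.Adj (f a) (f b) := fun f hf => by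
    have hf' := hν.isEmb f hf
    refine ⟨fun a b hab => hf'.inj (by simp) (by simp) hab, fun a b hab => ?_⟩
    rcases hparadj a b hab with ⟨h1, rfl⟩ | ⟨h1, rfl⟩
    · exact (hf'.adj a (mem_univ a) h1).symm
    · exact hf'.adj b (mem_univ b) h1
  obtain ⟨μ, hμ⟩ := ν.exists_subtype hgood
  refine ⟨μ, ?_, fun s x y hxt hx _ => ?_⟩
  · refine (hμ {f | f t = v}).trans ((PMF.toOuterMeasure_apply_eq_one_iff _ _).2 fun f hf => ?_)
    exact (hν.isEmb f hf).root
  · refine (hμ {f | ∀ i, f (x i) = y i}).trans_le ?_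
    have hcard : #(univ.map ⟨x, hx⟩) = s := by simp
    have hsub : univ.map ⟨x, hx⟩ ⊆ univ.erase t := fun a ha => by
      obtain ⟨i, -, rfl⟩ := mem_map.1 ha
      exact mem_erase.2 ⟨hxt i, mem_univ _⟩
    have hs : s ≤ n - 1 := by
      have := card_le_card hsub
      rwa [hcard, card_erase_of_mem (mem_univ t), card_univ, Fintype.card_fin] at this
    have hspread := hν.spread _ hsub (Function.extend x y id)
    rw [hcard, card_univ, Fintype.card_fin] at hspread
    have hset : {f : Fin n → Fin n | ∀ i, f (x i) = y i} =
        {f | ∀ a ∈ univ.map ⟨x, hx⟩, f a = Function.extend x y id a} := by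
      ext f
      simp [hx.extend_apply]
    rw [hset]
    refine hspread.trans (ENNReal.ofReal_le_ofReal ?_)
    have hx0 := spreadError_nonneg n
    have hx1 := spreadError_le_one n (by omega)
    have hK0 : 0 ≤ K * (2 - spreadError n) := mul_nonneg hK.le (by linarith)
    refine (pow_div_descFactorial_le hK0 hn2 hs).trans ?_
    gcongr
    refine le_trans ?_ (Nat.le_ceil _)
    nlinarith
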